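/- For n ∈ {4, 5}, the unit ball B^n is irreducible (every origin-symmetric convex body K properly contained in B^n satisfies d_K < d_{B^n}) but is not a local pessimum for lattice packing: for every ε > 0 there exists an origin-symmetric convex body K with Hausdorff distance δ_H(K, B^n) < ε and φ(K) < φ(B^n). -/

import Mathlib

open scoped RealInnerProductSpace
open Metric MeasureTheory

noncomputable section

abbrev Euc (n : ℕ) := EuclideanSpace ℝ (Fin n)

/-- The rank-one symmetric map `P_x : y ↦ ⟪y, x⟫ • x`. -/
def projMap {F : Type*} [NormedAddCommGroup F] [InnerProductSpace ℝ F] (x : F) :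
    F →ₗ[ℝ] F where
  toFun y := (⟪y, x⟫) • x
  map_add' y z := by simp [inner_add_left, add_smul]
  map_smul' c y := by simp [real_inner_smul_left, mul_smul]

/-- A configuration is perfect if the maps `P_x`, `x ∈ S`, span the symmetric maps. -/
def IsPerfectCfg {F : Type*} [NormedAddCommGroup F] [InnerProductSpace ℝ F]
    (S : Set F) : Prop :=
  ∀ T : F →ₗ[ℝ] F, T.IsSymmetric → T ∈ Submodule.span ℝ (projMap '' S)

/-- A configuration is eutactic if `Id = Σ_{x∈S} υ_x P_x` with `υ_x > 0`, `υ_x = υ_{-x}`. -/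
def IsEutacticCfg {F : Type*} [NormedAddCommGroup F] [InnerProductSpace ℝ F]
    (S : Set F) : Prop :=
  ∃ υ : F → ℝ, (∀ x ∈ S, 0 < υ x) ∧ (∀ x ∉ S, υ x = 0) ∧
    (Function.support υ).Finite ∧ (∀ x, υ x = υ (-x)) ∧
    ∑ᶠ x, υ x • projMap x = (LinearMap.id : F →ₗ[ℝ] F)

/-- A configuration is semi-eutactic if `Id = Σ_{x∈S} υ_x P_x` with `υ_x ≥ 0`, `υ_x = υ_{-x}`. -/
def IsSemiEutacticCfg {F : Type*} [NormedAddCommGroup F] [InnerProductSpace ℝ F]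
    (S : Set F) : Prop :=
  ∃ υ : F → ℝ, (∀ x ∈ S, 0 ≤ υ x) ∧ (∀ x ∉ S, υ x = 0) ∧
    (Function.support υ).Finite ∧ (∀ x, υ x = υ (-x)) ∧
    ∑ᶠ x, υ x • projMap x = (LinearMap.id : F →ₗ[ℝ] F)

/-- A configuration is extreme if it is perfect and eutactic. -/
def IsExtremeCfg {F : Type*} [NormedAddCommGroup F] [InnerProductSpace ℝ F]
    (S : Set F) : Prop :=
  IsPerfectCfg S ∧ IsEutacticCfg S

/-- Hilbert–Schmidt (Frobenius) norm of a linear map on `ℝ^n`. -/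
def frobNorm {n : ℕ} (T : Euc n →ₗ[ℝ] Euc n) : ℝ :=
  Real.sqrt (∑ j, ∑ i, (T (EuclideanSpace.single j 1) i) ^ 2)

/-- The lattice `T ℤ^n` as a set of points. -/
def latticeSet {n : ℕ} (T : Euc n →ₗ[ℝ] Euc n) : Set (Euc n) :=
  {v | ∃ z : Fin n → ℤ, v = T (∑ i, (z i : ℝ) • EuclideanSpace.single i 1)}

/-- A set is an (n-dimensional) lattice if it is `T ℤ^n` for an invertible `T`. -/
def IsLattice {n : ℕ} (Λ : Set (Euc n)) : Prop :=
  ∃ T : Euc n →ₗ[ℝ] Euc n, LinearMap.det T ≠ 0 ∧ Λ = latticeSet T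

/-- The determinant `d(Λ) = |det T|` of a lattice. -/
def latDet {n : ℕ} (Λ : Set (Euc n)) : ℝ :=
  sInf {d | ∃ T : Euc n →ₗ[ℝ] Euc n, Λ = latticeSet T ∧ d = |LinearMap.det T|}

/-- The metric `δ(Λ, Λ') = inf ‖T - T'‖` on the space of lattices. -/
def latDist {n : ℕ} (Λ Λ' : Set (Euc n)) : ℝ :=
  sInf {d | ∃ T T' : Euc n →ₗ[ℝ] Euc n,
    Λ = latticeSet T ∧ Λ' = latticeSet T' ∧ d = frobNorm (T - T')}

/-- The minimal norm `m(Λ)`. -/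
def minNorm {n : ℕ} (Λ : Set (Euc n)) : ℝ :=
  sInf {r | ∃ x ∈ Λ, x ≠ 0 ∧ r = ‖x‖ ^ 2}

/-- The set `S(Λ)` of minimal vectors of a lattice. -/
def minVecs {n : ℕ} (Λ : Set (Euc n)) : Set (Euc n) :=
  {x | x ∈ Λ ∧ x ≠ 0 ∧ ‖x‖ ^ 2 = minNorm Λ}

/-- An origin-symmetric convex body. -/
structure IsSymCB {n : ℕ} (K : Set (Euc n)) : Prop where
  convex : Convex ℝ K
  compact : IsCompact K
  nonempty_interior : (interior K).Nonempty
  symm : -K = K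

/-- A lattice is admissible for a body if it meets the interior only at the origin. -/
def IsAdmissible {n : ℕ} (Λ K : Set (Euc n)) : Prop :=
  Λ ∩ interior K ⊆ {0}

/-- The critical determinant `d_K`. -/
def critDet {n : ℕ} (K : Set (Euc n)) : ℝ :=
  sInf {d | ∃ Λ : Set (Euc n), IsLattice Λ ∧ IsAdmissible Λ K ∧ d = latDet Λ}

/-- A critical lattice of `K`: an admissible lattice attaining the critical determinant. -/
def IsCriticalLattice {n : ℕ} (Λ K : Set (Euc n)) : Prop :=
  IsLattice Λ ∧ IsAdmissible Λ K ∧ latDet Λ = critDet K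

/-- The optimal lattice packing fraction `φ(K) = 2⁻ⁿ vol(K) / d_K`. -/
def packFrac {n : ℕ} (K : Set (Euc n)) : ℝ :=
  (volume K).toReal / (2 ^ n * critDet K)

/-- The closed unit ball `Bⁿ`. -/
def unitBall (n : ℕ) : Set (Euc n) := Metric.closedBall 0 1

/-- The support function of a body. -/
def suppFn {n : ℕ} (K : Set (Euc n)) (x : Euc n) : ℝ :=
  sSup ((fun y => ⟪x, y⟫) '' K)

/-- The radial function of a body. -/
def radFn {n : ℕ} (K : Set (Euc n)) (x : Euc n) : ℝ :=
  sSup {t : ℝ | 0 ≤ t ∧ t • x ∈ K}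

section
open scoped RealInnerProductSpace
open Metric MeasureTheory

/-- the lattice generated by a family -/
def Lb {n k : ℕ} (b : Fin k → Euc n) : Set (Euc n) := {v | ∃ z : Fin k → ℤ, v = ∑ i, (z i : ℝ) • b i}

/-- matrix with columns `b j` -/
def cmat {n : ℕ} (b : Fin n → Euc n) : Matrix (Fin n) (Fin n) ℝ := Matrix.of fun i j => b j i

def gdet {n : ℕ} (b : Fin n → Euc n) : ℝ := (cmat b).det

def gram {n k : ℕ} (b : Fin k → Euc n) : Matrix (Fin k) (Fin k) ℝ := Matrix.of fun i j => ⟪b i, b j⟫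

/-- linear map with given columns -/
def tvec {n : ℕ} (b : Fin n → Euc n) : Euc n →ₗ[ℝ] Euc n :=
  (EuclideanSpace.basisFun (Fin n) ℝ).toBasis.constr ℝ b

lemma tvec_single {n : ℕ} (b : Fin n → Euc n) (i : Fin n) :
    tvec b (EuclideanSpace.single i 1) = b i := by
  have := (EuclideanSpace.basisFun (Fin n) ℝ).toBasis.constr_basis ℝ b i
  simpa [tvec] using this

lemma tvec_of {n : ℕ} (T : Euc n →ₗ[ℝ] Euc n) :
    tvec (fun i => T (EuclideanSpace.single i 1)) = T := by
  apply (EuclideanSpace.basisFun (Fin n) ℝ).toBasis.ext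
  intro i
  simp [tvec_single]

lemma latticeSet_tvec {n : ℕ} (b : Fin n → Euc n) : latticeSet (tvec b) = Lb b := by
  ext v
  simp [latticeSet, Lb, tvec_single]

lemma det_tvec {n : ℕ} (b : Fin n → Euc n) : LinearMap.det (tvec b) = gdet b := by
  rw [← LinearMap.det_toMatrix (EuclideanSpace.basisFun (Fin n) ℝ).toBasis]
  congr 1
  ext i j
  simp [LinearMap.toMatrix_apply, tvec_single, cmat]

lemma gram_eq {n : ℕ} (b : Fin n → Euc n) : gram b = (cmat b).transpose * cmat b := by
  ext i j
  simp [gram, cmat, Matrix.mul_apply, PiLp.inner_apply, mul_comm]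

lemma gdet_sq {n : ℕ} (b : Fin n → Euc n) : gdet b ^ 2 = (gram b).det := by
  rw [gram_eq, Matrix.det_mul, Matrix.det_transpose, gdet, sq]

lemma gdet_comb {n : ℕ} (b c : Fin n → Euc n) (M : Matrix (Fin n) (Fin n) ℝ)
    (h : ∀ j, c j = ∑ i, M i j • b i) : gdet c = gdet b * M.det := by
  rw [gdet, gdet, ← Matrix.det_mul]
  congr 1
  ext i j
  simp [cmat, h, Matrix.mul_apply, mul_comm]

lemma gdet_ne_zero_iff {n : ℕ} (b : Fin n → Euc n) : gdet b ≠ 0 ↔ LinearIndependent ℝ b := by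
  rw [← det_tvec]
  constructor
  · intro h
    have hk := LinearMap.ker_eq_bot_iff_range_eq_top.2 (LinearMap.range_eq_top.2
      (LinearEquiv.surjective (LinearMap.equivOfDetNeZero (tvec b) h)))
    have := (EuclideanSpace.basisFun (Fin n) ℝ).toBasis.linearIndependent.map' (tvec b) hk
    have e : (⇑(tvec b) ∘ ⇑(EuclideanSpace.basisFun (Fin n) ℝ).toBasis) = b := by
      ext i j
      simp [tvec_single]
    rw [e] at this
    exact this
  · intro h
    have e : IsUnit (tvec b) := by
      rw [Module.End.isUnit_iff]
      have hinj : Function.Injective (tvec b) := by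
        rw [← LinearMap.ker_eq_bot]
        refine (Submodule.eq_bot_iff _).2 ?_
        intro v hv
        have hv' : tvec b v = 0 := hv
        have e1 := (EuclideanSpace.basisFun (Fin n) ℝ).toBasis.sum_repr v
        rw [← e1] at hv'
        simp only [map_sum, map_smul, OrthonormalBasis.coe_toBasis, EuclideanSpace.basisFun_apply, tvec_single] at hv'
        have := (Fintype.linearIndependent_iff.1 h) _ hv'
        rw [← e1]
        exact Finset.sum_eq_zero fun i _ => by rw [this i]; simp
      exact ⟨hinj, LinearMap.surjective_of_injective hinj⟩
    exact ((LinearMap.isUnit_iff_isUnit_det _).1 e).ne_zero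

lemma Lb_add {n k : ℕ} {b : Fin k → Euc n} {u v : Euc n} (hu : u ∈ Lb b) (hv : v ∈ Lb b) : u + v ∈ Lb b := by
  obtain ⟨z, rfl⟩ := hu
  obtain ⟨w, rfl⟩ := hv
  exact ⟨z + w, by simp [add_smul, Finset.sum_add_distrib]⟩

lemma Lb_neg {n k : ℕ} {b : Fin k → Euc n} {u : Euc n} (hu : u ∈ Lb b) : -u ∈ Lb b := by
  obtain ⟨z, rfl⟩ := hu
  exact ⟨-z, by simp⟩

lemma Lb_sub {n k : ℕ} {b : Fin k → Euc n} {u v : Euc n} (hu : u ∈ Lb b) (hv : v ∈ Lb b) : u - v ∈ Lb b := by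
  rw [sub_eq_add_neg]; exact Lb_add hu (Lb_neg hv)

lemma Lb_zsmul {n k : ℕ} {b : Fin k → Euc n} {u : Euc n} (m : ℤ) (hu : u ∈ Lb b) : (m : ℝ) • u ∈ Lb b := by
  obtain ⟨z, rfl⟩ := hu
  exact ⟨fun i => m * z i, by simp [Finset.smul_sum, mul_smul]⟩

lemma Lb_zero {n k : ℕ} {b : Fin k → Euc n} : (0 : Euc n) ∈ Lb b := ⟨0, by simp⟩

lemma Lb_self {n k : ℕ} {b : Fin k → Euc n} (i : Fin k) : b i ∈ Lb b :=
  ⟨fun j => if j = i then 1 else 0, by simp⟩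

lemma Lb_sum {n k : ℕ} {b : Fin k → Euc n} {ι : Type*} (s : Finset ι) (f : ι → Euc n)
    (h : ∀ i ∈ s, f i ∈ Lb b) : ∑ i ∈ s, f i ∈ Lb b := by
  classical
  induction s using Finset.induction_on with
  | empty => simpa using Lb_zero
  | insert a s ha ih =>
    rw [Finset.sum_insert ha]
    exact Lb_add (h _ (by simp)) (ih fun i hi => h i (by simp [hi]))

lemma Lb_le {n k l : ℕ} {b : Fin k → Euc n} {c : Fin l → Euc n} (h : ∀ i, c i ∈ Lb b) : Lb c ⊆ Lb b := by
  rintro v ⟨z, rfl⟩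
  exact Lb_sum _ _ fun i _ => Lb_zsmul _ (h i)

/-- containment multiplies determinants by an integer -/
lemma gdet_of_subset {n : ℕ} {b c : Fin n → Euc n} (h : ∀ i, c i ∈ Lb b) :
    ∃ M : Matrix (Fin n) (Fin n) ℤ, (∀ j, c j = ∑ i, (M i j : ℝ) • b i) ∧ gdet c = gdet b * (M.det : ℝ) := by
  choose z hz using h
  refine ⟨Matrix.of fun i j => z j i, fun j => by simpa using hz j, ?_⟩
  rw [gdet_comb b c ((Matrix.of fun i j => z j i : Matrix (Fin n) (Fin n) ℤ).map (Int.castRingHom ℝ)) (fun j => by simpa using hz j)]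
  congr 1
  rw [← RingHom.mapMatrix_apply, ← RingHom.map_det]; simp

lemma abs_gdet_le_of_subset {n : ℕ} {b c : Fin n → Euc n} (h : ∀ i, c i ∈ Lb b) (hc : gdet c ≠ 0) :
    |gdet b| ≤ |gdet c| := by
  obtain ⟨M, -, hM⟩ := gdet_of_subset h
  have h0 : M.det ≠ 0 := by rintro h0; apply hc; rw [hM, h0]; simp
  rw [hM, abs_mul]
  have : (1 : ℝ) ≤ |(M.det : ℝ)| := by exact_mod_cast Int.one_le_abs h0
  nlinarith [abs_nonneg (gdet b)]

lemma abs_gdet_eq {n : ℕ} {b c : Fin n → Euc n} (h : Lb b = Lb c) (hb : gdet b ≠ 0) :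
    |gdet b| = |gdet c| := by
  have h1 : ∀ i, b i ∈ Lb c := fun i => h ▸ Lb_self i
  have h2 : ∀ i, c i ∈ Lb b := fun i => h ▸ Lb_self i
  have hc : gdet c ≠ 0 := by
    obtain ⟨M, -, hM⟩ := gdet_of_subset h1
    rintro h0; apply hb; rw [hM, h0]; simp
  exact le_antisymm (abs_gdet_le_of_subset h2 hc) (abs_gdet_le_of_subset h1 hb)

lemma latDet_Lb {n : ℕ} {b : Fin n → Euc n} (hb : gdet b ≠ 0) : latDet (Lb b) = |gdet b| := by
  have : {d | ∃ T : Euc n →ₗ[ℝ] Euc n, Lb b = latticeSet T ∧ d = |LinearMap.det T|} = {|gdet b|} := by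
    ext d
    simp only [Set.mem_ofPred_eq, Set.mem_singleton_iff]
    constructor
    · rintro ⟨T, hT, rfl⟩
      rw [← tvec_of T, latticeSet_tvec] at hT
      rw [← tvec_of T, det_tvec, abs_gdet_eq hT hb]
    · rintro rfl
      exact ⟨tvec b, (latticeSet_tvec b).symm, by rw [det_tvec]⟩
  rw [latDet, this, csInf_singleton]

lemma isLattice_iff {n : ℕ} {Λ : Set (Euc n)} : IsLattice Λ ↔ ∃ b : Fin n → Euc n, gdet b ≠ 0 ∧ Λ = Lb b := by
  constructor
  · rintro ⟨T, h, rfl⟩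
    refine ⟨fun i => T (EuclideanSpace.single i 1), ?_, ?_⟩
    · rwa [← det_tvec, tvec_of]
    · rw [← latticeSet_tvec, tvec_of]
  · rintro ⟨b, h, rfl⟩
    exact ⟨tvec b, by rwa [det_tvec], (latticeSet_tvec b).symm⟩

lemma critDet_eq {n : ℕ} (K : Set (Euc n)) :
    critDet K = sInf {d | ∃ b : Fin n → Euc n, gdet b ≠ 0 ∧ IsAdmissible (Lb b) K ∧ d = |gdet b|} := by
  rw [critDet]
  congr 1
  ext d
  constructor
  · rintro ⟨Λ, hL, hA, rfl⟩
    obtain ⟨b, hb, rfl⟩ := isLattice_iff.1 hL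
    exact ⟨b, hb, hA, latDet_Lb hb⟩
  · rintro ⟨b, hb, hA, rfl⟩
    exact ⟨Lb b, isLattice_iff.2 ⟨b, hb, rfl⟩, hA, (latDet_Lb hb).symm⟩

lemma critDet_le {n : ℕ} {K : Set (Euc n)} {b : Fin n → Euc n} (hb : gdet b ≠ 0)
    (hA : IsAdmissible (Lb b) K) : critDet K ≤ |gdet b| := by
  rw [critDet_eq]
  exact csInf_le ⟨0, by rintro d ⟨b, _, _, rfl⟩; exact abs_nonneg _⟩ ⟨b, hb, hA, rfl⟩

/-- Minimum at least one -/
def Adm {n : ℕ} (b : Fin n → Euc n) : Prop := ∀ v ∈ Lb b, v ≠ 0 → 1 ≤ ‖v‖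

lemma adm_iff {n : ℕ} (b : Fin n → Euc n) : IsAdmissible (Lb b) (unitBall n) ↔ Adm b := by
  rcases n with _ | n
  · simp only [IsAdmissible, Adm]
    constructor
    · intro _ v _ h; exact absurd (Subsingleton.elim v 0) h
    · intro _ v _; exact Subsingleton.elim v 0
  rw [IsAdmissible, unitBall, interior_closedBall _ one_ne_zero]
  constructor
  · intro h v hv h0
    by_contra hc
    exact h0 (h ⟨hv, by simpa using hc⟩)
  · rintro h v ⟨hv, hb⟩
    by_contra h0
    have := h v hv h0
    simp at hb
    linarith

end

section
open scoped RealInnerProductSpace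
open Metric MeasureTheory

lemma span_top_of_li {n : ℕ} {b : Fin n → Euc n} (h : LinearIndependent ℝ b) : Submodule.span ℝ (Set.range b) = ⊤ :=
  h.span_eq_top_of_card_eq_finrank' (by simp)

/-- the basis from an independent family -/
def bas {n : ℕ} {b : Fin n → Euc n} (h : LinearIndependent ℝ b) : Module.Basis (Fin n) ℝ (Euc n) :=
  Module.Basis.mk h (span_top_of_li h).ge

lemma bas_coe {n : ℕ} {b : Fin n → Euc n} (h : LinearIndependent ℝ b) : ⇑(bas h) = b := by simp [bas]

lemma exists_pos_le_gdet (n : ℕ) : ∃ c : ℝ, 0 < c ∧ ∀ b : Fin n → Euc n, gdet b ≠ 0 → Adm b → c ≤ |gdet b| := by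
  set b0 := (EuclideanSpace.basisFun (Fin n) ℝ).toBasis with hb0
  set F := (volume (ZSpan.fundamentalDomain b0)) with hF
  have hF0 : F ≠ 0 := ZSpan.measure_fundamentalDomain_ne_zero b0
  have hFt : F ≠ ⊤ := (ZSpan.fundamentalDomain_isBounded b0).measure_lt_top.ne
  have hB0 : volume (ball (0 : Euc n) 1) ≠ 0 := (measure_ball_pos _ _ one_pos).ne'
  have hBt : volume (ball (0 : Euc n) 1) ≠ ⊤ := measure_ball_lt_top.ne
  refine ⟨(volume (ball (0 : Euc n) 1)).toReal / (F.toReal * 2 ^ n), ?_, ?_⟩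
  · have := ENNReal.toReal_pos hF0 hFt
    have := ENNReal.toReal_pos hB0 hBt
    positivity
  intro b hb hA
  by_contra hlt
  push Not at hlt
  have hli := (gdet_ne_zero_iff b).1 hb
  let bb : Module.Basis (Fin n) ℝ (Euc n) := bas hli
  have hbb : ⇑bb = b := bas_coe hli
  have hdet : b0.det bb = gdet b := by
    rw [Module.Basis.det_apply, gdet]
    congr 1
    ext i j
    simp [hb0, hbb, cmat, Module.Basis.toMatrix_apply]
  have hfd := ZSpan.isAddFundamentalDomain' bb volume
  have hm := ZSpan.measure_fundamentalDomain bb volume b0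
  have : Countable (Submodule.span ℤ (Set.range bb)).toAddSubgroup := inferInstanceAs (Countable (Submodule.span ℤ (Set.range bb)))
  obtain ⟨x, hx0, hx⟩ := exists_ne_zero_mem_lattice_of_measure_mul_two_pow_lt_measure (s := ball (0 : Euc n) 1) hfd
    (by intro x hx; simpa using hx) (convex_ball _ _) (by
      rw [hm, hdet, ← hF]
      rw [← ENNReal.toReal_lt_toReal _ hBt]
      · have := ENNReal.toReal_pos hF0 hFt
        rw [lt_div_iff₀ (by positivity)] at hlt
        simp
        linarith
      · finiteness)
  have hxm : (x : Euc n) ∈ Lb b := by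
    have := x.2
    have h2 : (x : Euc n) ∈ Submodule.span ℤ (Set.range b) := by rw [← hbb]; exact this
    rw [Submodule.mem_span_range_iff_exists_fun] at h2
    obtain ⟨z, hz⟩ := h2
    exact ⟨z, by rw [← hz]; exact Finset.sum_congr rfl fun i _ => by rw [Int.cast_smul_eq_zsmul]⟩
  have := hA _ hxm (by simpa using hx0)
  simp at hx
  linarith

/-- critical determinant of the ball -/
def dB (n : ℕ) : ℝ := critDet (unitBall n)

lemma std_adm (n : ℕ) : Adm (fun i : Fin n => (EuclideanSpace.single i 1 : Euc n)) := by
  rintro v ⟨z, rfl⟩ h0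
  have : ∃ i, z i ≠ 0 := by
    by_contra h; push Not at h; exact h0 (by simp [h])
  obtain ⟨i, hi⟩ := this
  have h1 := PiLp.norm_apply_le (∑ i, (z i : ℝ) • (EuclideanSpace.single i 1 : Euc n)) i
  have h2 : (∑ i, (z i : ℝ) • (EuclideanSpace.single i 1 : Euc n)) i = z i := by
    simp [Pi.single_apply]
  rw [h2] at h1
  have : (1 : ℝ) ≤ ‖(z i : ℝ)‖ := by rw [Real.norm_eq_abs]; exact_mod_cast Int.one_le_abs hi
  linarith

lemma std_gdet (n : ℕ) : gdet (fun i : Fin n => (EuclideanSpace.single i 1 : Euc n)) = 1 := by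
  rw [gdet]
  have : cmat (fun i : Fin n => (EuclideanSpace.single i 1 : Euc n)) = 1 := by
    ext i j
    simp [cmat, Matrix.one_apply]
  rw [this, Matrix.det_one]

lemma dB_le {n : ℕ} {b : Fin n → Euc n} (hb : gdet b ≠ 0) (hA : Adm b) : dB n ≤ |gdet b| :=
  critDet_le hb ((adm_iff b).2 hA)

lemma dB_set_ne (n : ℕ) : {d | ∃ b : Fin n → Euc n, gdet b ≠ 0 ∧ IsAdmissible (Lb b) (unitBall n) ∧ d = |gdet b|}.Nonempty :=
  ⟨_, _, by rw [std_gdet]; simp, (adm_iff _).2 (std_adm n), rfl⟩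

lemma dB_pos (n : ℕ) : 0 < dB n := by
  obtain ⟨c, hc, h⟩ := exists_pos_le_gdet n
  refine lt_of_lt_of_le hc ?_
  rw [dB, critDet_eq]
  refine le_csInf (dB_set_ne n) ?_
  rintro d ⟨b, hb, hA, rfl⟩
  exact h b hb ((adm_iff b).1 hA)

lemma exists_lt_of_dB_lt {n : ℕ} {c : ℝ} (h : dB n < c) : ∃ b : Fin n → Euc n, gdet b ≠ 0 ∧ Adm b ∧ |gdet b| < c := by
  rw [dB, critDet_eq] at h
  obtain ⟨d, ⟨b, hb, hA, rfl⟩, hd⟩ := exists_lt_of_csInf_lt (dB_set_ne n) h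
  exact ⟨b, hb, (adm_iff b).1 hA, hd⟩

end

section
open scoped RealInnerProductSpace
open Metric MeasureTheory

lemma gdet_map {n : ℕ} (T : Euc n →ₗ[ℝ] Euc n) (b : Fin n → Euc n) :
    gdet (fun i => T (b i)) = LinearMap.det T * gdet b := by
  rw [← det_tvec, ← det_tvec, ← LinearMap.det_comp]
  congr 1
  apply (EuclideanSpace.basisFun (Fin n) ℝ).toBasis.ext
  intro i
  simp [tvec_single]

lemma Lb_map {n k : ℕ} (T : Euc n →ₗ[ℝ] Euc n) (b : Fin k → Euc n) :
    Lb (fun i => T (b i)) = T '' Lb b := by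
  ext v
  constructor
  · rintro ⟨z, rfl⟩
    exact ⟨_, ⟨z, rfl⟩, by simp⟩
  · rintro ⟨_, ⟨z, rfl⟩, rfl⟩
    exact ⟨z, by simp⟩

lemma exists_li_of_span_top {n : ℕ} {s : Set (Euc n)} (h : Submodule.span ℝ s = ⊤) :
    ∃ V : Fin n → Euc n, (∀ i, V i ∈ s) ∧ LinearIndependent ℝ V := by
  let B := Module.Basis.ofSpan h.ge
  have hfin := Module.Finite.finite_basis B
  have hc := Module.finrank_eq_nat_card_basis B
  rw [finrank_euclideanSpace_fin] at hc
  have e := (Finite.equivFinOfCardEq hc.symm)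
  refine ⟨fun i => B (e.symm i), fun i => Module.Basis.ofSpan_subset h.ge ⟨_, rfl⟩, ?_⟩
  exact B.linearIndependent.comp _ e.symm.injective

lemma span_short {n : ℕ} {b : Fin n → Euc n} (hb : gdet b ≠ 0) (hA : Adm b) {R : ℝ} (hR1 : 1 ≤ R)
    (hR : |gdet b| < R * dB n) : Submodule.span ℝ {v | v ∈ Lb b ∧ ‖v‖ ≤ R} = ⊤ := by
  by_contra hne
  set W := Submodule.span ℝ {v | v ∈ Lb b ∧ ‖v‖ ≤ R} with hW
  have : Wᗮ ≠ ⊥ := fun h => hne (Submodule.orthogonal_eq_bot_iff.1 h)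
  obtain ⟨u0, hu0, hu00⟩ := Submodule.exists_mem_ne_zero_of_ne_bot this
  set u := (‖u0‖⁻¹) • u0 with hu
  have hun : ‖u‖ = 1 := norm_smul_inv_norm (𝕜 := ℝ) hu00
  have huW : u ∈ Wᗮ := Submodule.smul_mem _ _ hu0
  have huu : ⟪u, u⟫ = (1 : ℝ) := by rw [real_inner_self_eq_norm_sq, hun]; norm_num
  set D := LinearMap.transvection ((innerₛₗ ℝ u) : Euc n →ₗ[ℝ] ℝ) ((1/R - 1) • u) with hD
  have hDa : ∀ x, D x = x + ⟪u, x⟫ • ((1/R - 1) • u) := fun x => by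
    rw [hD, LinearMap.transvection.apply]; simp
  have hdet : LinearMap.det D = 1 / R := by
    rw [hD, LinearMap.transvection.det]
    simp [hun]
  have hRp : 0 < R := by linarith
  have hnorm : ∀ x, ‖x‖ ≤ R * ‖D x‖ := by
    intro x
    have e1 : ‖D x‖ ^ 2 = ‖x‖ ^ 2 - (1 - 1/R^2) * ⟪u, x⟫ ^ 2 := by
      rw [hDa, norm_add_sq_real, norm_smul, norm_smul, hun, inner_smul_right, inner_smul_right, real_inner_comm u x,
        mul_pow, mul_pow, Real.norm_eq_abs, Real.norm_eq_abs, sq_abs, sq_abs]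
      ring
    have e2 : ⟪u, x⟫ ^ 2 ≤ ‖x‖ ^ 2 := by
      have := abs_real_inner_le_norm u x
      rw [hun, one_mul] at this
      rw [← sq_abs]; gcongr
    have e3 : 1 / R^2 ≤ 1 := by
      rw [div_le_one (by positivity)]; nlinarith
    have e4 : ‖x‖ ^ 2 * (1 / R ^ 2) ≤ ‖D x‖ ^ 2 := by rw [e1]; nlinarith
    have e5 : ‖x‖ ^ 2 ≤ (R * ‖D x‖) ^ 2 := by
      rw [mul_pow]
      rw [mul_one_div, div_le_iff₀ (by positivity)] at e4
      linarith
    exact le_of_sq_le_sq e5 (by positivity)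
  have hadm : Adm (fun i => D (b i)) := by
    intro v hv h0
    rw [Lb_map] at hv
    obtain ⟨x, hx, rfl⟩ := hv
    have hx0 : x ≠ 0 := by rintro rfl; exact h0 (map_zero _)
    by_cases hxR : ‖x‖ ≤ R
    · have : ⟪u, x⟫ = (0 : ℝ) := by
        rw [real_inner_comm]
        exact (Submodule.mem_orthogonal _ _).1 huW x (Submodule.subset_span ⟨hx, hxR⟩)
      rw [hDa, this]
      simpa using hA x hx hx0
    · push Not at hxR
      have := hnorm x
      by_contra hc
      push Not at hc
      nlinarith
  have hg : gdet (fun i => D (b i)) = 1 / R * gdet b := by rw [gdet_map, hdet]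
  have := dB_le (by rw [hg]; exact mul_ne_zero (by positivity) hb) hadm
  rw [hg, abs_mul, abs_of_pos (by positivity : 0 < 1 / R), div_mul_eq_mul_div, le_div_iff₀ hRp] at this
  linarith

lemma Lb_unimod {n : ℕ} {b b' : Fin n → Euc n} (U : Matrix (Fin n) (Fin n) ℤ) (hU : U.det = 1)
    (h : ∀ j, b' j = ∑ i, (U i j : ℝ) • b i) : Lb b' = Lb b := by
  apply Set.Subset.antisymm
  · exact Lb_le fun j => ⟨fun i => U i j, h j⟩
  · refine Lb_le fun k => ⟨fun j => U.adjugate j k, ?_⟩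
    have e : U * U.adjugate = 1 := by rw [Matrix.mul_adjugate, hU, one_smul]
    simp_rw [h, Finset.smul_sum, smul_smul]
    rw [Finset.sum_comm]
    simp_rw [← Finset.sum_smul]
    have : ∀ i, (∑ j, (U.adjugate j k : ℝ) * (U i j : ℝ)) = if i = k then 1 else 0 := by
      intro i
      have := congrFun (congrFun e i) k
      rw [Matrix.mul_apply, Matrix.one_apply] at this
      rw [← Int.cast_one, ← Int.cast_zero, ← Int.cast_ite, ← this]
      push_cast
      exact Finset.sum_congr rfl fun j _ => mul_comm _ _
    simp [this]

lemma pigeon (n : ℕ) (N0 : ℕ) : ∃ C : ℝ, 0 ≤ C ∧ ∀ M : Matrix (Fin n) (Fin n) ℤ, M.det ≠ 0 → |M.det| ≤ N0 →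
    ∃ U : Matrix (Fin n) (Fin n) ℤ, U.det = 1 ∧ ∃ W : Matrix (Fin n) (Fin n) ℝ, (∀ i j, |W i j| ≤ C) ∧
      U.map (Int.castRingHom ℝ) = M.map (Int.castRingHom ℝ) * W := by
  classical
  let good : Set (Matrix (Fin n) (Fin n) ℤ) := {M | M.det ≠ 0 ∧ |M.det| ≤ N0}
  let key : Matrix (Fin n) (Fin n) ℤ → ℤ × (Fin n → Fin n → ℤ) := fun M => (M.det, fun i j => M i j % M.det)
  have hfin : (key '' good).Finite := by
    refine Set.Finite.subset ((Set.finite_Icc (-(N0:ℤ)) N0).prod (Set.Finite.pi (t := fun _ : Fin n => Set.pi Set.univ (fun _ : Fin n => Set.Icc (0:ℤ) N0)) (fun _ => Set.Finite.pi fun _ => Set.finite_Icc _ _))) ?_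
    rintro _ ⟨M, ⟨h1, h2⟩, rfl⟩
    refine ⟨?_, ?_⟩
    · exact abs_le.1 h2
    · intro i _ j _
      exact ⟨Int.emod_nonneg _ h1, (Int.emod_lt_abs _ h1).le.trans h2⟩
  let rep : ℤ × (Fin n → Fin n → ℤ) → Matrix (Fin n) (Fin n) ℤ := fun k => if h : ∃ M ∈ good, key M = k then h.choose else 0
  have hrep : ∀ M ∈ good, rep (key M) ∈ good ∧ key (rep (key M)) = key M := by
    intro M hM
    have h : ∃ M' ∈ good, key M' = key M := ⟨M, hM, rfl⟩
    simp only [rep]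
    rw [dif_pos h]
    exact h.choose_spec
  let g : ℤ × (Fin n → Fin n → ℤ) → ℝ := fun k => ∑ i, ∑ j, |((rep k).map (Int.castRingHom ℝ))⁻¹ i j|
  obtain ⟨C, hC⟩ := (hfin.image g).bddAbove
  refine ⟨max C 0, le_max_right _ _, fun M h1 h2 => ?_⟩
  have hM : M ∈ good := ⟨h1, h2⟩
  obtain ⟨hr1, hr2⟩ := hrep M hM
  set M0 := rep (key M) with hM0
  have hdet : M0.det = M.det := congrArg Prod.fst hr2
  have hmod : ∀ i j, M0 i j % M0.det = M i j % M.det := fun i j => congrFun (congrFun (congrArg Prod.snd hr2) i) j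
  have hE : ∀ i j, ∃ e, M i j = M0 i j + M0.det * e := by
    intro i j
    have := hmod i j
    rw [← hdet] at this
    obtain ⟨e, he⟩ := Int.ModEq.dvd (show M0 i j ≡ M i j [ZMOD M0.det] from this)
    exact ⟨e, by linarith⟩
  choose E hE using hE
  let EE : Matrix (Fin n) (Fin n) ℤ := Matrix.of E
  have hME : M = M0 + M0.det • EE := by
    ext i j; simp [EE, hE i j]
  let U := 1 + EE * M0.adjugate
  have hUM : U * M0 = M := by
    simp only [U]
    rw [add_mul, one_mul, mul_assoc, Matrix.adjugate_mul, Matrix.mul_smul, mul_one]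
    exact hME.symm
  have hUdet : U.det = 1 := by
    have := congrArg Matrix.det hUM
    rw [Matrix.det_mul, hdet] at this
    exact mul_right_cancel₀ h1 (by rw [this, one_mul])
  refine ⟨U, hUdet, (M0.map (Int.castRingHom ℝ))⁻¹, ?_, ?_⟩
  · intro i j
    have h3 : g (key M) ≤ C := hC ⟨_, ⟨M, hM, rfl⟩, rfl⟩
    refine le_trans ?_ (le_trans h3 (le_max_left _ _))
    simp only [g]
    have := Finset.single_le_sum (f := fun i => ∑ j, |(M0.map (Int.castRingHom ℝ))⁻¹ i j|) (fun i _ => by positivity) (Finset.mem_univ i)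
    refine le_trans ?_ this
    exact Finset.single_le_sum (f := fun j => |(M0.map (Int.castRingHom ℝ))⁻¹ i j|) (fun i _ => by positivity) (Finset.mem_univ j)
  · have hd0 : IsUnit (M0.map (Int.castRingHom ℝ)).det := by
      rw [← RingHom.mapMatrix_apply, ← RingHom.map_det, hdet]
      simpa using h1
    rw [← hUM, Matrix.map_mul, mul_assoc, Matrix.mul_nonsing_inv _ hd0, mul_one]

lemma mahler_basis (n : ℕ) (c : ℝ) : ∃ R : ℝ, ∀ b : Fin n → Euc n, gdet b ≠ 0 → Adm b → |gdet b| ≤ c →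
    ∃ b' : Fin n → Euc n, Lb b' = Lb b ∧ ∀ i, ‖b' i‖ ≤ R := by
  have hd := dB_pos n
  obtain ⟨R, hR1, hRc⟩ : ∃ R : ℝ, 1 ≤ R ∧ c < R * dB n := by
    refine ⟨max 1 (c / dB n + 1), le_max_left _ _, ?_⟩
    have : c / dB n < max 1 (c / dB n + 1) := lt_of_lt_of_le (by linarith) (le_max_right _ _)
    rwa [div_lt_iff₀ hd] at this
  obtain ⟨N0, hN0⟩ := exists_nat_ge (((n.factorial : ℝ) * R ^ n) / dB n)
  obtain ⟨C, hC0, hC⟩ := pigeon n N0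
  refine ⟨n * (C * R), fun b hb hA hbc => ?_⟩
  obtain ⟨V, hV, hVli⟩ := exists_li_of_span_top (span_short hb hA hR1 (hbc.trans_lt hRc))
  obtain ⟨M, hM, hMd⟩ := gdet_of_subset (fun i => (hV i).1)
  have hV0 := (gdet_ne_zero_iff V).2 hVli
  have hMd0 : M.det ≠ 0 := by rintro h; rw [h] at hMd; simp at hMd; exact hV0 hMd
  have hVb : |gdet V| ≤ (n.factorial : ℝ) * R ^ n := by
    have := Matrix.det_le (A := cmat V) (abv := AbsoluteValue.abs) (x := R) (fun i j => by
      simp only [AbsoluteValue.abs_apply, cmat, Matrix.of_apply]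
      exact (PiLp.norm_apply_le (V j) i).trans (hV j).2)
    simpa [gdet] using this
  have hMle : |M.det| ≤ N0 := by
    have h1 := dB_le hb hA
    rw [hMd, abs_mul] at hVb
    have h2 : |(M.det : ℝ)| ≤ N0 := by
      refine le_trans ?_ hN0
      rw [le_div_iff₀ hd]
      nlinarith [abs_nonneg (M.det : ℝ)]
    exact_mod_cast h2
  obtain ⟨U, hU, W, hW, hUW⟩ := hC M hMd0 hMle
  refine ⟨fun j => ∑ i, (U i j : ℝ) • b i, Lb_unimod U hU fun j => rfl, fun j => ?_⟩
  have e : ∑ i, (U i j : ℝ) • b i = ∑ k, W k j • V k := by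
    simp_rw [hM, Finset.smul_sum, smul_smul]
    rw [Finset.sum_comm]
    simp_rw [← Finset.sum_smul]
    refine Finset.sum_congr rfl fun i _ => ?_
    congr 1
    have := congrFun (congrFun hUW i) j
    simp [Matrix.mul_apply] at this
    rw [this]
    exact Finset.sum_congr rfl fun j _ => mul_comm _ _
  show ‖∑ i, (U i j : ℝ) • b i‖ ≤ _
  rw [e]
  refine (norm_sum_le _ _).trans ?_
  refine (Finset.sum_le_sum (g := fun _ => C * R) fun k _ => ?_).trans (by simp)
  rw [norm_smul]
  exact mul_le_mul (hW k j) (hV k).2 (norm_nonneg _) hC0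

lemma gdet_smul {n : ℕ} (r : ℝ) (b : Fin n → Euc n) : gdet (fun i => r • b i) = r ^ n * gdet b := by
  have := gdet_map (r • LinearMap.id) b
  simpa using this

lemma continuous_gdet {n : ℕ} : Continuous (gdet : (Fin n → Euc n) → ℝ) := by
  unfold gdet cmat
  apply Continuous.matrix_det
  apply continuous_matrix
  intro i j
  simp only [Matrix.of_apply]
  fun_prop

lemma adm_smul {n : ℕ} {b : Fin n → Euc n} {r : ℝ} (hr : 0 < r) (h : ∀ v ∈ Lb b, v ≠ 0 → r ≤ ‖v‖) :
    Adm (fun i => r⁻¹ • b i) := by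
  intro v hv h0
  have hL := Lb_map (r⁻¹ • LinearMap.id) b
  simp only [LinearMap.smul_apply, LinearMap.id_apply] at hL
  rw [hL] at hv
  obtain ⟨x, hx, rfl⟩ := hv
  have hx0 : x ≠ 0 := by rintro rfl; simp at h0
  have := h x hx hx0
  simp only [LinearMap.smul_apply, LinearMap.id_apply]
  rw [norm_smul, norm_inv, Real.norm_eq_abs, abs_of_pos hr, inv_mul_eq_div, le_div_iff₀ hr]
  linarith

lemma mahler_seq {n : ℕ} (b : ℕ → Fin n → Euc n) (r : ℕ → ℝ) (c : ℝ) (hb : ∀ k, gdet (b k) ≠ 0)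
    (hr : ∀ k, 1/2 ≤ r k) (hrt : Filter.Tendsto r Filter.atTop (nhds 1))
    (h : ∀ k, ∀ v ∈ Lb (b k), v ≠ 0 → r k ≤ ‖v‖) (hc : ∀ k, |gdet (b k)| ≤ c) :
    ∃ (b' : ℕ → Fin n → Euc n) (φ : ℕ → ℕ) (a : Fin n → Euc n), StrictMono φ ∧ (∀ k, Lb (b' k) = Lb (b k)) ∧
      Filter.Tendsto (b' ∘ φ) Filter.atTop (nhds a) ∧ gdet a ≠ 0 ∧ Adm a := by
  have hrp : ∀ k, 0 < r k := fun k => lt_of_lt_of_le (by norm_num) (hr k)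
  obtain ⟨R, hR⟩ := mahler_basis n (2 ^ n * c)
  have hadm : ∀ k, Adm (fun i => (r k)⁻¹ • b k i) := fun k => adm_smul (hrp k) (h k)
  have hg : ∀ k, gdet (fun i => (r k)⁻¹ • b k i) ≠ 0 := fun k => by
    rw [gdet_smul]; exact mul_ne_zero (pow_ne_zero _ (inv_ne_zero (hrp k).ne')) (hb k)
  have hbd : ∀ k, ∃ b' : Fin n → Euc n, Lb b' = Lb (fun i => (r k)⁻¹ • b k i) ∧ ∀ i, ‖b' i‖ ≤ R := fun k => by
    refine hR _ (hg k) (hadm k) ?_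
    rw [gdet_smul, abs_mul, abs_pow, abs_of_pos (inv_pos.2 (hrp k))]
    have : (r k)⁻¹ ≤ 2 := by
      rw [inv_le_comm₀ (hrp k) (by norm_num)]; linarith [hr k]
    have h0 := inv_pos.2 (hrp k)
    have h3 := hc k
    gcongr
  choose B hBL hBR using hbd
  obtain ⟨a, -, φ, hφ, hlim⟩ := tendsto_subseq_of_bounded (s := closedBall (0 : Fin n → Euc n) (max R 0)) isBounded_closedBall (x := B) (fun k => by
    rw [mem_closedBall_zero_iff, pi_norm_le_iff_of_nonneg (le_max_right R 0)]
    exact fun i => (hBR k i).trans (le_max_left _ _))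
  have hrφ : Filter.Tendsto (fun k => r (φ k)) Filter.atTop (nhds 1) := hrt.comp hφ.tendsto_atTop
  have hBadm : ∀ k, Adm (B k) := fun k v hv => hadm k v (hBL k ▸ hv)
  have hBg : ∀ k, gdet (B k) ≠ 0 := fun k h0 => by
    have := abs_gdet_eq (hBL k).symm (hg k)
    rw [h0, abs_zero, abs_eq_zero] at this
    exact hg k this
  have hga : dB n ≤ |gdet a| := by
    refine ge_of_tendsto (((continuous_gdet.tendsto a).comp hlim).abs) (Filter.Eventually.of_forall fun k => ?_)
    exact dB_le (hBg _) (hBadm _)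
  have hga0 : gdet a ≠ 0 := by
    intro h0; rw [h0, abs_zero] at hga; exact absurd (dB_pos n) (not_lt.2 hga)
  refine ⟨fun k i => r k • B k i, φ, a, hφ, ?_, ?_, hga0, ?_⟩
  · intro k
    have h1 := Lb_map (r k • LinearMap.id) (B k)
    have h2 := Lb_map ((r k)⁻¹ • LinearMap.id) (b k)
    simp only [LinearMap.smul_apply, LinearMap.id_apply] at h1 h2
    rw [h1, hBL, h2, Set.image_image]
    simp [smul_smul, (hrp k).ne']
  · have := hrφ.smul hlim
    rw [one_smul] at this
    exact this
  · rintro v ⟨z, rfl⟩ h0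
    have hz : ∃ i, z i ≠ 0 := by
      by_contra hh; push Not at hh; exact h0 (by simp [hh])
    refine ge_of_tendsto (f := fun k => ‖∑ i, (z i : ℝ) • B (φ k) i‖) (x := Filter.atTop) ?_ (Filter.Eventually.of_forall fun k => ?_)
    · refine Filter.Tendsto.norm (tendsto_finsetSum _ fun i _ => ?_)
      exact ((continuous_apply i).tendsto a |>.comp hlim).const_smul (z i : ℝ)
    · refine hBadm _ _ ⟨z, rfl⟩ fun h1 => ?_
      obtain ⟨i, hi⟩ := hz
      have := Fintype.linearIndependent_iff.1 ((gdet_ne_zero_iff _).1 (hBg (φ k))) _ h1 i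
      exact hi (by exact_mod_cast this)

lemma exists_critical (n : ℕ) : ∃ b : Fin n → Euc n, Adm b ∧ |gdet b| = dB n := by
  have : ∀ k : ℕ, ∃ b : Fin n → Euc n, gdet b ≠ 0 ∧ Adm b ∧ |gdet b| < dB n + 1 / ((k : ℝ) + 1) :=
    fun k => exists_lt_of_dB_lt (by have : 0 < 1 / ((k : ℝ) + 1) := by positivity
                                    linarith)
  choose b hb hA hlt using this
  obtain ⟨b', φ, a, hφ, hL, hlim, ha, hAa⟩ := mahler_seq b (fun _ => 1) (dB n + 1) hb (by norm_num) tendsto_const_nhds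
    (fun k => hA k) (fun k => (hlt k).le.trans (by
      have : 1 / ((k : ℝ) + 1) ≤ 1 := by rw [div_le_one (by positivity)]; linarith [(Nat.cast_nonneg k : (0:ℝ) ≤ k)]
      linarith))
  refine ⟨a, hAa, le_antisymm ?_ (dB_le ha hAa)⟩
  have h1 : Filter.Tendsto (fun k => dB n + 1 / ((φ k : ℝ) + 1)) Filter.atTop (nhds (dB n + 0)) :=
    (tendsto_one_div_add_atTop_nhds_zero_nat.comp hφ.tendsto_atTop).const_add _
  rw [add_zero] at h1
  refine le_of_tendsto_of_tendsto (((continuous_gdet.tendsto a).comp hlim).abs) h1 (Filter.Eventually.of_forall fun k => ?_)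
  have := abs_gdet_eq (hL (φ k)).symm (hb _)
  show |gdet (b' (φ k))| ≤ _
  rw [← this]
  exact (hlt _).le

end

section
open scoped RealInnerProductSpace
open Metric MeasureTheory

lemma det_one_add_smul_lt {n : ℕ} {A : Matrix (Fin n) (Fin n) ℝ} (hA : A.IsHermitian) (h0 : A ≠ 0) (htr : A.trace ≤ 0) :
    ∃ t0 > 0, ∀ t : ℝ, 0 < t → t ≤ t0 → 0 < (1 + t • A).det ∧ (1 + t • A).det < 1 := by
  have key : ∀ t : ℝ, (1 + t • A).det = ∏ i, (1 + t * hA.eigenvalues i) := by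
    intro t
    have hs := hA.spectral_theorem
    rw [Unitary.conjStarAlgAut_apply] at hs
    set U := (hA.eigenvectorUnitary : Matrix (Fin n) (Fin n) ℝ) with hU
    have hUU : U * star U = 1 := Unitary.coe_mul_star_self _
    have e : 1 + t • A = U * (Matrix.diagonal (fun i => 1 + t * hA.eigenvalues i)) * star U := by
      have : Matrix.diagonal (fun i => 1 + t * hA.eigenvalues i) = 1 + t • Matrix.diagonal (RCLike.ofReal ∘ hA.eigenvalues : Fin n → ℝ) := by
        ext i j
        by_cases h : i = j
        · subst h; simp
        · simp [h]
      rw [this, mul_add, add_mul, mul_one, hUU]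
      congr 1
      rw [Matrix.mul_smul, Matrix.smul_mul, ← hs]
    rw [e, Matrix.det_mul, Matrix.det_mul, mul_right_comm, ← Matrix.det_mul, hUU, Matrix.det_one, one_mul, Matrix.det_diagonal]
  have htr' : A.trace = ∑ i, hA.eigenvalues i := by simpa using hA.trace_eq_sum_eigenvalues
  obtain ⟨i0, hi0⟩ : ∃ i, hA.eigenvalues i ≠ 0 := by
    by_contra h
    push Not at h
    exact h0 (hA.eigenvalues_eq_zero_iff.1 (funext h))
  set m := ∑ i, |hA.eigenvalues i| with hm
  have hm0 : 0 < m := lt_of_lt_of_le (abs_pos.2 hi0) (Finset.single_le_sum (f := fun i => |hA.eigenvalues i|) (fun i _ => abs_nonneg _) (Finset.mem_univ i0))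
  refine ⟨1 / (2 * m), by positivity, fun t ht ht2 => ?_⟩
  have hpos : ∀ i, 0 < 1 + t * hA.eigenvalues i := by
    intro i
    have h1 : |hA.eigenvalues i| ≤ m := Finset.single_le_sum (f := fun i => |hA.eigenvalues i|) (fun i _ => abs_nonneg _) (Finset.mem_univ i)
    have h2 : t * m ≤ 1 / 2 := by
      rw [le_div_iff₀ (by positivity)] at ht2; linarith
    have h3 := neg_abs_le (hA.eigenvalues i)
    nlinarith
  rw [key]
  refine ⟨Finset.prod_pos fun i _ => hpos i, ?_⟩
  calc ∏ i, (1 + t * hA.eigenvalues i) < ∏ i, Real.exp (t * hA.eigenvalues i) := by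
        refine Finset.prod_lt_prod (fun i _ => hpos i) (fun i _ => ?_) ⟨i0, Finset.mem_univ _, ?_⟩
        · linarith [Real.add_one_le_exp (t * hA.eigenvalues i)]
        · linarith [Real.add_one_lt_exp (mul_ne_zero ht.ne' hi0)]
    _ = Real.exp (t * A.trace) := by rw [← Real.exp_sum, ← Finset.mul_sum, htr']
    _ ≤ 1 := by rw [Real.exp_le_one_iff]; nlinarith

lemma finite_short {n : ℕ} {b : Fin n → Euc n} (hb : gdet b ≠ 0) (R : ℝ) : {v | v ∈ Lb b ∧ ‖v‖ ≤ R}.Finite := by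
  have hli := (gdet_ne_zero_iff b).1 hb
  have hbound : ∃ C : ℕ, ∀ v : Euc n, ‖v‖ ≤ R → ∀ i, |(bas hli).repr v i| ≤ C := by
    have : ∀ i, ∃ C : ℝ, ∀ v : Euc n, ‖v‖ ≤ R → |(bas hli).repr v i| ≤ C := by
      intro i
      let f : Euc n →L[ℝ] ℝ := LinearMap.toContinuousLinearMap ((bas hli).coord i)
      refine ⟨‖f‖ * R, fun v hv => ?_⟩
      have := f.le_opNorm v
      have h2 : f v = (bas hli).repr v i := by simp [f]
      rw [h2, Real.norm_eq_abs] at this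
      exact this.trans (by gcongr)
    choose C hC using this
    obtain ⟨N, hN⟩ := exists_nat_ge (∑ i, |C i|)
    refine ⟨N, fun v hv i => (hC i v hv).trans ((le_abs_self _).trans (le_trans ?_ hN))⟩
    exact Finset.single_le_sum (f := fun i => |C i|) (fun i _ => abs_nonneg _) (Finset.mem_univ i)
  obtain ⟨C, hC⟩ := hbound
  refine Set.Finite.subset ((Set.Finite.pi (t := fun _ : Fin n => Set.Icc (-(C:ℤ)) C) (fun _ => Set.finite_Icc _ _)).image (fun z : Fin n → ℤ => ∑ i, (z i : ℝ) • b i)) ?_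
  rintro v ⟨⟨z, rfl⟩, hv⟩
  refine ⟨z, ?_, rfl⟩
  intro i _
  have := hC _ hv i
  have e : (bas hli).repr (∑ i, (z i : ℝ) • b i) i = z i := by
    have := (bas hli).repr_sum_self (fun i => (z i : ℝ))
    rw [bas_coe] at this
    rw [this]
  rw [e] at this
  have h2 : |z i| ≤ C := by exact_mod_cast this
  exact abs_le.1 h2

/-- gap above the minimum -/
lemma exists_gap {n : ℕ} {b : Fin n → Euc n} (hb : gdet b ≠ 0) (hA : Adm b) :
    ∃ γ > 0, ∀ v ∈ Lb b, v ≠ 0 → ‖v‖ = 1 ∨ 1 + γ ≤ ‖v‖ := by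
  have hf := finite_short hb 2
  set s := {v | v ∈ Lb b ∧ ‖v‖ ≤ 2 ∧ 1 < ‖v‖} with hs
  have hsf : s.Finite := hf.subset fun v hv => ⟨hv.1, hv.2.1⟩
  have : ∃ γ > 0, γ ≤ 1 ∧ ∀ v ∈ s, 1 + γ ≤ ‖v‖ := by
    rcases s.eq_empty_or_nonempty with h | h
    · exact ⟨1, one_pos, le_rfl, by simp [h]⟩
    · obtain ⟨w, hw, hmin⟩ := hsf.exists_minimalFor (fun v => ‖v‖) s h
      refine ⟨‖w‖ - 1, by linarith [hw.2.2], by linarith [hw.2.1], fun v hv => ?_⟩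
      rcases le_total ‖w‖ ‖v‖ with h1 | h1
      · linarith
      · have := hmin hv h1
        simp at this; linarith
  obtain ⟨γ, hγ, hγ1, h⟩ := this
  refine ⟨γ, hγ, fun v hv h0 => ?_⟩
  rcases (hA v hv h0).eq_or_lt with h1 | h1
  · exact Or.inl h1.symm
  · right
    rcases le_or_gt ‖v‖ 2 with h2 | h2
    · exact h v ⟨hv, h2, h1⟩
    · linarith

lemma perfect_aux {n : ℕ} {b : Fin n → Euc n} (hA : Adm b) (hcrit : |gdet b| = dB n)
    (q : Matrix (Fin n) (Fin n) ℝ) (hq : q.IsHermitian) (htr : q.trace ≤ 0)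
    (hB : ∀ v ∈ Lb b, ‖v‖ = 1 → ∑ i, ∑ j, q i j * v i * v j = 0) : q = 0 := by
  by_contra hne
  have hb : gdet b ≠ 0 := by
    intro h; rw [h, abs_zero] at hcrit; exact (dB_pos n).ne hcrit
  obtain ⟨t0, ht0, hdet⟩ := det_one_add_smul_lt hq hne htr
  obtain ⟨γ, hγ, hgap⟩ := exists_gap hb hA
  let Q : Euc n →ₗ[ℝ] Euc n := tvec (fun j => WithLp.toLp 2 (fun i => q i j))
  have hQa : ∀ x i, Q x i = ∑ j, q i j * x j := by
    intro x i
    have e1 := (EuclideanSpace.basisFun (Fin n) ℝ).toBasis.sum_repr x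
    conv_lhs => rw [← e1]
    simp [Q, tvec_single, mul_comm]
  have hQin : ∀ x, ⟪x, Q x⟫ = ∑ i, ∑ j, q i j * x i * x j := by
    intro x
    simp only [PiLp.inner_apply, hQa]
    refine Finset.sum_congr rfl fun i _ => ?_
    simp only [RCLike.inner_apply, conj_trivial, Finset.sum_mul]
    exact Finset.sum_congr rfl fun j _ => by ring
  obtain ⟨C, hC0, hC⟩ : ∃ C : ℝ, 0 ≤ C ∧ ∀ x, ‖Q x‖ ≤ C * ‖x‖ := by
    let f := LinearMap.toContinuousLinearMap Q
    exact ⟨‖f‖, norm_nonneg _, fun x => f.le_opNorm x⟩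
  have htex : ∃ t > 0, t ≤ t0 ∧ 1 ≤ (1 + γ) * (1 - t * C) ∧ 0 ≤ 1 - t * C := by
    refine ⟨min t0 (γ / ((1 + γ) * (C + 1))), lt_min ht0 (by positivity), min_le_left _ _, ?_⟩
    have h1 := min_le_right t0 (γ / ((1 + γ) * (C + 1)))
    set t := min t0 (γ / ((1 + γ) * (C + 1)))
    have ht : 0 < t := lt_min ht0 (by positivity)
    rw [le_div_iff₀ (by positivity)] at h1
    have h2 : (1 + γ) * (t * C) ≤ γ := by nlinarith [mul_pos ht hγ]
    exact ⟨by linarith, by nlinarith⟩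
  obtain ⟨t, htp, htt0, ht1, ht2⟩ := htex
  let A : Euc n →ₗ[ℝ] Euc n := LinearMap.id + t • Q
  have hdA : LinearMap.det A = (1 + t • q).det := by
    rw [← LinearMap.det_toMatrix (EuclideanSpace.basisFun (Fin n) ℝ).toBasis]
    congr 1
    ext i j
    simp [A, LinearMap.toMatrix_apply, Q, tvec_single, Matrix.one_apply]
  have hadm : Adm (fun i => A (b i)) := by
    intro v hv h0
    rw [Lb_map] at hv
    obtain ⟨x, hx, rfl⟩ := hv
    have hx0 : x ≠ 0 := by rintro rfl; exact h0 (map_zero _)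
    have hAx : A x = x + t • Q x := by simp [A]
    rw [hAx]
    rcases hgap x hx hx0 with h1 | h1
    · have h2 : 1 ≤ ‖x + t • Q x‖ ^ 2 := by
        rw [norm_add_sq_real, inner_smul_right, hQin, hB x hx h1, h1]
        nlinarith [sq_nonneg ‖t • Q x‖]
      nlinarith [norm_nonneg (x + t • Q x)]
    · have h2 : ‖x‖ ≤ ‖x + t • Q x‖ + ‖t • Q x‖ := by
        have := norm_sub_le (x + t • Q x) (t • Q x)
        simpa using this
      rw [norm_smul, Real.norm_eq_abs, abs_of_pos htp] at h2
      have := hC x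
      nlinarith
  obtain ⟨hd1, hd2⟩ := hdet t htp htt0
  have := dB_le (by rw [gdet_map, hdA]; exact mul_ne_zero hd1.ne' hb) hadm
  rw [gdet_map, hdA, abs_mul, hcrit, abs_of_pos hd1] at this
  nlinarith [dB_pos n]

lemma perfect {n : ℕ} {b : Fin n → Euc n} (hA : Adm b) (hcrit : |gdet b| = dB n)
    (B : Euc n →ₗ[ℝ] Euc n →ₗ[ℝ] ℝ) (hB : ∀ v ∈ Lb b, ‖v‖ = 1 → B v v = 0) (v : Euc n) : B v v = 0 := by
  let e : Fin n → Euc n := fun i => EuclideanSpace.single i 1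
  let q : Matrix (Fin n) (Fin n) ℝ := Matrix.of fun i j => (B (e i) (e j) + B (e j) (e i))
  have hq : q.IsHermitian := by
    ext i j; simp [q, add_comm]
  have hx : ∀ x : Euc n, x = ∑ i, x i • e i := by
    intro x
    have e1 := (EuclideanSpace.basisFun (Fin n) ℝ).toBasis.sum_repr x
    simpa using e1.symm
  have hBq : ∀ x : Euc n, ∑ i, ∑ j, q i j * x i * x j = 2 * B x x := by
    intro x
    have e1 : B x x = ∑ i, ∑ j, x i * x j * B (e i) (e j) := by
      conv_lhs => rw [hx x]
      simp only [map_sum, LinearMap.sum_apply, map_smul, LinearMap.smul_apply, smul_eq_mul, Finset.mul_sum]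
      try rw [Finset.sum_comm]
      exact Finset.sum_congr rfl fun i _ => Finset.sum_congr rfl fun j _ => by ring
    have e2 : B x x = ∑ i, ∑ j, x i * x j * B (e j) (e i) := by
      rw [e1, Finset.sum_comm]
      exact Finset.sum_congr rfl fun i _ => Finset.sum_congr rfl fun j _ => by ring
    rw [two_mul]
    nth_rewrite 1 [e1]
    rw [e2, ← Finset.sum_add_distrib]
    refine Finset.sum_congr rfl fun i _ => ?_
    rw [← Finset.sum_add_distrib]
    exact Finset.sum_congr rfl fun j _ => by simp [q]; ring
  have hq0 : q = 0 := by
    rcases le_total q.trace 0 with h | h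
    · exact perfect_aux hA hcrit q hq h fun v hv h1 => by rw [hBq, hB v hv h1, mul_zero]
    · have := perfect_aux hA hcrit (-q) hq.neg (by simpa using h) fun v hv h1 => by
        have := hBq v
        rw [hB v hv h1, mul_zero] at this
        simpa using this
      simpa using this
  have := hBq v
  rw [hq0] at this
  simpa using this.symm

lemma crit_ne {n : ℕ} {b : Fin n → Euc n} (hcrit : |gdet b| = dB n) : gdet b ≠ 0 := by
  intro h; rw [h, abs_zero] at hcrit; exact (dB_pos n).ne hcrit

end

section
open scoped RealInnerProductSpace
open Metric MeasureTheory

lemma watson_identity {n k : ℕ} (b : Fin k → Euc n) (h1 : ∀ i, ‖b i‖ = 1) (x s : Fin k → ℝ)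
    (hs : ∀ i, s i ^ 2 = 1) (hsx : ∀ i, s i * |x i| = x i) (w : Euc n) (hw : w = ∑ i, x i • b i) :
    ∑ i, |x i| * (‖w - s i • b i‖ ^ 2 - 1) = (∑ i, |x i| - 2) * ‖w‖ ^ 2 := by
  have e1 : ∀ i, |x i| * (‖w - s i • b i‖ ^ 2 - 1) = |x i| * ‖w‖ ^ 2 - 2 * ⟪w, x i • b i⟫ := by
    intro i
    rw [norm_sub_sq_real, inner_smul_right, norm_smul, h1, mul_one, Real.norm_eq_abs, sq_abs, hs, inner_smul_right]
    have := hsx i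
    linear_combination (-2 * ⟪w, b i⟫) * this
  simp_rw [e1]
  rw [Finset.sum_sub_distrib, ← Finset.sum_mul, ← Finset.mul_sum, ← inner_sum, ← hw, real_inner_self_eq_norm_sq]
  ring

lemma exists_sign (x : ℝ) : ∃ s : ℝ, ∃ m : ℤ, s = m ∧ s ^ 2 = 1 ∧ s * |x| = x := by
  rcases le_total 0 x with h | h
  · exact ⟨1, 1, by simp, by simp, by simp [abs_of_nonneg h]⟩
  · exact ⟨-1, -1, by simp, by simp, by simp [abs_of_nonpos h]⟩

lemma watson1 {n k : ℕ} {T : Fin n → Euc n} (hA : Adm T) (b : Fin k → Euc n) (h1 : ∀ i, ‖b i‖ = 1)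
    (hbT : ∀ i, b i ∈ Lb T) (x : Fin k → ℝ) (hw : ∑ i, x i • b i ∈ Lb T) (hn : ∑ i, x i • b i ∉ Lb b) :
    2 ≤ ∑ i, |x i| := by
  choose s m hsm hs2 hsx using fun i => exists_sign (x i)
  have hid := watson_identity b h1 x s hs2 hsx _ rfl
  set w := ∑ i, x i • b i with hwd
  have hge : 0 ≤ ∑ i, |x i| * (‖w - s i • b i‖ ^ 2 - 1) := by
    refine Finset.sum_nonneg fun i _ => mul_nonneg (abs_nonneg _) ?_
    have hm : s i • b i ∈ Lb b := by rw [hsm]; exact Lb_zsmul _ (Lb_self i)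
    have hm2 : s i • b i ∈ Lb T := by rw [hsm]; exact Lb_zsmul _ (hbT i)
    have : 1 ≤ ‖w - s i • b i‖ := hA _ (Lb_sub hw hm2) fun h => hn (by rw [sub_eq_zero.1 h]; exact hm)
    nlinarith
  have hw0 : w ≠ 0 := fun h => hn (h ▸ Lb_zero)
  have : 0 < ‖w‖ ^ 2 := by positivity
  rw [hid] at hge
  by_contra hc
  push Not at hc
  nlinarith

lemma int_mem_Lb {n k : ℕ} (b : Fin k → Euc n) (z : Fin k → ℤ) : ∑ i, (z i : ℝ) • b i ∈ Lb b := ⟨z, rfl⟩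

lemma watson2 {n k : ℕ} (hk : k ≤ 5) {T : Fin n → Euc n} (hA : Adm T) (b : Fin k → Euc n) (h1 : ∀ i, ‖b i‖ = 1)
    (hbT : ∀ i, b i ∈ Lb T) (x : Fin k → ℝ) (hw : ∑ i, x i • b i ∈ Lb T) : (2:ℝ) • ∑ i, x i • b i ∈ Lb b := by
  by_contra hn
  set y : Fin k → ℝ := fun i => x i - round (x i) with hy
  have hyx : ∑ i, y i • b i = ∑ i, x i • b i - ∑ i, (round (x i) : ℝ) • b i := by
    rw [← Finset.sum_sub_distrib]; exact Finset.sum_congr rfl fun i _ => by rw [hy]; simp [sub_smul]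
  have hyT : ∑ i, y i • b i ∈ Lb T := by
    rw [hyx]; exact Lb_sub hw (Lb_le hbT (int_mem_Lb b _))
  have h2y : (2:ℝ) • ∑ i, y i • b i ∉ Lb b := by
    intro h
    apply hn
    rw [hyx, smul_sub] at h
    have := Lb_add h (Lb_zsmul 2 (int_mem_Lb b fun i => round (x i)))
    push_cast at this
    simpa using this
  have hyn : ∑ i, y i • b i ∉ Lb b := fun h => h2y (by simpa using Lb_zsmul 2 h)
  have hW1 := watson1 hA b h1 hbT y hyT hyn
  choose s m hsm hs2 hsx using fun i => exists_sign (y i)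
  have hyle : ∀ i, |y i| ≤ 1/2 := fun i => abs_sub_round _
  have e2 : ∑ i, (2 * y i - s i) • b i = (2:ℝ) • ∑ i, y i • b i - ∑ i, (m i : ℝ) • b i := by
    rw [Finset.smul_sum, ← Finset.sum_sub_distrib]
    exact Finset.sum_congr rfl fun i _ => by rw [sub_smul, hsm, mul_smul]
  have hW2 := watson1 hA b h1 hbT (fun i => 2 * y i - s i) (by
      rw [e2]; exact Lb_sub (by simpa using Lb_zsmul 2 hyT) (Lb_le hbT (int_mem_Lb b _))) (by
      rw [e2]; intro h; exact h2y (by simpa using Lb_add h (int_mem_Lb b m)))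
  have e3 : ∀ i, |2 * y i - s i| = 1 - 2 * |y i| := by
    intro i
    have h3 : 2 * y i - s i = s i * (2 * |y i| - 1) := by linear_combination -2 * hsx i
    have h4 : |s i| = 1 := by
      have := hs2 i
      rw [← sq_abs] at this
      nlinarith [abs_nonneg (s i)]
    rw [h3, abs_mul, h4, one_mul, abs_of_nonpos (by linarith [hyle i])]
    ring
  simp_rw [e3] at hW2
  rw [Finset.sum_sub_distrib, ← Finset.mul_sum] at hW2
  simp at hW2
  have : (k : ℝ) ≤ 5 := by exact_mod_cast hk
  linarith

lemma coord_of_mem {n k : ℕ} {b : Fin k → Euc n} (hli : LinearIndependent ℝ b) {x y : Fin k → ℝ}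
    (h : ∑ i, x i • b i = ∑ i, y i • b i) : x = y := by
  have := Fintype.linearIndependent_iff.1 hli (fun i => x i - y i) (by
    simp [sub_smul, Finset.sum_sub_distrib, h])
  funext i
  linarith [this i]

/-- contains an orthonormal 4-tuple with its half-sum -/
def D4type {n : ℕ} (T : Fin n → Euc n) : Prop :=
  ∃ e : Fin 4 → Euc n, Orthonormal ℝ e ∧ (∀ i, e i ∈ Lb T) ∧ (1/2 : ℝ) • ∑ i, e i ∈ Lb T

lemma weight4 {n : ℕ} {T : Fin n → Euc n} (hA : Adm T) (c : Fin 4 → Euc n) (h1 : ∀ i, ‖c i‖ = 1)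
    (hli : LinearIndependent ℝ c)
    (hcT : ∀ i, c i ∈ Lb T) (hw : (1/2 : ℝ) • ∑ i, c i ∈ Lb T) : Orthonormal ℝ c := by
  -- all half sums have norm one
  have key : ∀ s : Fin 4 → ℝ, (∀ i, s i = 1 ∨ s i = -1) → ∑ i, (s i / 2) • c i ∈ Lb T ∧ ∀ i, ‖∑ j, (s j / 2) • c j - s i • c i‖ = 1 := by
    intro s hs
    have hs2 : ∀ i, s i ^ 2 = 1 := fun i => by rcases hs i with h | h <;> rw [h] <;> norm_num
    have hInt : ∀ i, ∃ m : ℤ, (s i / 2) = 1/2 + m := fun i => by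
      rcases hs i with h | h
      · exact ⟨0, by rw [h]; simp⟩
      · exact ⟨-1, by rw [h]; norm_num⟩
    have hsm : ∀ i, ∃ m : ℤ, s i = m := fun i => by
      rcases hs i with h | h
      · exact ⟨1, by rw [h]; simp⟩
      · exact ⟨-1, by rw [h]; norm_num⟩
    choose m hm using hInt
    have hmem : ∑ i, (s i / 2) • c i ∈ Lb T := by
      have : ∑ i, (s i / 2) • c i = (1/2 : ℝ) • ∑ i, c i + ∑ i, (m i : ℝ) • c i := by
        rw [Finset.smul_sum, ← Finset.sum_add_distrib]
        exact Finset.sum_congr rfl fun i _ => by rw [hm, add_smul]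
      rw [this]; exact Lb_add hw (Lb_le hcT (int_mem_Lb c m))
    have habs : ∀ i, |s i / 2| = 1/2 := fun i => by
      rcases hs i with h | h <;> rw [h] <;> norm_num
    have hid := watson_identity c h1 (fun i => s i / 2) s hs2 (fun i => by rw [habs]; ring) _ rfl
    simp only [habs] at hid
    set w := ∑ i, (s i / 2) • c i with hwd
    have hge : ∀ i, 1 ≤ ‖w - s i • c i‖ := by
      intro i
      obtain ⟨m', hm'⟩ := hsm i
      refine hA _ (Lb_sub hmem (by rw [hm']; exact Lb_zsmul _ (hcT i))) fun h => ?_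
      have h2 : ∑ j, (s j / 2) • c j = ∑ j, (if j = i then s i else 0) • c j := by
        rw [← hwd, sub_eq_zero.1 h]; simp
      have h3 := congrFun (coord_of_mem hli h2) i
      simp at h3
      have := hs2 i
      have h4 : s i = 0 := by linarith
      rw [h4] at this; norm_num at this
    have hz : ∑ i, (1/2 : ℝ) * (‖w - s i • c i‖ ^ 2 - 1) = 0 := by
      rw [hid]; norm_num
    have hz2 := (Finset.sum_eq_zero_iff_of_nonneg (fun i _ => by nlinarith [hge i])).1 hz
    refine ⟨hmem, fun i => ?_⟩
    have := hz2 i (Finset.mem_univ _)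
    nlinarith [hge i]
  have key2 : ∀ s : Fin 4 → ℝ, (∀ i, s i = 1 ∨ s i = -1) → ‖∑ i, (s i / 2) • c i‖ ^ 2 = 1 := by
    intro s hs
    have := (key (Function.update s 0 (-s 0)) (fun i => by
      by_cases h : i = 0
      · subst h; simp; rcases hs 0 with h | h <;> rw [h] <;> norm_num
      · simp [h, hs i])).2 0
    have e : ∑ j, (Function.update s 0 (-s 0) j / 2) • c j - Function.update s 0 (-s 0) 0 • c 0 = ∑ i, (s i / 2) • c i := by
      simp [Fin.sum_univ_four]
      module
    rw [e] at this
    rw [this]; norm_num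
  have hexp : ∀ s : Fin 4 → ℝ, (∀ i, s i = 1 ∨ s i = -1) →
      s 0 * s 1 * ⟪c 0, c 1⟫ + s 0 * s 2 * ⟪c 0, c 2⟫ + s 0 * s 3 * ⟪c 0, c 3⟫ + s 1 * s 2 * ⟪c 1, c 2⟫
        + s 1 * s 3 * ⟪c 1, c 3⟫ + s 2 * s 3 * ⟪c 2, c 3⟫ = (0 : ℝ) := by
    intro s hs
    have h := key2 s hs
    have hs2 : ∀ i, s i ^ 2 = 1 := fun i => by rcases hs i with h | h <;> rw [h] <;> norm_num
    rw [← real_inner_self_eq_norm_sq] at h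
    simp only [Fin.sum_univ_four, inner_add_left, inner_add_right, real_inner_smul_left, inner_smul_right,
      real_inner_self_eq_norm_sq, h1, real_inner_comm (c 0) (c 1), real_inner_comm (c 0) (c 2), real_inner_comm (c 0) (c 3),
      real_inner_comm (c 1) (c 2), real_inner_comm (c 1) (c 3), real_inner_comm (c 2) (c 3)] at h
    have a0 := hs2 0
    have a1 := hs2 1
    have a2 := hs2 2
    have a3 := hs2 3
    linear_combination 2 * h - (a0 + a1 + a2 + a3) / 2
  have f1 := hexp ![1,1,1,1] (by intro i; fin_cases i <;> simp)
  have f2 := hexp ![-1,1,1,1] (by intro i; fin_cases i <;> simp)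
  have f3 := hexp ![1,-1,1,1] (by intro i; fin_cases i <;> simp)
  have f4 := hexp ![1,1,-1,1] (by intro i; fin_cases i <;> simp)
  have f5 := hexp ![1,1,1,-1] (by intro i; fin_cases i <;> simp)
  have f6 := hexp ![-1,-1,1,1] (by intro i; fin_cases i <;> simp)
  have f7 := hexp ![-1,1,-1,1] (by intro i; fin_cases i <;> simp)
  have f8 := hexp ![-1,1,1,-1] (by intro i; fin_cases i <;> simp)
  simp at f1 f2 f3 f4 f5 f6 f7 f8
  have g01 : ⟪c 0, c 1⟫ = (0:ℝ) := by linarith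
  have g02 : ⟪c 0, c 2⟫ = (0:ℝ) := by linarith
  have g03 : ⟪c 0, c 3⟫ = (0:ℝ) := by linarith
  have g12 : ⟪c 1, c 2⟫ = (0:ℝ) := by linarith
  have g13 : ⟪c 1, c 3⟫ = (0:ℝ) := by linarith
  have g23 : ⟪c 2, c 3⟫ = (0:ℝ) := by linarith
  refine ⟨h1, ?_⟩
  intro i j hij
  fin_cases i <;> fin_cases j <;> simp at hij ⊢ <;> first | assumption | (rw [real_inner_comm]; assumption)

lemma dichotomy {n k : ℕ} (hk : k ≤ 5) {T : Fin n → Euc n} (hA : Adm T) (hD : ¬ D4type T) (b : Fin k → Euc n)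
    (h1 : ∀ i, ‖b i‖ = 1) (hli : LinearIndependent ℝ b) (hbT : ∀ i, b i ∈ Lb T) (x : Fin k → ℝ)
    (hw : ∑ i, x i • b i ∈ Lb T) :
    (∀ i, ∃ m : ℤ, x i = m) ∨ (k = 5 ∧ ∀ i, ∃ m : ℤ, x i = m + 1/2) := by
  classical
  obtain ⟨z, hz⟩ := watson2 hk hA b h1 hbT x hw
  have hz' : ∀ i, 2 * x i = z i := by
    intro i
    refine congrFun (coord_of_mem hli (x := fun i => 2 * x i) (y := fun i => (z i : ℝ)) ?_) i
    rw [← hz, Finset.smul_sum]; simp [mul_smul]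
  let J : Finset (Fin k) := Finset.univ.filter fun i => ¬ Even (z i)
  have hx : ∀ i, ∃ m : ℤ, x i = m + (if i ∈ J then 1/2 else 0) := by
    intro i
    by_cases hi : Even (z i)
    · obtain ⟨m, hm⟩ := hi
      refine ⟨m, ?_⟩
      have := hz' i
      rw [hm] at this; push_cast at this
      have hJ : i ∉ J := by simp [J, hm]
      simp only [hJ, if_false]; linarith
    · obtain ⟨m, hm⟩ := Int.not_even_iff_odd.1 hi
      refine ⟨m, ?_⟩
      have := hz' i
      rw [hm] at this; push_cast at this
      have hJ : i ∈ J := by simp only [J, Finset.mem_filter]; exact ⟨Finset.mem_univ _, hi⟩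
      simp only [hJ, if_true]; linarith
  choose m hm using hx
  have hw0 : ∑ i, (if i ∈ J then (1/2 : ℝ) else 0) • b i ∈ Lb T := by
    have : ∑ i, (if i ∈ J then (1/2 : ℝ) else 0) • b i = ∑ i, x i • b i - ∑ i, (m i : ℝ) • b i := by
      rw [← Finset.sum_sub_distrib]
      exact Finset.sum_congr rfl fun i _ => by rw [hm i]; rw [add_smul]; simp
    rw [this]; exact Lb_sub hw (Lb_le hbT (int_mem_Lb b m))
  rcases J.eq_empty_or_nonempty with hJ | ⟨i0, hi0⟩
  · left; intro i; exact ⟨m i, by rw [hm i]; simp [hJ]⟩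
  have hnot : ∑ i, (if i ∈ J then (1/2 : ℝ) else 0) • b i ∉ Lb b := by
    rintro ⟨y, hy⟩
    have := congrFun (coord_of_mem hli hy) i0
    simp only [hi0, if_true] at this
    have h2 : (2 * y i0 : ℝ) = 1 := by linarith
    have h3 : 2 * y i0 = 1 := by exact_mod_cast h2
    omega
  have hW := watson1 hA b h1 hbT _ hw0 hnot
  have hsum : ∑ i, |(if i ∈ J then (1/2 : ℝ) else 0)| = J.card * (1/2) := by
    rw [← nsmul_eq_mul, ← Finset.sum_const]
    rw [Finset.sum_congr rfl (fun i _ => show |(if i ∈ J then (1/2 : ℝ) else 0)| = if i ∈ J then (1/2 : ℝ) else 0 by split_ifs <;> norm_num)]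
    simp [Finset.sum_ite_mem]
  rw [hsum] at hW
  have hJ4 : 4 ≤ J.card := by
    have : (4 : ℝ) ≤ J.card := by linarith
    exact_mod_cast this
  have hJk : J.card ≤ k := by simpa using Finset.card_le_univ J
  rcases hJ4.eq_or_lt with h4 | h5
  · exfalso
    apply hD
    let f := J.orderEmbOfFin h4.symm
    have hf : (1/2 : ℝ) • ∑ i, b (f i) = ∑ i, (if i ∈ J then (1/2 : ℝ) else 0) • b i := by
      simp only [ite_smul, zero_smul, Finset.sum_ite_mem, Finset.univ_inter]
      rw [← Finset.smul_sum]
      congr 1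
      rw [show ∑ i, b (f i) = ∑ x ∈ Finset.univ.map f.toEmbedding, b x from (Finset.sum_map Finset.univ f.toEmbedding b).symm]
      congr 1
      ext j
      have hr := Finset.range_orderEmbOfFin J h4.symm
      have : j ∈ Set.range f ↔ j ∈ J := by rw [hr]; simp
      rw [← this]; simp
    refine ⟨fun i => b (f i), weight4 hA _ (fun i => h1 _) (hli.comp _ f.injective) (fun i => hbT _) ?_, fun i => hbT _, ?_⟩
    · rw [hf]; exact hw0
    · rw [hf]; exact hw0
  · right
    have hk5 : k = 5 := by omega
    refine ⟨hk5, fun i => ⟨m i, ?_⟩⟩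
    have hJu : J = Finset.univ := by
      rw [← Finset.card_eq_iff_eq_univ]; simp; omega
    rw [hm i]; simp [hJu]

end

section
open scoped RealInnerProductSpace
open Metric MeasureTheory

lemma on_norm {n k : ℕ} {g : Fin k → Euc n} (hg : Orthonormal ℝ g) (x : Fin k → ℝ) :
    ‖∑ i, x i • g i‖ ^ 2 = ∑ i, x i ^ 2 := by
  rw [← real_inner_self_eq_norm_sq, hg.inner_sum]
  simp [sq]

lemma on_expand {n : ℕ} {g : Fin n → Euc n} (hg : Orthonormal ℝ g) (v : Euc n) : v = ∑ i, ⟪g i, v⟫ • g i := by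
  have hli := hg.linearIndependent
  let B := OrthonormalBasis.mk hg (span_top_of_li hli).ge
  have := B.sum_repr' v
  simpa [B] using this.symm

lemma on_gdet {n : ℕ} {g : Fin n → Euc n} (hg : Orthonormal ℝ g) : gdet g ^ 2 = 1 := by
  rw [gdet_sq]
  have : gram g = 1 := by
    ext i j
    rw [gram, Matrix.of_apply, Matrix.one_apply, orthonormal_iff_ite.1 hg]
  rw [this, Matrix.det_one]

/-- pattern of equality -/
def TwoHalf (y : Fin 4 → ℝ) : Prop := ∃ i j : Fin 4, i ≠ j ∧ |y i| = 1/2 ∧ |y j| = 1/2 ∧ ∀ k, k ≠ i → k ≠ j → y k = 0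

lemma covering (x : Fin 4 → ℝ) : ∃ (z : Fin 4 → ℤ) (ε : ℤ), ∃ y : Fin 4 → ℝ, (∀ i, y i = x i - z i - ε / 2) ∧
    (∑ i, y i ^ 2 < 1/2 ∨ (∑ i, y i ^ 2 = 1/2 ∧ TwoHalf y)) := by
  set y : Fin 4 → ℝ := fun i => x i - round (x i) with hy
  have hle : ∀ i, |y i| ≤ 1/2 := fun i => abs_sub_round _
  rcases lt_or_ge 1 (∑ i, |y i|) with h | h
  · choose s m hsm hs2 hsx using fun i => exists_sign (y i)
    have hodd : ∀ i, ∃ q : ℤ, (m i : ℝ) = 2 * q + 1 := by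
      intro i
      have h1 := hs2 i
      rw [hsm i] at h1
      rcases sq_eq_one_iff.1 h1 with h2 | h2
      · exact ⟨0, by rw [h2]; simp⟩
      · exact ⟨-1, by rw [h2]; norm_num⟩
    choose q hq using hodd
    refine ⟨fun i => round (x i) + q i, 1, fun i => y i - s i / 2, fun i => ?_, Or.inl ?_⟩
    · simp only [hy]; rw [hsm i, hq i]; push_cast; ring
    · have e : ∀ i, (y i - s i / 2) ^ 2 = (1/2 - |y i|) ^ 2 := by
        intro i
        have h1 := hsx i
        have h2 := hs2 i
        have h3 := sq_abs (y i)
        linear_combination -(|y i|) * h2 + s i * h1 - h3 + h2 * (1/4)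
      simp_rw [e]
      have : ∀ i, (1/2 - |y i|) ^ 2 ≤ (1/2 - |y i|) * (1/2) := fun i => by
        nlinarith [hle i, abs_nonneg (y i)]
      refine lt_of_le_of_lt (Finset.sum_le_sum fun i _ => this i) ?_
      rw [← Finset.sum_mul, Finset.sum_sub_distrib]
      simp
      linarith
  · refine ⟨fun i => round (x i), 0, y, fun i => by simp [hy], ?_⟩
    have h1 : ∀ i, y i ^ 2 ≤ |y i| / 2 := fun i => by
      rw [← sq_abs]; nlinarith [hle i, abs_nonneg (y i)]
    simp only [Fin.sum_univ_four] at h ⊢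
    rcases lt_or_ge (y 0 ^ 2 + y 1 ^ 2 + y 2 ^ 2 + y 3 ^ 2) (1/2) with h2 | h2
    · exact Or.inl h2
    · right
      have a0 := h1 0
      have a1 := h1 1
      have a2 := h1 2
      have a3 := h1 3
      refine ⟨by linarith, ?_⟩
      have hs : |y 0| + |y 1| + |y 2| + |y 3| = 1 := by linarith
      have hz : ∀ i, y i ^ 2 = |y i| / 2 := by
        intro i
        fin_cases i <;> simp <;> linarith
      have hz2 : ∀ i, |y i| = 1/2 ∨ |y i| = 0 := by
        intro i
        have := hz i
        rw [← sq_abs] at this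
        have h3 : |y i| * (|y i| - 1/2) = 0 := by linarith
        rcases mul_eq_zero.1 h3 with h4 | h4
        · exact Or.inr h4
        · left; linarith
      have fin : ∀ i j k l : Fin 4, i ≠ j → (∀ m, m ≠ i → m ≠ j → m = k ∨ m = l) → |y i| = 1/2 → |y j| = 1/2 → |y k| = 0 → |y l| = 0 → TwoHalf y := by
        intro i j k l hij hm h1 h2 h3 h4
        refine ⟨i, j, hij, h1, h2, fun m hmi hmj => ?_⟩
        rcases hm m hmi hmj with rfl | rfl
        · exact abs_eq_zero.1 h3
        · exact abs_eq_zero.1 h4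
      rcases hz2 0 with b0 | b0 <;> rcases hz2 1 with b1 | b1 <;> rcases hz2 2 with b2 | b2 <;> rcases hz2 3 with b3 | b3 <;>
        rw [b0, b1, b2, b3] at hs <;> first | (exfalso; norm_num at hs; done) | skip
      · exact fin 0 1 2 3 (by decide) (by decide) b0 b1 b2 b3
      · exact fin 0 2 1 3 (by decide) (by decide) b0 b2 b1 b3
      · exact fin 0 3 1 2 (by decide) (by decide) b0 b3 b1 b2
      · exact fin 1 2 0 3 (by decide) (by decide) b1 b2 b0 b3
      · exact fin 1 3 0 2 (by decide) (by decide) b1 b3 b0 b2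
      · exact fin 2 3 0 1 (by decide) (by decide) b2 b3 b0 b1

/-- An orthonormal frame exhibiting `D_n/√2` inside the lattice -/
def Frame {n : ℕ} (T f : Fin n → Euc n) : Prop :=
  Orthonormal ℝ f ∧ ∀ i j, i ≠ j → (1/√2 : ℝ) • (f i + f j) ∈ Lb T ∧ (1/√2 : ℝ) • (f i - f j) ∈ Lb T

lemma frame_of_zero {n : ℕ} {T f : Fin n → Euc n} (hf : Orthonormal ℝ f) (i0 : Fin n)
    (h : ∀ j, j ≠ i0 → (1/√2 : ℝ) • (f i0 + f j) ∈ Lb T ∧ (1/√2 : ℝ) • (f i0 - f j) ∈ Lb T) : Frame T f := by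
  refine ⟨hf, fun i j hij => ?_⟩
  by_cases hi : i = i0
  · subst hi; exact h j hij.symm
  by_cases hj : j = i0
  · subst hj
    obtain ⟨h1, h2⟩ := h i hi
    refine ⟨by rwa [add_comm], ?_⟩
    have := Lb_neg h2
    rwa [← smul_neg, neg_sub] at this
  · obtain ⟨h1, h2⟩ := h i hi
    obtain ⟨h3, h4⟩ := h j hj
    constructor
    · have := Lb_sub h1 h4
      rw [← smul_sub] at this
      convert this using 2
      abel
    · have := Lb_sub h1 h3
      rw [← smul_sub] at this
      convert this using 2
      abel

/-- the `D_n` basis -/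
def dbas {n : ℕ} (f : Fin n → Euc n) (M : Matrix (Fin n) (Fin n) ℤ) : Fin n → Euc n :=
  fun j => ∑ i, ((M i j : ℝ) * (1/√2)) • f i

def DM4 : Matrix (Fin 4) (Fin 4) ℤ := !![1,1,0,0; 1,-1,1,0; 0,0,-1,1; 0,0,0,-1]
def DM5 : Matrix (Fin 5) (Fin 5) ℤ := !![1,1,0,0,0; 1,-1,1,0,0; 0,0,-1,1,0; 0,0,0,-1,1; 0,0,0,0,-1]

lemma DM4_det : DM4.det = -2 := by
  simp [DM4, Matrix.det_succ_row_zero, Fin.sum_univ_succ, Fin.succAbove]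
lemma DM5_det : DM5.det = 2 := by
  simp [DM5, Matrix.det_succ_row_zero, Fin.sum_univ_succ, Fin.succAbove]

lemma sqrt2_inv_sq : (1/√2 : ℝ) ^ 2 = 1/2 := by
  rw [div_pow, Real.sq_sqrt (by norm_num)]; norm_num

lemma dbas_gdet {n : ℕ} {f : Fin n → Euc n} (hf : Orthonormal ℝ f) (M : Matrix (Fin n) (Fin n) ℤ) :
    gdet (dbas f M) ^ 2 = (M.det : ℝ) ^ 2 * (1/2) ^ n := by
  have := gdet_comb f (dbas f M) ((1/√2 : ℝ) • (M.map (Int.castRingHom ℝ))) (fun j => by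
    simp [dbas, mul_comm])
  rw [this, mul_pow, on_gdet hf, one_mul, Matrix.det_smul, mul_pow, ← RingHom.mapMatrix_apply, ← RingHom.map_det, ← pow_mul, mul_comm _ 2, pow_mul, sqrt2_inv_sq]
  simp [mul_comm]

lemma dbas_mem {n : ℕ} {f : Fin n → Euc n} (M : Matrix (Fin n) (Fin n) ℤ) (hM : ∀ j, Even (∑ i, M i j)) {v : Euc n} (hv : v ∈ Lb (dbas f M)) :
    ∃ z : Fin n → ℤ, Even (∑ i, z i) ∧ v = ∑ i, ((z i : ℝ) * (1/√2)) • f i := by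
  obtain ⟨y, rfl⟩ := hv
  refine ⟨fun i => ∑ j, M i j * y j, ?_, ?_⟩
  · rw [Finset.sum_comm]
    simp_rw [← Finset.sum_mul]
    exact Finset.even_sum _ fun j _ => (hM j).mul_right _
  · simp only [dbas, Finset.smul_sum, smul_smul]
    rw [Finset.sum_comm]
    refine Finset.sum_congr rfl fun i _ => ?_
    rw [← Finset.sum_smul]
    congr 1
    push_cast
    rw [Finset.sum_mul]
    exact Finset.sum_congr rfl fun j _ => by ring

lemma even_sum_sq {n : ℕ} (z : Fin n → ℤ) (h : Even (∑ i, z i)) (h0 : z ≠ 0) : 2 ≤ ∑ i, z i ^ 2 := by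
  have h1 : Even (∑ i, z i ^ 2) := by
    have : Even (∑ i, z i ^ 2 - ∑ i, z i) := by
      rw [← Finset.sum_sub_distrib]
      refine Finset.even_sum _ fun i _ => ?_
      have := Int.even_mul_pred_self (z i)
      rwa [show z i ^ 2 - z i = z i * (z i - 1) by ring]
    simpa using this.add h
  have h2 : 0 < ∑ i, z i ^ 2 := by
    obtain ⟨i, hi⟩ := Function.ne_iff.1 h0
    exact Finset.sum_pos' (fun i _ => sq_nonneg _) ⟨i, Finset.mem_univ _, by simp at hi; positivity⟩
  obtain ⟨r, hr⟩ := h1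
  omega

lemma dbas_adm {n : ℕ} {f : Fin n → Euc n} (hf : Orthonormal ℝ f) (M : Matrix (Fin n) (Fin n) ℤ) (hM : ∀ j, Even (∑ i, M i j)) :
    Adm (dbas f M) := by
  intro v hv h0
  obtain ⟨z, hz, rfl⟩ := dbas_mem M hM hv
  have hz0 : z ≠ 0 := by rintro rfl; simp at h0
  have h2 := even_sum_sq z hz hz0
  have h3 := on_norm hf (fun i => (z i : ℝ) * (1/√2))
  simp only [mul_pow, sqrt2_inv_sq] at h3
  rw [← Finset.sum_mul] at h3
  have h4 : (2 : ℝ) ≤ ∑ i, (z i : ℝ) ^ 2 := by exact_mod_cast h2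
  by_contra hc
  push Not at hc
  nlinarith [norm_nonneg (∑ i, ((z i : ℝ) * (1/√2)) • f i)]

lemma std_on (n : ℕ) : Orthonormal ℝ (fun i : Fin n => (EuclideanSpace.single i 1 : Euc n)) := by
  have := (EuclideanSpace.basisFun (Fin n) ℝ).orthonormal
  have e : (fun i : Fin n => (EuclideanSpace.single i 1 : Euc n)) = EuclideanSpace.basisFun (Fin n) ℝ := by
    funext i; simp
  rw [e]; exact this

lemma DM4_even : ∀ j, Even (∑ i, DM4 i j) := by decide
lemma DM5_even : ∀ j, Even (∑ i, DM5 i j) := by decide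

lemma sq_le_of_dB {n : ℕ} {b : Fin n → Euc n} {d : ℝ} (hd : 0 < d) (hb : gdet b ^ 2 = d) (hA : Adm b) : dB n ^ 2 ≤ d := by
  have h0 : gdet b ≠ 0 := by rintro h; rw [h] at hb; simp at hb; linarith
  have := dB_le h0 hA
  rw [← hb, ← sq_abs (gdet b)]
  have := dB_pos n
  gcongr

lemma dB4_le : dB 4 ^ 2 ≤ 1/4 :=
  sq_le_of_dB (by norm_num) (by rw [dbas_gdet (std_on 4) DM4, DM4_det]; norm_num) (dbas_adm (std_on 4) DM4 DM4_even)
lemma dB5_le : dB 5 ^ 2 ≤ 1/8 :=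
  sq_le_of_dB (by norm_num) (by rw [dbas_gdet (std_on 5) DM5, DM5_det]; norm_num) (dbas_adm (std_on 5) DM5 DM5_even)

end

section
open scoped RealInnerProductSpace
open Metric MeasureTheory

lemma on_comb {n k l : ℕ} {g : Fin k → Euc n} (hg : Orthonormal ℝ g) (O : Fin l → Fin k → ℝ)
    (hO : ∀ i j, ∑ m, O i m * O j m = if i = j then 1 else 0) : Orthonormal ℝ (fun j => ∑ m, O j m • g m) := by
  rw [orthonormal_iff_ite]
  intro i j
  rw [hg.inner_sum]
  simpa using hO i j

lemma hur {n : ℕ} {T : Fin n → Euc n} {e : Fin 4 → Euc n} (he : ∀ i, e i ∈ Lb T) (hh : (1/2 : ℝ) • ∑ i, e i ∈ Lb T)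
    (z : Fin 4 → ℤ) (ε : ℤ) : ∑ i, ((z i : ℝ) + ε / 2) • e i ∈ Lb T := by
  have : ∑ i, ((z i : ℝ) + ε / 2) • e i = ∑ i, (z i : ℝ) • e i + (ε : ℝ) • ((1/2 : ℝ) • ∑ i, e i) := by
    rw [Finset.smul_sum, Finset.smul_sum, ← Finset.sum_add_distrib]
    refine Finset.sum_congr rfl fun i _ => ?_
    rw [add_smul, smul_smul]; congr 2; ring
  rw [this]
  exact Lb_add (Lb_le he (int_mem_Lb e z)) (Lb_zsmul _ hh)

lemma D4_four {T : Fin 4 → Euc 4} (hA : Adm T) (hT : gdet T ≠ 0) (hD : D4type T) :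
    gdet T ^ 2 = 1/4 ∧ ∃ f, Frame T f := by
  obtain ⟨e, hon, he, hh⟩ := hD
  constructor
  · let c : Fin 4 → Euc 4 := ![(1/2 : ℝ) • ∑ i, e i, e 1, e 2, e 3]
    have hcT : ∀ i, c i ∈ Lb T := by
      intro i; fin_cases i <;> simp [c, he] <;> simpa using hh
    have hTc : ∀ v ∈ Lb T, v ∈ Lb c := by
      intro v hv
      obtain ⟨z, ε, y, hy, hN⟩ := covering (fun i => ⟪e i, v⟫)
      have hw : ∑ i, y i • e i = v - ∑ i, ((z i : ℝ) + ε / 2) • e i := by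
        conv_rhs => rw [on_expand hon v]
        rw [← Finset.sum_sub_distrib]
        refine Finset.sum_congr rfl fun i _ => ?_
        rw [hy, ← sub_smul]; congr 1; ring
      have hwT : ∑ i, y i • e i ∈ Lb T := by rw [hw]; exact Lb_sub hv (hur he hh z ε)
      have hw0 : ∑ i, y i • e i = 0 := by
        by_contra h0
        have h1 := hA _ hwT h0
        have h2 := on_norm hon y
        rcases hN with h3 | ⟨h3, -⟩ <;> nlinarith
      have hv' : v = ∑ i, ((z i : ℝ) + ε / 2) • e i := by
        rw [hw, sub_eq_zero] at hw0; exact hw0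
      refine ⟨![ε + 2 * z 0, z 1 - z 0, z 2 - z 0, z 3 - z 0], ?_⟩
      rw [hv']
      simp [Fin.sum_univ_four, c]
      module
    have hL : Lb T = Lb c := Set.Subset.antisymm hTc (Lb_le hcT)
    have h1 := abs_gdet_eq hL hT
    have h2 := gdet_comb e c !![1/2, 0, 0, 0; 1/2, 1, 0, 0; 1/2, 0, 1, 0; 1/2, 0, 0, 1] (by
      intro j; fin_cases j <;> simp [c, Fin.sum_univ_four])
    rw [← sq_abs, h1, sq_abs, h2, mul_pow, on_gdet hon]
    simp [Matrix.det_succ_row_zero, Fin.sum_univ_succ]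
    norm_num
  · have hr := sqrt2_inv_sq
    set r : ℝ := 1/√2 with hrd
    have hon2 := on_comb hon (![![r, r, 0, 0], ![r, -r, 0, 0], ![0, 0, r, r], ![0, 0, r, -r]] : Fin 4 → Fin 4 → ℝ) (by
      intro i j
      fin_cases i <;> fin_cases j <;> simp [Fin.sum_univ_four] <;> nlinarith)
    refine ⟨_, frame_of_zero hon2 0 ?_⟩
    have hmem : ∀ x : Fin 4 → ℝ, (∃ (z : Fin 4 → ℤ) (ε : ℤ), ∀ i, x i = z i + ε / 2) → ∑ i, x i • e i ∈ Lb T := by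
      rintro x ⟨z, ε, h⟩
      simp_rw [h]
      exact hur he hh z ε
    have hcomb : ∀ (p q x : Fin 4 → ℝ), (∀ i, x i = r * (p i + q i)) → (r • (∑ i, p i • e i + ∑ i, q i • e i)) = ∑ i, x i • e i := by
      intro p q x h
      rw [← Finset.sum_add_distrib, Finset.smul_sum]
      refine Finset.sum_congr rfl fun i _ => ?_
      rw [h, ← add_smul, smul_smul]
    have hcomb2 : ∀ (p q x : Fin 4 → ℝ), (∀ i, x i = r * (p i - q i)) → (r • (∑ i, p i • e i - ∑ i, q i • e i)) = ∑ i, x i • e i := by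
      intro p q x h
      rw [← Finset.sum_sub_distrib, Finset.smul_sum]
      refine Finset.sum_congr rfl fun i _ => ?_
      rw [h, ← sub_smul, smul_smul]
    intro j hj
    fin_cases j
    · exact absurd rfl hj
    · constructor
      · rw [hcomb _ _ ![1,0,0,0] (by intro i; fin_cases i <;> simp <;> nlinarith)]
        exact hmem _ ⟨![1,0,0,0], 0, by intro i; fin_cases i <;> simp⟩
      · rw [hcomb2 _ _ ![0,1,0,0] (by intro i; fin_cases i <;> simp <;> nlinarith)]
        exact hmem _ ⟨![0,1,0,0], 0, by intro i; fin_cases i <;> simp⟩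
    · constructor
      · rw [hcomb _ _ ![1/2,1/2,1/2,1/2] (by intro i; fin_cases i <;> simp <;> nlinarith)]
        exact hmem _ ⟨![0,0,0,0], 1, by intro i; fin_cases i <;> simp⟩
      · rw [hcomb2 _ _ ![1/2,1/2,-1/2,-1/2] (by intro i; fin_cases i <;> simp <;> nlinarith)]
        exact hmem _ ⟨![0,0,-1,-1], 1, by intro i; fin_cases i <;> simp <;> norm_num⟩
    · constructor
      · rw [hcomb _ _ ![1/2,1/2,1/2,-1/2] (by intro i; fin_cases i <;> simp <;> nlinarith)]
        exact hmem _ ⟨![0,0,0,-1], 1, by intro i; fin_cases i <;> simp <;> norm_num⟩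
      · rw [hcomb2 _ _ ![1/2,1/2,-1/2,1/2] (by intro i; fin_cases i <;> simp <;> nlinarith)]
        exact hmem _ ⟨![0,0,-1,0], 1, by intro i; fin_cases i <;> simp <;> norm_num⟩

lemma exists_perp {e : Fin 4 → Euc 5} (hon : Orthonormal ℝ e) : ∃ u : Euc 5, Orthonormal ℝ (![e 0, e 1, e 2, e 3, u] : Fin 5 → Euc 5) := by
  set W := Submodule.span ℝ (Set.range e) with hW
  have : Wᗮ ≠ ⊥ := by
    intro h
    have h1 : W = ⊤ := Submodule.orthogonal_eq_bot_iff.1 h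
    have h2 : Module.finrank ℝ W = 4 := by simpa using finrank_span_eq_card hon.linearIndependent
    rw [h1, finrank_top] at h2
    simp at h2
  obtain ⟨u0, hu0, hu00⟩ := Submodule.exists_mem_ne_zero_of_ne_bot this
  set u := (‖u0‖⁻¹) • u0 with hu
  have hun : ‖u‖ = 1 := norm_smul_inv_norm (𝕜 := ℝ) hu00
  have huW : u ∈ Wᗮ := Submodule.smul_mem _ _ hu0
  have hort : ∀ i, ⟪e i, u⟫ = (0:ℝ) := fun i => (Submodule.mem_orthogonal _ _).1 huW _ (Submodule.subset_span ⟨i, rfl⟩)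
  have hort2 : ∀ i, ⟪u, e i⟫ = (0:ℝ) := fun i => by rw [real_inner_comm]; exact hort i
  have hee := orthonormal_iff_ite.1 hon
  refine ⟨u, orthonormal_iff_ite.2 ?_⟩
  intro i j
  have hn : ∀ i, ‖e i‖ = 1 := hon.1
  fin_cases i <;> fin_cases j <;> simp [hort, hort2, hee, hun, hn]

end

section
open scoped RealInnerProductSpace
open Metric MeasureTheory

lemma D5_frame {T : Fin 5 → Euc 5} {e : Fin 4 → Euc 5} {u : Euc 5}
    (hon : Orthonormal ℝ (![e 0, e 1, e 2, e 3, u] : Fin 5 → Euc 5))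
    (he : ∀ i, e i ∈ Lb T) (hh : (1/2 : ℝ) • ∑ i, e i ∈ Lb T) (a s t : ℝ) (ha : a ^ 2 = 1/2) (p q : ℤ)
    (hs : s ^ 2 = 1) (ht : t ^ 2 = 1) (hsp : s = 1 - 2 * p) (htq : t = 1 - 2 * q)
    (hw : (s / 2) • e 0 + (t / 2) • e 1 + a • u ∈ Lb T) : ∃ f, Frame T f := by
  have hr := sqrt2_inv_sq
  set r : ℝ := 1/√2 with hrd
  have hon2 := on_comb hon (![![r * s, r * t, 0, 0, 0], ![r * s, - r * t, 0, 0, 0], ![0, 0, r, r, 0], ![0, 0, r, -r, 0], ![0, 0, 0, 0, 2 * r * a]] : Fin 5 → Fin 5 → ℝ) (by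
      intro i j
      fin_cases i <;> fin_cases j <;> simp [Fin.sum_univ_five]
      · linear_combination (r ^ 2) * hs + r ^ 2 * ht + 2 * hr
      · linear_combination (r ^ 2) * hs - r ^ 2 * ht
      · linear_combination (r ^ 2) * hs - r ^ 2 * ht
      · linear_combination (r ^ 2) * hs + r ^ 2 * ht + 2 * hr
      · linear_combination 2 * hr
      · linear_combination 2 * hr
      · linear_combination 4 * a ^ 2 * hr + 2 * ha)
  refine ⟨_, frame_of_zero hon2 0 ?_⟩
  have h0 := he 0
  have h1 := he 1
  have h2 := he 2
  have h3 := he 3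
  rw [Fin.sum_univ_four] at hh
  have key : ∀ (x : Fin 5 → ℝ) (z : Fin 4 → ℤ) (k l : ℤ), x 0 = z 0 + k / 2 + l * (s/2) → x 1 = z 1 + k / 2 + l * (t / 2) →
     x 2 = z 2 + k / 2 → x 3 = z 3 + k / 2 → x 4 = l * a → 
     x 0 • e 0 + x 1 • e 1 + x 2 • e 2 + x 3 • e 3 + x 4 • u ∈ Lb T := by
    intro x z k l e0 e1 e2 e3 e4
    have := Lb_add (Lb_le he (int_mem_Lb e z)) (Lb_add (Lb_zsmul k hh) (Lb_zsmul l hw))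
    convert this using 1
    rw [Fin.sum_univ_four, e0, e1, e2, e3, e4]
    module
  have hrr : r * r = 1/2 := by rw [← sq]; exact hr
  have hra : r * (2 * r * a) = a := by linear_combination 2 * a * hrr
  intro j hj
  rw [← hrd]
  clear_value r
  fin_cases j
  · exact absurd rfl hj
  · constructor
    · convert key ![s, 0, 0, 0, 0] ![1 - 2 * p,0,0,0] 0 0 (by simp; linarith) (by simp) (by simp) (by simp) (by simp) using 1
      simp [Fin.sum_univ_five]
      match_scalars <;> first | ring1 | linear_combination 2 * s * hrr | linear_combination -2 * s * hrr
    · convert key ![0, t, 0, 0, 0] ![0, 1 - 2 * q,0,0] 0 0 (by simp) (by simp; linarith) (by simp) (by simp) (by simp) using 1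
      simp [Fin.sum_univ_five]
      match_scalars <;> first | ring1 | linear_combination 2 * t * hrr | linear_combination -2 * t * hrr
  · constructor
    · convert key ![s/2, t/2, 1/2, 1/2, 0] ![-p,-q,0,0] 1 0 (by simp; linarith) (by simp; linarith) (by simp) (by simp) (by simp) using 1
      simp [Fin.sum_univ_five]
      match_scalars <;> first | linear_combination s * hrr | linear_combination t * hrr | linear_combination hrr
    · convert key ![s/2, t/2, -1/2, -1/2, 0] ![-p,-q,-1,-1] 1 0 (by simp; linarith) (by simp; linarith) (by simp; norm_num) (by simp; norm_num) (by simp) using 1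
      simp [Fin.sum_univ_five]
      match_scalars <;> first | linear_combination s * hrr | linear_combination t * hrr | linear_combination -hrr
  · constructor
    · convert key ![s/2, t/2, 1/2, -1/2, 0] ![-p,-q,0,-1] 1 0 (by simp; linarith) (by simp; linarith) (by simp) (by simp; norm_num) (by simp) using 1
      simp [Fin.sum_univ_five]
      match_scalars <;> first | linear_combination s * hrr | linear_combination t * hrr | linear_combination hrr | linear_combination -hrr
    · convert key ![s/2, t/2, -1/2, 1/2, 0] ![-p,-q,-1,0] 1 0 (by simp; linarith) (by simp; linarith) (by simp; norm_num) (by simp) (by simp) using 1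
      simp [Fin.sum_univ_five]
      match_scalars <;> first | linear_combination s * hrr | linear_combination t * hrr | linear_combination hrr | linear_combination -hrr
  · constructor
    · convert key ![s/2, t/2, 0, 0, a] ![0,0,0,0] 0 1 (by simp) (by simp) (by simp) (by simp) (by simp) using 1
      simp [Fin.sum_univ_five]
      match_scalars <;> first | linear_combination s * hrr | linear_combination t * hrr | linear_combination 2 * a * hrr
    · convert key ![s/2, t/2, 0, 0, -a] ![1 - 2 * p,1-2 * q,0,0] 0 (-1) (by simp; linarith) (by simp; linarith) (by simp) (by simp) (by simp) using 1
      simp [Fin.sum_univ_five]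
      match_scalars <;> first | linear_combination s * hrr | linear_combination t * hrr | linear_combination -2 * a * hrr

lemma perm4 : ∀ i j : Fin 4, i ≠ j → ∃ p : Equiv.Perm (Fin 4), p 0 = i ∧ p 1 = j := by decide

lemma half_sign {y : ℝ} (h : |y| = 1/2) : ∃ (s : ℝ) (p : ℤ), s ^ 2 = 1 ∧ s = 1 - 2 * p ∧ y = s / 2 := by
  rcases abs_eq (by norm_num : (0:ℝ) ≤ 1/2) |>.1 h with h | h
  · exact ⟨1, 0, by norm_num, by norm_num, by linarith⟩
  · exact ⟨-1, 1, by norm_num, by norm_num, by linarith⟩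

lemma D4_five {T : Fin 5 → Euc 5} (hA : Adm T) (hT : gdet T ≠ 0) (hle : gdet T ^ 2 ≤ 1/8) (hD : D4type T) :
    gdet T ^ 2 = 1/8 ∧ ∃ f, Frame T f := by
  obtain ⟨e, hon4, he, hh⟩ := hD
  obtain ⟨u, hon⟩ := exists_perp hon4
  have hexp : ∀ v : Euc 5, v = ∑ i, ⟪e i, v⟫ • e i + ⟪u, v⟫ • u := by
    intro v
    have := on_expand hon v
    simpa [Fin.sum_univ_five, Fin.sum_univ_four] using this
  have hnrm : ∀ (y : Fin 4 → ℝ) (b : ℝ), ‖∑ i, y i • e i + b • u‖ ^ 2 = ∑ i, y i ^ 2 + b ^ 2 := by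
    intro y b
    have := on_norm hon ![y 0, y 1, y 2, y 3, b]
    simpa [Fin.sum_univ_five, Fin.sum_univ_four] using this
  have red : ∀ v ∈ Lb T, ∃ (y : Fin 4 → ℝ) (z : Fin 4 → ℤ) (ε : ℤ), ∑ i, y i • e i + ⟪u, v⟫ • u ∈ Lb T ∧
      v = (∑ i, y i • e i + ⟪u, v⟫ • u) + ∑ i, ((z i : ℝ) + ε / 2) • e i ∧ (∑ i, y i ^ 2 < 1/2 ∨ (∑ i, y i ^ 2 = 1/2 ∧ TwoHalf y)) := by
    intro v hv
    obtain ⟨z, ε, y, hy, hN⟩ := covering (fun i => ⟪e i, v⟫)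
    have e1 : v = (∑ i, y i • e i + ⟪u, v⟫ • u) + ∑ i, ((z i : ℝ) + ε / 2) • e i := by
      have h1 : ∑ i, ⟪e i, v⟫ • e i = ∑ i, y i • e i + ∑ i, ((z i : ℝ) + ε / 2) • e i := by
        rw [← Finset.sum_add_distrib]
        refine Finset.sum_congr rfl fun i _ => ?_
        rw [hy, ← add_smul]; congr 1; ring
      conv_lhs => rw [hexp v, h1]
      abel
    refine ⟨y, z, ε, ?_, e1, hN⟩
    have := Lb_sub hv (hur he hh z ε)
    convert this using 1
    rw [eq_sub_iff_add_eq]; exact e1.symm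
  have hN : ∀ y : Fin 4 → ℝ, (∑ i, y i ^ 2 < 1/2 ∨ (∑ i, y i ^ 2 = 1/2 ∧ TwoHalf y)) → ∑ i, y i ^ 2 ≤ 1/2 := by
    rintro y (h | ⟨h, -⟩) <;> linarith
  have hzero : ∀ v ∈ Lb T, ⟪u, v⟫ = 0 → ∃ (z : Fin 4 → ℤ) (ε : ℤ), v = ∑ i, ((z i : ℝ) + ε / 2) • e i := by
    intro v hv h0
    obtain ⟨y, z, ε, h1, h2, h3⟩ := red v hv
    have hw0 : ∑ i, y i • e i + ⟪u, v⟫ • u = 0 := by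
      by_contra hne
      have a1 := hA _ h1 hne
      have a2 := hnrm y ⟪u, v⟫
      have a3 := hN y h3
      rw [h0] at a1 a2
      nlinarith
    refine ⟨z, ε, ?_⟩
    conv_lhs => rw [h2, hw0, zero_add]
  have hbig : ∀ v ∈ Lb T, ⟪u, v⟫ ≠ 0 → 1/2 ≤ ⟪u, v⟫ ^ 2 := by
    intro v hv h0
    obtain ⟨y, z, ε, h1, h2, h3⟩ := red v hv
    have a2 := hnrm y ⟪u, v⟫
    have a3 := hN y h3
    have a1 := hA _ h1 (by
      intro h
      rw [h] at a2
      have : 0 < ⟪u, v⟫ ^ 2 := by positivity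
      have : 0 ≤ ∑ i, y i ^ 2 := Finset.sum_nonneg fun i _ => sq_nonneg _
      norm_num at a2
      linarith)
    nlinarith
  let H : AddSubgroup ℝ :=
    { carrier := (fun v => ⟪u, v⟫) '' Lb T
      add_mem' := by
        rintro _ _ ⟨v, hv, rfl⟩ ⟨w, hw, rfl⟩
        exact ⟨v + w, Lb_add hv hw, inner_add_right _ _ _⟩
      zero_mem' := ⟨0, Lb_zero, inner_zero_right _⟩
      neg_mem' := by
        rintro _ ⟨v, hv, rfl⟩
        exact ⟨-v, Lb_neg hv, inner_neg_right _ _⟩ }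
  obtain ⟨a, ha⟩ := AddSubgroup.cyclic_of_isolated_zero (H := H) (a := 1/2) (by norm_num) (by
    rw [Set.disjoint_left]
    rintro _ ⟨v, hv, rfl⟩ h
    have h1 := hbig v hv h.1.ne'
    simp only [Set.mem_Ioo] at h
    nlinarith [h.1, h.2])
  have haH : a ∈ H := by rw [ha]; exact AddSubgroup.mem_closure_singleton_self a
  have hall : ∀ v ∈ Lb T, ∃ k : ℤ, ⟪u, v⟫ = k * a := by
    intro v hv
    have : ⟪u, v⟫ ∈ H := ⟨v, hv, rfl⟩
    rw [ha, AddSubgroup.mem_closure_singleton] at this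
    obtain ⟨k, hk⟩ := this
    exact ⟨k, by rw [← hk]; simp⟩
  obtain ⟨v0, hv0, hv0a⟩ := haH
  simp only at hv0a
  have ha0 : a ≠ 0 := by
    intro h0
    have hTz : ∀ i, ⟪u, T i⟫ = (0:ℝ) := fun i => by
      obtain ⟨k, hk⟩ := hall _ (Lb_self i); rw [hk, h0, mul_zero]
    have hli := (gdet_ne_zero_iff T).1 hT
    have hu : u ∈ Submodule.span ℝ (Set.range T) := by rw [span_top_of_li hli]; trivial
    have : ⟪u, u⟫ = (0:ℝ) := by
      refine Submodule.span_induction (p := fun x _ => ⟪u, x⟫ = (0:ℝ)) ?_ ?_ ?_ ?_ hu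
      · rintro _ ⟨i, rfl⟩; exact hTz i
      · exact inner_zero_right _
      · intro x y _ _ h1 h2; rw [inner_add_right, h1, h2, add_zero]
      · intro c x _ h1; rw [inner_smul_right, h1, mul_zero]
    have hu1 : ‖u‖ = 1 := by simpa using hon.1 4
    rw [real_inner_self_eq_norm_sq, hu1] at this
    norm_num at this
  obtain ⟨y, z, ε, h1, h2, h3⟩ := red v0 hv0
  rw [hv0a] at h1 h2
  set w := ∑ i, y i • e i + a • u with hw
  have ha2 : 1/2 ≤ a ^ 2 := by
    have := hbig v0 hv0 (by rw [hv0a]; exact ha0)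
    rwa [hv0a] at this
  let c : Fin 5 → Euc 5 := ![(1/2 : ℝ) • ∑ i, e i, e 1, e 2, e 3, w]
  have hcT : ∀ i, c i ∈ Lb T := by
    intro i; fin_cases i <;> simp [c, he, h1] <;> simpa using hh
  have huu : ⟪u, w⟫ = a := by
    have h4 := orthonormal_iff_ite.1 hon 4 0
    have h5 := orthonormal_iff_ite.1 hon 4 1
    have h6 := orthonormal_iff_ite.1 hon 4 2
    have h7 := orthonormal_iff_ite.1 hon 4 3
    have h8 := orthonormal_iff_ite.1 hon 4 4
    simp at h4 h5 h6 h7 h8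
    have hun : ‖u‖ = 1 := by simpa using hon.1 4
    simp [hw, inner_add_right, Fin.sum_univ_four, inner_smul_right, h4, h5, h6, h7, hun]
  have hTc : ∀ v ∈ Lb T, v ∈ Lb c := by
    intro v hv
    obtain ⟨k, hk⟩ := hall v hv
    obtain ⟨z', ε', hz⟩ := hzero (v - (k : ℝ) • w) (Lb_sub hv (Lb_zsmul k h1)) (by
      rw [inner_sub_right, inner_smul_right, hk, huu, sub_self])
    refine ⟨![ε' + 2 * z' 0, z' 1 - z' 0, z' 2 - z' 0, z' 3 - z' 0, k], ?_⟩
    rw [sub_eq_iff_eq_add] at hz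
    rw [hz]
    simp [Fin.sum_univ_four, Fin.sum_univ_five, c]
    module
  have hL : Lb T = Lb c := Set.Subset.antisymm hTc (Lb_le hcT)
  have g1 := abs_gdet_eq hL hT
  have g2 := gdet_comb ![e 0, e 1, e 2, e 3, u] c !![1/2, 0, 0, 0, y 0; 1/2, 1, 0, 0, y 1; 1/2, 0, 1, 0, y 2; 1/2, 0, 0, 1, y 3; 0, 0, 0, 0, a] (by
      intro j; fin_cases j <;> simp [c, Fin.sum_univ_four, Fin.sum_univ_five, hw])
  have g3 : gdet T ^ 2 = a ^ 2 / 4 := by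
    rw [← sq_abs, g1, sq_abs, g2, mul_pow, on_gdet hon]
    simp [Matrix.det_succ_row_zero, Fin.sum_univ_succ, Fin.succAbove]
    ring
  have ha3 : a ^ 2 = 1/2 := by linarith
  refine ⟨by rw [g3, ha3]; norm_num, ?_⟩
  have hw0 : w ≠ 0 := by
    intro h; rw [h, inner_zero_right] at huu; exact ha0 huu.symm
  have hwn := hA w h1 hw0
  have hwn2 := hnrm y a
  rw [← hw] at hwn2
  rcases h3 with h3 | ⟨h3, i, j, hij, hi, hj, hk⟩
  · nlinarith
  obtain ⟨p, hp0, hp1⟩ := perm4 i j hij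
  obtain ⟨s, m, hs1, hs2, hs3⟩ := half_sign hi
  obtain ⟨t, q, ht1, ht2, ht3⟩ := half_sign hj
  have hon' : Orthonormal ℝ (![(e ∘ p) 0, (e ∘ p) 1, (e ∘ p) 2, (e ∘ p) 3, u] : Fin 5 → Euc 5) := by
    have hn : ∀ i, ‖e i‖ = 1 := hon4.1
    have hun : ‖u‖ = 1 := by simpa using hon.1 4
    have hee := orthonormal_iff_ite.1 hon4
    have hort : ∀ i, ⟪e i, u⟫ = (0:ℝ) := by
      intro i
      fin_cases i
      · simpa using orthonormal_iff_ite.1 hon 0 4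
      · simpa using orthonormal_iff_ite.1 hon 1 4
      · simpa using orthonormal_iff_ite.1 hon 2 4
      · simpa using orthonormal_iff_ite.1 hon 3 4
    have hort2 : ∀ i, ⟪u, e i⟫ = (0:ℝ) := fun i => by rw [real_inner_comm]; exact hort i
    rw [orthonormal_iff_ite]
    intro i j
    fin_cases i <;> fin_cases j <;> simp [hort, hort2, hee, hun, hn]
  refine D5_frame (e := e ∘ p) hon' (fun i => he _) ?_ a s t ha3 m q hs1 ht1 hs2 ht2 ?_
  · convert hh using 2
    exact Equiv.sum_comp p e
  · convert h1 using 1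
    rw [hw, ← Equiv.sum_comp p, Fin.sum_univ_four]
    have k2 := hk (p 2) (by rw [← hp0]; simp) (by rw [← hp1]; simp)
    have k3 := hk (p 3) (by rw [← hp0]; simp) (by rw [← hp1]; simp)
    rw [k2, k3]
    simp [hp0, hp1, hs3, ht3]

end

section
open scoped RealInnerProductSpace
open Metric MeasureTheory

lemma swap_sum {n k : ℕ} (b : Fin k → Euc n) (i : Fin k) (v : Euc n) (c : Fin k → ℝ) (x : Fin k → ℝ)
    (hv : v = ∑ j, x j • b j) :
    ∑ j, c j • (Function.update b i v) j = ∑ j, ((if j = i then 0 else c j) + c i * x j) • b j := by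
  have e1 : ∀ j, c j • (Function.update b i v) j = (if j = i then 0 else c j) • b j + (if j = i then c i else 0) • v := by
    intro j
    by_cases h : j = i
    · subst h; simp
    · simp [h]
  simp_rw [e1, Finset.sum_add_distrib, ← Finset.sum_smul, add_smul, Finset.sum_add_distrib]
  congr 1
  conv_lhs => rw [hv]
  simp [Finset.smul_sum, smul_smul]

lemma swap_li {n k : ℕ} {b : Fin k → Euc n} (hli : LinearIndependent ℝ b) (i : Fin k) {v : Euc n} {x : Fin k → ℝ}
    (hv : v = ∑ j, x j • b j) (hx : x i ≠ 0) : LinearIndependent ℝ (Function.update b i v) := by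
  rw [Fintype.linearIndependent_iff]
  intro c hc
  rw [swap_sum b i v c x hv] at hc
  have h := Fintype.linearIndependent_iff.1 hli _ hc
  have hi : c i = 0 := by
    have := h i
    simp at this
    exact this.resolve_right hx
  intro j
  by_cases hj : j = i
  · rw [hj, hi]
  · have := h j
    simpa [hj, hi] using this

lemma swap_coord {n k : ℕ} {b : Fin k → Euc n} (i : Fin k) {v : Euc n} {x : Fin k → ℝ}
    (hv : v = ∑ j, x j • b j) (hx : x i ≠ 0) (y : Fin k → ℝ) :
    ∑ j, y j • b j = ∑ j, (if j = i then y i / x i else y j - x j * (y i / x i)) • (Function.update b i v) j := by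
  rw [swap_sum b i v _ x hv]
  refine Finset.sum_congr rfl fun j _ => ?_
  congr 1
  by_cases h : j = i
  · subst h; simp; field_simp
  · simp [h]; ring

lemma perfect_mat {n : ℕ} {T b : Fin n → Euc n} (hA : Adm T) (hcrit : |gdet T| = dB n) (hli : LinearIndependent ℝ b)
    (H : Fin n → Fin n → ℝ) (hH : ∀ x : Fin n → ℝ, ∑ i, x i • b i ∈ Lb T → ‖∑ i, x i • b i‖ = 1 → ∑ i, ∑ j, x i * x j * H i j = 0)
    (x : Fin n → ℝ) : ∑ i, ∑ j, x i * x j * H i j = 0 := by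
  let B := Matrix.toLinearMap₂ (R := ℝ) (bas hli) (bas hli) (Matrix.of H)
  have hBx : ∀ x : Fin n → ℝ, B (∑ i, x i • b i) (∑ i, x i • b i) = ∑ i, ∑ j, x i * x j * H i j := by
    intro x
    have hr : ∀ i, (bas hli).repr (∑ i, x i • b i) i = x i := by
      intro i
      have := (bas hli).repr_sum_self x
      rw [bas_coe] at this
      exact congrFun this i
    simp only [B, Matrix.toLinearMap₂_apply, hr, Matrix.of_apply, smul_eq_mul, mul_assoc]
  rw [← hBx]
  refine perfect hA hcrit B (fun v hv hv1 => ?_) _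
  have hvs : v = ∑ i, (bas hli).repr v i • b i := by
    have := (bas hli).sum_repr v
    rw [bas_coe] at this
    exact this.symm
  rw [hvs, hBx]
  rw [hvs] at hv hv1
  exact hH _ hv hv1

def W5 (T b : Fin 5 → Euc 5) : Prop := (∀ i, ‖b i‖ = 1) ∧ LinearIndependent ℝ b ∧ (∀ i, b i ∈ Lb T) ∧
  ∀ σ : Fin 5 → ℝ, (∀ i, σ i = 1 ∨ σ i = -1) → ∑ i, (σ i / 2) • b i ∈ Lb T

lemma W5_of {T b : Fin 5 → Euc 5} (h1 : ∀ i, ‖b i‖ = 1) (hli : LinearIndependent ℝ b) (hbT : ∀ i, b i ∈ Lb T)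
   (x : Fin 5 → ℝ) (hx : ∀ i, ∃ m : ℤ, x i = m + 1/2) (hw : ∑ i, x i • b i ∈ Lb T) : W5 T b := by
  refine ⟨h1, hli, hbT, fun σ hσ => ?_⟩
  choose m hm using hx
  have : ∀ i, ∃ q : ℤ, σ i / 2 = x i + q := by
    intro i
    rcases hσ i with h | h
    · exact ⟨- m i, by rw [h, hm]; push_cast; ring⟩
    · exact ⟨- m i - 1, by rw [h, hm]; push_cast; ring⟩
  choose q hq using this
  simp_rw [hq, add_smul, Finset.sum_add_distrib]
  exact Lb_add hw (Lb_le hbT (int_mem_Lb b q))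

lemma unit_W5 {T b : Fin 5 → Euc 5} (hA : Adm T) (hD : ¬ D4type T) (hW : W5 T b) (x : Fin 5 → ℝ)
    (hx : ∑ i, x i • b i ∈ Lb T) (hx1 : ‖∑ i, x i • b i‖ = 1) :
    (∃ i, ∀ j, j ≠ i → x j = 0) ∨ (∀ i, x i = 1/2 ∨ x i = -1/2) := by
  obtain ⟨h1, hli, hbT, hh⟩ := hW
  set v := ∑ i, x i • b i with hv
  have sw : ∀ i, x i ≠ 0 → ∀ y : Fin 5 → ℝ, ∑ j, y j • b j ∈ Lb T →
      (∀ j, ∃ m : ℤ, (if j = i then y i / x i else y j - x j * (y i / x i)) = m) ∨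
      (∀ j, ∃ m : ℤ, (if j = i then y i / x i else y j - x j * (y i / x i)) = m + 1/2) := by
    intro i hi y hy
    rw [swap_coord i hv hi y] at hy
    have := dichotomy le_rfl hA hD (Function.update b i v) (by
      intro j
      by_cases hj : j = i
      · subst hj; simpa using hx1
      · simp [hj, h1]) (swap_li hli i hv hi) (by
      intro j
      by_cases hj : j = i
      · subst hj; simpa using hx
      · simp [hj, hbT]) _ hy
    rcases this with h | ⟨-, h⟩
    · exact Or.inl h
    · exact Or.inr h
  rcases dichotomy le_rfl hA hD b h1 hli hbT x hx with h | ⟨-, h⟩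
  · left
    choose m hm using h
    have key : ∀ i, x i ≠ 0 → Odd (m i) ∧ ∀ j, j ≠ i → Even (m j) := by
      intro i hi
      have hmi : (m i : ℝ) ≠ 0 := by rw [← hm]; exact hi
      have hy := hh (fun _ => 1) (fun _ => Or.inl rfl)
      rcases sw i hi _ hy with h | h
      · exfalso
        obtain ⟨k, hk⟩ := h i
        simp only [if_true] at hk
        rw [hm i] at hk
        field_simp at hk
        have : (1:ℤ) = 2 * m i * k := by exact_mod_cast hk
        rw [mul_assoc] at this
        omega
      · obtain ⟨k, hk⟩ := h i
        simp only [if_true] at hk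
        rw [hm i] at hk
        have e1 : (1:ℝ) = m i * (2 * k + 1) := by
          field_simp at hk; linarith
        have e2 : (1:ℤ) = m i * (2 * k + 1) := by exact_mod_cast e1
        have o : Odd (m i) := by
          have : Odd (m i * (2 * k + 1)) := by rw [← e2]; exact odd_one
          exact (Int.odd_mul.1 this).1
        refine ⟨o, fun j hj => ?_⟩
        obtain ⟨l, hl⟩ := h j
        simp only [if_neg hj] at hl
        rw [hm i, hm j] at hl
        have e3 : (m j : ℝ) = - 2 * m i * l := by
          field_simp at hl; linarith
        have e4 : m j = - 2 * m i * l := by exact_mod_cast e3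
        exact ⟨- m i * l, by rw [e4]; ring⟩
    have hne : ∃ i, x i ≠ 0 := by
      by_contra hc
      push Not at hc
      have : v = 0 := by rw [hv]; simp [hc]
      rw [this] at hx1
      simp at hx1
    obtain ⟨i, hi⟩ := hne
    refine ⟨i, fun j hj => ?_⟩
    by_contra hxj
    exact Int.not_even_iff_odd.2 (key j hxj).1 ((key i hi).2 j hj)
  · right
    choose m hm using h
    intro i
    have hne : (2 * (m i:ℝ) + 1) ≠ 0 := by
      intro h0
      have : (2 * m i + 1 : ℤ) = 0 := by exact_mod_cast h0
      omega
    have hxi : x i = (2 * m i + 1) / 2 := by rw [hm]; ring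
    have hi : x i ≠ 0 := by rw [hxi]; positivity
    have hy : ∑ j, (if j = i then (1:ℝ) else 0) • b j ∈ Lb T := by simpa using hbT i
    have e0 : (1 : ℝ) / ((2 * m i + 1) / 2) = 2 / (2 * m i + 1) := by field_simp
    rcases sw i hi _ hy with h | h
    · obtain ⟨k, hk⟩ := h i
      simp only [if_true] at hk
      rw [hxi, e0, div_eq_iff hne] at hk
      have e2 : (2:ℤ) = k * (2 * m i + 1) := by exact_mod_cast hk
      have d1 : (2 * m i + 1) ∣ 2 := ⟨k, by linarith⟩
      have d2 : -(2 * m i + 1) ∣ 2 := (neg_dvd).2 d1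
      have l1 := Int.le_of_dvd (by norm_num) d1
      have l2 := Int.le_of_dvd (by norm_num) d2
      have : m i = 0 ∨ m i = -1 := by omega
      rcases this with h | h
      · left; rw [hxi, h]; norm_num
      · right; rw [hxi, h]; norm_num
    · exfalso
      obtain ⟨k, hk⟩ := h i
      simp only [if_true] at hk
      rw [hxi, e0, div_eq_iff hne] at hk
      have e1 : (4:ℝ) = (2 * k + 1) * (2 * m i + 1) := by linarith
      have e2 : (4:ℤ) = (2 * k + 1) * (2 * m i + 1) := by exact_mod_cast e1
      have : Odd ((2 * k + 1) * (2 * m i + 1)) := Int.odd_mul.2 ⟨⟨k, rfl⟩, ⟨m i, rfl⟩⟩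
      rw [← e2] at this
      exact absurd this (by decide)

lemma W5_gdet {T b : Fin 5 → Euc 5} (hA : Adm T) (hT : gdet T ≠ 0) (hD : ¬ D4type T) (hW : W5 T b) : gdet b ^ 2 ≤ 4 * gdet T ^ 2 := by
  obtain ⟨h1, hli, hbT, hh⟩ := hW
  let c : Fin 5 → Euc 5 := ![∑ i, (1/2 : ℝ) • b i, b 1, b 2, b 3, b 4]
  have hc : ∀ i, T i ∈ Lb c := by
    intro i
    obtain ⟨x, hx⟩ : ∃ x : Fin 5 → ℝ, T i = ∑ j, x j • b j := by
      have := (bas hli).sum_repr (T i)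
      rw [bas_coe] at this
      exact ⟨_, this.symm⟩
    have hw : ∑ j, x j • b j ∈ Lb T := by rw [← hx]; exact Lb_self i
    rw [hx]
    rcases dichotomy le_rfl hA hD b h1 hli hbT x hw with h | ⟨-, h⟩
    · choose m hm using h
      refine ⟨![2 * m 0, m 1 - m 0, m 2 - m 0, m 3 - m 0, m 4 - m 0], ?_⟩
      simp_rw [hm]
      simp [Fin.sum_univ_five, c]
      module
    · choose m hm using h
      refine ⟨![2 * m 0 + 1, m 1 - m 0, m 2 - m 0, m 3 - m 0, m 4 - m 0], ?_⟩
      simp_rw [hm]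
      simp [Fin.sum_univ_five, c]
      module
  have h2 := abs_gdet_le_of_subset hc hT
  have h3 := gdet_comb b c !![1/2, 0, 0, 0, 0; 1/2, 1, 0, 0, 0; 1/2, 0, 1, 0, 0; 1/2, 0, 0, 1, 0; 1/2, 0, 0, 0, 1] (by
      intro j; fin_cases j <;> simp [c, Fin.sum_univ_five])
  have h4 : gdet c = gdet b / 2 := by
    rw [h3]
    simp [Matrix.det_succ_row_zero, Fin.sum_univ_succ, Fin.succAbove]
    ring
  rw [h4] at h2
  have h5 := sq_le_sq.2 h2
  linarith

end

section
open scoped RealInnerProductSpace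
open Metric MeasureTheory

/-- linear arithmetic on the folded 5-cube -/
lemma folded_cube (c a0 a1 a2 a3 a4 p01 p02 p03 p04 p12 p13 p14 p23 p24 p34 : ℝ)
   (n0 : 0 ≤ a0) (n1 : 0 ≤ a1) (n2 : 0 ≤ a2) (n3 : 0 ≤ a3) (n4 : 0 ≤ a4)
   (n01 : 0 ≤ p01) (n02 : 0 ≤ p02) (n03 : 0 ≤ p03) (n04 : 0 ≤ p04) (n12 : 0 ≤ p12) (n13 : 0 ≤ p13) (n14 : 0 ≤ p14)
   (n23 : 0 ≤ p23) (n24 : 0 ≤ p24) (n34 : 0 ≤ p34)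
   (m0 : a0 ≤ c) (m1 : a1 ≤ c) (m2 : a2 ≤ c) (m3 : a3 ≤ c) (m4 : a4 ≤ c)
   (ec : a0 + a1 + a2 + a3 + a4 = 1 + c)
   (e0 : c + p01 + p02 + p03 + p04 = 1 + a0) (e1 : c + p01 + p12 + p13 + p14 = 1 + a1)
   (e2 : c + p02 + p12 + p23 + p24 = 1 + a2) (e3 : c + p03 + p13 + p23 + p34 = 1 + a3)
   (e4 : c + p04 + p14 + p24 + p34 = 1 + a4)
   (e01 : a0 + a1 + p23 + p24 + p34 = 1 + p01) (e02 : a0 + a2 + p13 + p14 + p34 = 1 + p02)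
   (e03 : a0 + a3 + p12 + p14 + p24 = 1 + p03) (e04 : a0 + a4 + p12 + p13 + p23 = 1 + p04)
   (e12 : a1 + a2 + p03 + p04 + p34 = 1 + p12) (e13 : a1 + a3 + p02 + p04 + p24 = 1 + p13)
   (e14 : a1 + a4 + p02 + p03 + p23 = 1 + p14) (e23 : a2 + a3 + p01 + p04 + p14 = 1 + p23)
   (e24 : a2 + a4 + p01 + p03 + p13 = 1 + p24) (e34 : a3 + a4 + p01 + p02 + p12 = 1 + p34)
   (q01 : 0 < a0 → 0 < a1 → p01 = 0) (q02 : 0 < a0 → 0 < a2 → p02 = 0) (q03 : 0 < a0 → 0 < a3 → p03 = 0)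
   (q04 : 0 < a0 → 0 < a4 → p04 = 0) (q12 : 0 < a1 → 0 < a2 → p12 = 0) (q13 : 0 < a1 → 0 < a3 → p13 = 0)
   (q14 : 0 < a1 → 0 < a4 → p14 = 0) (q23 : 0 < a2 → 0 < a3 → p23 = 0) (q24 : 0 < a2 → 0 < a4 → p24 = 0)
   (q34 : 0 < a3 → 0 < a4 → p34 = 0) : 
   c = 3/2 ∧ a0 = 1/2 ∧ a1 = 1/2 ∧ a2 = 1/2 ∧ a3 = 1/2 ∧ a4 = 1/2 ∧ 
   p01 = 0 ∧ p02 = 0 ∧ p03 = 0 ∧ p04 = 0 ∧ p12 = 0 ∧ p13 = 0 ∧ p14 = 0 ∧ p23 = 0 ∧ p24 = 0 ∧ p34 = 0 := by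
  rcases n0.lt_or_eq with z0 | z0 <;> rcases n1.lt_or_eq with z1 | z1 <;> rcases n2.lt_or_eq with z2 | z2 <;>
    rcases n3.lt_or_eq with z3 | z3 <;> rcases n4.lt_or_eq with z4 | z4 <;>
    try have r01 := q01 z0 z1
  all_goals try have r02 := q02 z0 z2
  all_goals try have r03 := q03 z0 z3
  all_goals try have r04 := q04 z0 z4
  all_goals try have r12 := q12 z1 z2
  all_goals try have r13 := q13 z1 z3
  all_goals try have r14 := q14 z1 z4
  all_goals try have r23 := q23 z2 z3
  all_goals try have r24 := q24 z2 z4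
  all_goals try have r34 := q34 z3 z4
  all_goals clear q01 q02 q03 q04 q12 q13 q14 q23 q24 q34
  all_goals first | (exfalso; linarith; done) | skip
  refine ⟨?_, ?_, ?_, ?_, ?_, ?_, ?_, ?_, ?_, ?_, ?_, ?_, ?_, ?_, ?_, ?_⟩ <;> linarith

lemma norm5 (b : Fin 5 → Euc 5) (h1 : ∀ i, ‖b i‖ = 1) (s : Fin 5 → ℝ) : ‖∑ i, s i • b i‖ ^ 2 =
    s 0 ^ 2 + s 1 ^ 2 + s 2 ^ 2 + s 3 ^ 2 + s 4 ^ 2 + 2 * (s 0 * s 1 * ⟪b 0, b 1⟫ + s 0 * s 2 * ⟪b 0, b 2⟫ + s 0 * s 3 * ⟪b 0, b 3⟫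
      + s 0 * s 4 * ⟪b 0, b 4⟫ + s 1 * s 2 * ⟪b 1, b 2⟫ + s 1 * s 3 * ⟪b 1, b 3⟫ + s 1 * s 4 * ⟪b 1, b 4⟫
      + s 2 * s 3 * ⟪b 2, b 3⟫ + s 2 * s 4 * ⟪b 2, b 4⟫ + s 3 * s 4 * ⟪b 3, b 4⟫) := by
  have hs : ∀ i, ⟪b i, b i⟫ = (1:ℝ) := fun i => by rw [real_inner_self_eq_norm_sq, h1]; norm_num
  rw [← real_inner_self_eq_norm_sq]
  simp only [Fin.sum_univ_five, inner_add_left, inner_add_right, inner_smul_left, inner_smul_right, hs]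
  rw [real_inner_comm (b 0) (b 1), real_inner_comm (b 0) (b 2), real_inner_comm (b 0) (b 3), real_inner_comm (b 0) (b 4),
    real_inner_comm (b 1) (b 2), real_inner_comm (b 1) (b 3), real_inner_comm (b 1) (b 4), real_inner_comm (b 2) (b 3),
    real_inner_comm (b 2) (b 4), real_inner_comm (b 3) (b 4)]
  simp
  ring

lemma W5_perfect {T b : Fin 5 → Euc 5} (hA : Adm T) (hcrit : |gdet T| = dB 5) (hD : ¬ D4type T) (hW : W5 T b)
    (H : Fin 5 → Fin 5 → ℝ) (hsym : ∀ i j, H i j = H j i) (hdiag : ∀ i, H i i = 0)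
    (hH : ∀ s : Fin 5 → ℝ, (∀ i, s i = 1 ∨ s i = -1) → ‖∑ i, s i • b i‖ ^ 2 = 4 → ∑ i, ∑ j, s i * s j * H i j = 0) (i j : Fin 5) : H i j = 0 := by
  have hp := perfect_mat hA hcrit hW.2.1 H (by
    intro x hx hx1
    rcases unit_W5 hA hD hW x hx hx1 with ⟨i, hi⟩ | h
    · refine Finset.sum_eq_zero fun k _ => Finset.sum_eq_zero fun l _ => ?_
      by_cases hk : k = i
      · by_cases hl : l = i
        · rw [hk, hl, hdiag, mul_zero]
        · rw [hi l hl]; ring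
      · rw [hi k hk]; ring
    · have := hH (fun i => 2 * x i) (fun i => by rcases h i with h | h <;> rw [h] <;> norm_num) (by
        have : ∑ i, (2 * x i) • b i = (2:ℝ) • ∑ i, x i • b i := by simp [Finset.smul_sum, smul_smul]
        rw [this, norm_smul, hx1]; norm_num)
      have e : ∀ i j, 2 * x i * (2 * x j) * H i j = 4 * (x i * x j * H i j) := fun i j => by ring
      simp_rw [e, ← Finset.mul_sum] at this
      linarith)
  by_cases hij : i = j
  · rw [hij, hdiag]
  have h2 := hp (Pi.single i 1 + Pi.single j 1)
  have e : ∀ k l : Fin 5, (Pi.single i 1 + Pi.single j 1 : Fin 5 → ℝ) k * (Pi.single i 1 + Pi.single j 1 : Fin 5 → ℝ) l * H k l =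
     (if k = i then if l = i then H k l else 0 else 0) + (if k = i then if l = j then H k l else 0 else 0) +
     (if k = j then if l = i then H k l else 0 else 0) + (if k = j then if l = j then H k l else 0 else 0) := by
    intro k l
    simp only [Pi.add_apply, Pi.single_apply]
    split_ifs <;> ring
  rw [Finset.sum_congr rfl fun k _ => Finset.sum_congr rfl fun l _ => e k l] at h2
  simp only [Finset.sum_add_distrib] at h2
  simp [hdiag] at h2
  rw [hsym j i] at h2
  linarith

lemma W5_caseA {T b : Fin 5 → Euc 5} (hA : Adm T) (hcrit : |gdet T| = dB 5) (hD : ¬ D4type T) (hW : W5 T b)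
    (h1 : ‖∑ i, (![1,1,1,1,1] : Fin 5 → ℝ) i • b i‖ ^ 2 ≠ 4) (h2 : ‖∑ i, (![-1,1,1,1,1] : Fin 5 → ℝ) i • b i‖ ^ 2 ≠ 4)
    (h3 : ‖∑ i, (![1,-1,1,1,1] : Fin 5 → ℝ) i • b i‖ ^ 2 ≠ 4) (h4 : ‖∑ i, (![-1,-1,1,1,1] : Fin 5 → ℝ) i • b i‖ ^ 2 ≠ 4) : False := by
  have hG : ∀ i j, (!![1,0,0,0,0;0,1,0,0,0;0,0,1,1/2,1/2;0,0,1/2,1,1/2;0,0,1/2,1/2,1] : Matrix (Fin 5) (Fin 5) ℝ) i j - ⟪b i, b j⟫ = 0 := by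
    refine W5_perfect hA hcrit hD hW (fun i j => (!![1,0,0,0,0;0,1,0,0,0;0,0,1,1/2,1/2;0,0,1/2,1,1/2;0,0,1/2,1/2,1] : Matrix (Fin 5) (Fin 5) ℝ) i j - ⟪b i, b j⟫) ?_ ?_ ?_
    · intro i j
      rw [real_inner_comm]
      fin_cases i <;> fin_cases j <;> simp
    · intro i
      have : ⟪b i, b i⟫ = (1:ℝ) := by rw [real_inner_self_eq_norm_sq, hW.1]; norm_num
      rw [this]
      fin_cases i <;> simp
    · intro s hs h
      have e1 : ∑ i, ∑ j, s i * s j * ⟪b i, b j⟫ = 4 := by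
        rw [← h, ← real_inner_self_eq_norm_sq, sum_inner]
        simp_rw [inner_sum, inner_smul_left, inner_smul_right]
        simp [mul_assoc]
      simp_rw [mul_sub, Finset.sum_sub_distrib]
      rw [e1]
      simp [Fin.sum_univ_five]
      have hneg : ∀ t : Fin 5 → ℝ, (∀ i, t i = - s i) → ‖∑ i, t i • b i‖ ^ 2 = 4 := by
        intro t ht
        simp_rw [ht, neg_smul, Finset.sum_neg_distrib, norm_neg]
        exact h
      have conv : ∀ t : Fin 5 → ℝ, ‖∑ i, t i • b i‖ ^ 2 ≠ 4 → ¬ (∀ i, s i = t i) ∧ ¬ (∀ i, s i = - t i) := by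
        intro t ht
        refine ⟨fun hh => ht ?_, fun hh => ht (hneg t fun i => by rw [hh]; ring)⟩
        rw [← funext hh]; exact h
      have c1 := conv _ h1
      have c2 := conv _ h2
      have c3 := conv _ h3
      have c4 := conv _ h4
      simp [Fin.forall_fin_succ] at c1 c2 c3 c4
      rcases hs 0 with z0 | z0 <;> rcases hs 1 with z1 | z1 <;> rcases hs 2 with z2 | z2 <;>
        rcases hs 3 with z3 | z3 <;> rcases hs 4 with z4 | z4 <;> simp only [z0, z1, z2, z3, z4] at c1 c2 c3 c4 ⊢ <;>
        first | (norm_num; done) | (exfalso; norm_num at c1; done) | (exfalso; norm_num at c2; done) | (exfalso; norm_num at c3; done) | (exfalso; norm_num at c4; done)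
  have hI : ∀ i j, ⟪b i, b j⟫ = (!![1,0,0,0,0;0,1,0,0,0;0,0,1,1/2,1/2;0,0,1/2,1,1/2;0,0,1/2,1/2,1] : Matrix (Fin 5) (Fin 5) ℝ) i j := fun i j => by
    linarith [hG i j]
  apply hD
  refine ⟨![b 0, b 1, b 2 - b 3, b 4], ?_, ?_, ?_⟩
  · rw [orthonormal_iff_ite]
    intro i j
    fin_cases i <;> fin_cases j <;>
      simp [-inner_self_eq_norm_sq_to_K, inner_sub_left, inner_sub_right, hI] <;> norm_num [hW.1]
  · intro i
    fin_cases i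
    · exact hW.2.2.1 0
    · exact hW.2.2.1 1
    · exact Lb_sub (hW.2.2.1 2) (hW.2.2.1 3)
    · exact hW.2.2.1 4
  · convert hW.2.2.2 ![1,1,1,-1,1] (by intro i; fin_cases i <;> simp) using 1
    simp [Fin.sum_univ_four, Fin.sum_univ_five]
    module

end

section
open scoped RealInnerProductSpace
open Metric MeasureTheory

lemma perm5 (i j : Fin 5) (h : i ≠ j) : ∃ p : Equiv.Perm (Fin 5), p 0 = i ∧ p 1 = j := by
  refine ⟨(Equiv.swap 0 i).trans (Equiv.swap (Equiv.swap 0 i 1) j), ?_, ?_⟩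
  · revert h; revert i j; decide
  · simp

lemma W5_sign {T b : Fin 5 → Euc 5} (hW : W5 T b) (σ : Fin 5 → ℝ) (hσ : ∀ i, σ i = 1 ∨ σ i = -1) : W5 T (fun i => σ i • b i) := by
  obtain ⟨h1, hli, hbT, hh⟩ := hW
  refine ⟨fun i => ?_, ?_, fun i => ?_, fun τ hτ => ?_⟩
  · rcases hσ i with h | h <;> simp [h, norm_neg, h1]
  · rw [Fintype.linearIndependent_iff]
    intro c hc i
    simp_rw [smul_smul] at hc
    have := Fintype.linearIndependent_iff.1 hli _ hc i
    rcases hσ i with h | h <;> simpa [h] using this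
  · rcases hσ i with h | h
    · simpa [h] using hbT i
    · simpa [h] using Lb_neg (hbT i)
  · have := hh (fun i => τ i * σ i) (fun i => by rcases hσ i with h | h <;> rcases hτ i with h' | h' <;> simp [h, h'])
    convert this using 1
    refine Finset.sum_congr rfl fun i _ => ?_
    rw [smul_smul]; congr 1; ring

lemma W5_perm {T b : Fin 5 → Euc 5} (hW : W5 T b) (p : Equiv.Perm (Fin 5)) : W5 T (b ∘ p) := by
  obtain ⟨h1, hli, hbT, hh⟩ := hW
  refine ⟨fun i => h1 _, hli.comp p p.injective, fun i => hbT _, fun τ hτ => ?_⟩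
  have := hh (τ ∘ p.symm) (fun i => hτ _)
  rw [← Equiv.sum_comp p] at this
  simpa using this

def fl (i j : Fin 5) : Fin 5 → ℝ := fun k => if k = i ∨ k = j then -1 else 1

lemma W5_caseA' {T b : Fin 5 → Euc 5} (hA : Adm T) (hcrit : |gdet T| = dB 5) (hD : ¬ D4type T) (hW : W5 T b) (i j : Fin 5) (hij : i ≠ j)
    (h1 : 4 < ‖∑ k, (1:ℝ) • b k‖ ^ 2) (h2 : 4 < ‖∑ k, fl i i k • b k‖ ^ 2)
    (h3 : 4 < ‖∑ k, fl j j k • b k‖ ^ 2) (h4 : 4 ≤ ‖∑ k, fl i j k • b k‖ ^ 2) : ‖∑ k, fl i j k • b k‖ ^ 2 = 4 := by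
  by_contra hne
  obtain ⟨p, rfl, rfl⟩ := perm5 i j hij
  refine W5_caseA hA hcrit hD (W5_perm hW p) ?_ ?_ ?_ ?_
  · rw [← Equiv.sum_comp p] at h1
    convert h1.ne' using 5 with k
    · fin_cases k <;> simp
    · rfl
  · rw [← Equiv.sum_comp p] at h2
    convert h2.ne' using 5 with k
    · fin_cases k <;> simp [fl]
    · rfl
  · rw [← Equiv.sum_comp p] at h3
    convert h3.ne' using 5 with k
    · fin_cases k <;> simp [fl]
    · rfl
  · rw [← Equiv.sum_comp p] at hne
    convert hne using 5 with k
    · fin_cases k <;> simp [fl]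
    · rfl

set_option maxHeartbeats 2000000 in
lemma W5_false {T b : Fin 5 → Euc 5} (hA : Adm T) (hcrit : |gdet T| = dB 5) (hle : gdet T ^ 2 ≤ 1/8) (hD : ¬ D4type T) (hW : W5 T b) : False := by
  have hT := crit_ne hcrit
  -- choose the best signs
  obtain ⟨τ, hτ⟩ := Finite.exists_max (fun τ : Fin 5 → Bool => ‖∑ i, (if τ i then (1:ℝ) else -1) • b i‖ ^ 2)
  have hW2 := W5_sign hW (fun i => if τ i then (1:ℝ) else -1) (fun i => by cases τ i <;> simp)
  set c : Fin 5 → Euc 5 := fun i => (if τ i then (1:ℝ) else -1) • b i with hc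
  have hmax : ∀ s : Fin 5 → ℝ, (∀ i, s i = 1 ∨ s i = -1) → ‖∑ i, s i • c i‖ ^ 2 ≤ ‖∑ i, (1:ℝ) • c i‖ ^ 2 := by
    intro s hs
    have := hτ (fun i => if s i = 1 then τ i else !(τ i))
    beta_reduce at this
    have e1 : ∑ i, s i • c i = ∑ i, (if (if s i = 1 then τ i else !(τ i)) = true then (1:ℝ) else -1) • b i := by
      refine Finset.sum_congr rfl fun i _ => ?_
      rcases hs i with h | h
      · simp [hc, h]
      · have h3 : (-1:ℝ) ≠ 1 := by norm_num
        cases hti : τ i <;> simp [hc, h, hti, h3]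
    have e2 : ∑ i, (1:ℝ) • c i = ∑ i, (if τ i then (1:ℝ) else -1) • b i := by
      refine Finset.sum_congr rfl fun i _ => ?_
      simp [hc]
    rw [e1, e2]
    exact this
  clear_value c
  have hmin : ∀ s : Fin 5 → ℝ, (∀ i, s i = 1 ∨ s i = -1) → 4 ≤ ‖∑ i, s i • c i‖ ^ 2 := by
    intro s hs
    have h1 := hW2.2.2.2 s hs
    have h2 := hA _ h1 (by
      intro h0
      have := Fintype.linearIndependent_iff.1 hW2.2.1 _ h0 0
      rcases hs 0 with h | h <;> rw [h] at this <;> norm_num at this)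
    have : ∑ i, s i • c i = (2:ℝ) • ∑ i, (s i / 2) • c i := by
      rw [Finset.smul_sum]; refine Finset.sum_congr rfl fun i _ => ?_
      rw [smul_smul]; congr 1; ring
    rw [this, norm_smul]
    norm_num
    nlinarith
  have hflc : ∀ i j k, fl i j k = 1 ∨ fl i j k = -1 := by
    intro i j k; unfold fl; split_ifs <;> simp
  have hq := W5_caseA' hA hcrit hD hW2
  have hN := norm5 c hW2.1
  have n1 := hN (fun _ => 1)
  have n0 := fun i j => hN (fl i j)
  have nn := fun i j => hmin (fl i j) (hflc i j)
  have mm := fun i => hmax (fl i i) (hflc i i)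
  have hgd := W5_gdet hA hT hD hW2
  have hg : gdet c ^ 2 ≤ 1/2 := by linarith
  rw [gdet_sq] at hg
  have hs : ∀ i, ⟪c i, c i⟫ = (1:ℝ) := fun i => by rw [real_inner_self_eq_norm_sq, hW2.1]; norm_num
  have hsy : ∀ i j, gram c i j = gram c j i := fun i j => by simp [gram, real_inner_comm]
  have hgd : ∀ i, gram c i i = 1 := fun i => by simp only [gram, Matrix.of_apply, hs]
  have hgo : ∀ i j, ⟪c i, c j⟫ = gram c i j := fun i j => by simp [gram]
  simp only [hgo] at n1 n0
  generalize gram c = G at *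
  generalize hM : ‖∑ i, (1:ℝ) • c i‖ ^ 2 = M at *
  have hF : ∃ F : Fin 5 → Fin 5 → ℝ, ∀ i j, F i j = ‖∑ k, fl i j k • c k‖ ^ 2 := ⟨_, fun i j => rfl⟩
  obtain ⟨F, hF⟩ := hF
  simp only [← hF] at hq n0 nn mm
  clear hmax hmin hN hF hM
  have hM4 : 4 < M := by
    have a1 := mm 0
    have a2 := mm 1
    have a3 := mm 2
    have a4 := mm 3
    have a5 := mm 4
    rw [n0] at a1 a2 a3 a4 a5
    simp [fl] at a1 a2 a3 a4 a5 n1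
    linarith
  have key := folded_cube ((M - 4)/4) ((F 0 0 - 4)/4) ((F 1 1 - 4)/4) ((F 2 2 - 4)/4) ((F 3 3 - 4)/4) ((F 4 4 - 4)/4)
    ((F 0 1 - 4)/4) ((F 0 2 - 4)/4) ((F 0 3 - 4)/4) ((F 0 4 - 4)/4) ((F 1 2 - 4)/4) ((F 1 3 - 4)/4) ((F 1 4 - 4)/4)
    ((F 2 3 - 4)/4) ((F 2 4 - 4)/4) ((F 3 4 - 4)/4)
    (by linarith [nn 0 0]) (by linarith [nn 1 1]) (by linarith [nn 2 2]) (by linarith [nn 3 3]) (by linarith [nn 4 4])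
    (by linarith [nn 0 1]) (by linarith [nn 0 2]) (by linarith [nn 0 3]) (by linarith [nn 0 4])
    (by linarith [nn 1 2]) (by linarith [nn 1 3]) (by linarith [nn 1 4]) (by linarith [nn 2 3]) (by linarith [nn 2 4]) (by linarith [nn 3 4])
    (by linarith [mm 0]) (by linarith [mm 1]) (by linarith [mm 2]) (by linarith [mm 3]) (by linarith [mm 4])
    (by rw [n1, n0, n0, n0, n0, n0]; simp [fl]; ring)
    (by rw [n1, n0, n0, n0, n0, n0]; simp [fl]; ring)
    (by rw [n1, n0, n0, n0, n0, n0]; simp [fl]; ring)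
    (by rw [n1, n0, n0, n0, n0, n0]; simp [fl]; ring)
    (by rw [n1, n0, n0, n0, n0, n0]; simp [fl]; ring)
    (by rw [n1, n0, n0, n0, n0, n0]; simp [fl]; ring)
    (by rw [n0, n0, n0, n0, n0, n0]; simp [fl]; ring)
    (by rw [n0, n0, n0, n0, n0, n0]; simp [fl]; ring)
    (by rw [n0, n0, n0, n0, n0, n0]; simp [fl]; ring)
    (by rw [n0, n0, n0, n0, n0, n0]; simp [fl]; ring)
    (by rw [n0, n0, n0, n0, n0, n0]; simp [fl]; ring)
    (by rw [n0, n0, n0, n0, n0, n0]; simp [fl]; ring)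
    (by rw [n0, n0, n0, n0, n0, n0]; simp [fl]; ring)
    (by rw [n0, n0, n0, n0, n0, n0]; simp [fl]; ring)
    (by rw [n0, n0, n0, n0, n0, n0]; simp [fl]; ring)
    (by rw [n0, n0, n0, n0, n0, n0]; simp [fl]; ring)
    (fun a b => by rw [hq 0 1 (by decide) hM4 (by linarith) (by linarith) (nn _ _)]; norm_num)
    (fun a b => by rw [hq 0 2 (by decide) hM4 (by linarith) (by linarith) (nn _ _)]; norm_num)
    (fun a b => by rw [hq 0 3 (by decide) hM4 (by linarith) (by linarith) (nn _ _)]; norm_num)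
    (fun a b => by rw [hq 0 4 (by decide) hM4 (by linarith) (by linarith) (nn _ _)]; norm_num)
    (fun a b => by rw [hq 1 2 (by decide) hM4 (by linarith) (by linarith) (nn _ _)]; norm_num)
    (fun a b => by rw [hq 1 3 (by decide) hM4 (by linarith) (by linarith) (nn _ _)]; norm_num)
    (fun a b => by rw [hq 1 4 (by decide) hM4 (by linarith) (by linarith) (nn _ _)]; norm_num)
    (fun a b => by rw [hq 2 3 (by decide) hM4 (by linarith) (by linarith) (nn _ _)]; norm_num)
    (fun a b => by rw [hq 2 4 (by decide) hM4 (by linarith) (by linarith) (nn _ _)]; norm_num)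
    (fun a b => by rw [hq 3 4 (by decide) hM4 (by linarith) (by linarith) (nn _ _)]; norm_num)
  obtain ⟨kc, k0, k1, k2, k3, k4, k01, k02, k03, k04, k12, k13, k14, k23, k24, k34⟩ := key
  rw [n0] at k0 k1 k2 k3 k4 k01 k02 k03 k04 k12 k13 k14 k23 k24 k34
  rw [n1] at kc
  clear nn mm hq n0 n1
  simp [fl] at kc k0 k1 k2 k3 k4 k01 k02 k03 k04 k12 k13 k14 k23 k24 k34
  have g01 : G 0 1 = 1/4 := by linarith
  have g02 : G 0 2 = 1/4 := by linarith
  have g03 : G 0 3 = 1/4 := by linarith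
  have g04 : G 0 4 = 1/4 := by linarith
  have g12 : G 1 2 = 1/4 := by linarith
  have g13 : G 1 3 = 1/4 := by linarith
  have g14 : G 1 4 = 1/4 := by linarith
  have g23 : G 2 3 = 1/4 := by linarith
  have g24 : G 2 4 = 1/4 := by linarith
  have g34 : G 3 4 = 1/4 := by linarith
  have hGe : G = !![1,1/4,1/4,1/4,1/4;1/4,1,1/4,1/4,1/4;1/4,1/4,1,1/4,1/4;1/4,1/4,1/4,1,1/4;1/4,1/4,1/4,1/4,1] := by
    ext i j
    fin_cases i <;> fin_cases j <;> simp [hgd, g01, g02, g03, g04, g12, g13, g14, g23, g24, g34, hsy 1 0, hsy 2 0, hsy 3 0, hsy 4 0,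
      hsy 2 1, hsy 3 1, hsy 4 1, hsy 3 2, hsy 4 2, hsy 4 3]
  rw [hGe] at hg
  simp [Matrix.det_succ_row_zero, Fin.sum_univ_succ, Fin.succAbove] at hg
  norm_num at hg

end

section
open scoped RealInnerProductSpace
open Metric MeasureTheory

def UU {V : Type} [AddCommGroup V] [Module ℝ V] (S : Set V) : Prop :=
  ∀ (k : ℕ) (b : Fin k → V), LinearIndependent ℝ b → (∀ i, b i ∈ S) → ∀ x : Fin k → ℝ, ∑ i, x i • b i ∈ S →
    ∀ i, x i = 0 ∨ x i = 1 ∨ x i = -1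

section
variable {V : Type} [AddCommGroup V] [Module ℝ V]

lemma exists_li_fin [FiniteDimensional ℝ V] (D : Set V) : ∃ (k : ℕ) (d : Fin k → V), (∀ i, d i ∈ D) ∧ LinearIndependent ℝ d ∧
    Submodule.span ℝ (Set.range d) = Submodule.span ℝ D := by
  obtain ⟨b, hb, hs, hli⟩ := exists_linearIndependent ℝ D
  haveI : Fintype b := hli.setFinite.fintype
  let e := Fintype.equivFin b
  refine ⟨Fintype.card b, fun i => (e.symm i : V), fun i => hb (e.symm i).2, hli.comp e.symm e.symm.injective, ?_⟩
  rw [← hs]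
  congr 1
  ext v
  constructor
  · rintro ⟨i, rfl⟩; exact (e.symm i).2
  · intro hv; exact ⟨e ⟨v, hv⟩, by simp⟩

lemma exists_functional {k : ℕ} {d : Fin k → V} (hli : LinearIndependent ℝ d) (m : Fin k → ℝ) :
    ∃ l : V →ₗ[ℝ] ℝ, ∀ i, l (d i) = m i := by
  let f := (Module.Basis.span hli).constr ℝ m
  obtain ⟨g, hg⟩ := LinearMap.exists_extend f
  refine ⟨g, fun i => ?_⟩
  have h1 : ((Module.Basis.span hli i : Submodule.span ℝ (Set.range d)) : V) = d i := by
    rw [Module.Basis.span_apply]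
  have h2 := LinearMap.congr_fun hg (Module.Basis.span hli i)
  simp only [LinearMap.comp_apply, Submodule.subtype_apply, h1] at h2
  rw [h2]
  exact (Module.Basis.span hli).constr_basis ℝ m i

variable (e0 : V)

abbrev qm : V →ₗ[ℝ] V ⧸ Submodule.span ℝ {e0} := (Submodule.span ℝ {e0}).mkQ

lemma qm_eq_zero {v : V} : qm e0 v = 0 ↔ ∃ c : ℝ, c • e0 = v := by
  simp [Submodule.mem_span_singleton]

lemma qm_self : qm e0 e0 = 0 := (qm_eq_zero e0).2 ⟨1, one_smul _ _⟩

lemma li_cons (h0 : e0 ≠ 0) {k : ℕ} {s : Fin k → V} (h : LinearIndependent ℝ (fun i => qm e0 (s i))) :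
    LinearIndependent ℝ (Fin.cons e0 s : Fin (k+1) → V) := by
  rw [Fintype.linearIndependent_iff]
  intro c hc
  rw [Fin.sum_univ_succ] at hc
  simp only [Fin.cons_zero, Fin.cons_succ] at hc
  have h1 := congrArg (qm e0) hc
  simp only [map_add, map_smul, map_sum, qm_self, smul_zero, zero_add, map_zero] at h1
  have h2 := Fintype.linearIndependent_iff.1 h _ h1
  simp only [h2, zero_smul, Finset.sum_const_zero, add_zero, smul_eq_zero, h0, or_false] at hc
  intro i
  refine Fin.cases hc (fun j => h2 j) i

lemma lift_sum {k : ℕ} {s : Fin k → V} {x : Fin k → ℝ} {v : V} (h : qm e0 v = ∑ i, x i • qm e0 (s i)) :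
    ∃ c : ℝ, v = c • e0 + ∑ i, x i • s i := by
  have : qm e0 (v - ∑ i, x i • s i) = 0 := by
    rw [map_sub, h]; simp only [map_sum, map_smul, sub_self]
  obtain ⟨c, hc⟩ := (qm_eq_zero e0).1 this
  exact ⟨c, by rw [hc]; abel⟩

variable {e0} {S : Set V}

lemma UU_cons (hU : UU S) (h0 : e0 ≠ 0) (hS0 : e0 ∈ S) {k : ℕ} {s : Fin k → V} (h : LinearIndependent ℝ (fun i => qm e0 (s i)))
    (hs : ∀ i, s i ∈ S) (c : ℝ) (x : Fin k → ℝ) (hv : c • e0 + ∑ i, x i • s i ∈ S) :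
    (c = 0 ∨ c = 1 ∨ c = -1) ∧ ∀ i, x i = 0 ∨ x i = 1 ∨ x i = -1 := by
  have := hU (k+1) (Fin.cons e0 s) (li_cons e0 h0 h) (fun i => Fin.cases hS0 hs i) (Fin.cons c x) (by
    rw [Fin.sum_univ_succ]; simpa using hv)
  exact ⟨by simpa using this 0, fun i => by simpa using this i.succ⟩

lemma UU_quot (hU : UU S) (h0 : e0 ≠ 0) (hS0 : e0 ∈ S) : UU (qm e0 '' S) := by
  intro k b hli hb x hx
  choose s hs hsb using hb
  obtain ⟨v, hv, hvx⟩ := hx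
  have hli' : LinearIndependent ℝ (fun i => qm e0 (s i)) := by
    simp_rw [hsb]; exact hli
  simp_rw [← hsb] at hvx
  obtain ⟨c, hc⟩ := lift_sum e0 hvx
  rw [hc] at hv
  exact (UU_cons hU h0 hS0 hli' hs c x hv).2

lemma two_lift (hU : UU S) (h0 : e0 ≠ 0) (hS0 : e0 ∈ S) {v : V} (hv : v ∈ S) (hv0 : qm e0 v ≠ 0) {c : ℝ} (h : v + c • e0 ∈ S) :
    c = 0 ∨ c = 1 ∨ c = -1 := by
  refine (UU_cons (s := fun _ : Fin 1 => v) hU h0 hS0 ?_ (fun _ => hv) c (fun _ => 1) ?_).1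
  · exact LinearIndependent.of_subsingleton (0 : Fin 1) hv0
  · simpa [add_comm] using h

lemma coef (hU : UU S) (h0 : e0 ≠ 0) (hS0 : e0 ∈ S) {k : ℕ} {y : Fin k → V} (h : LinearIndependent ℝ (fun i => qm e0 (y i)))
    (hy : ∀ i, y i ∈ S) (hy' : ∀ i, y i + e0 ∈ S) (c : ℝ) (x : Fin k → ℝ) (hv : c • e0 + ∑ i, x i • y i ∈ S) (J : Finset (Fin k)) :
    c - ∑ j ∈ J, x j = 0 ∨ c - ∑ j ∈ J, x j = 1 ∨ c - ∑ j ∈ J, x j = -1 := by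
  classical
  refine (UU_cons (s := fun i => if i ∈ J then y i + e0 else y i) hU h0 hS0 ?_ ?_ (c - ∑ j ∈ J, x j) x ?_).1
  · convert h using 2 with i
    split_ifs
    · rw [map_add, qm_self, add_zero]
    · rfl
  · intro i
    split_ifs
    · exact hy' i
    · exact hy i
  · convert hv using 1
    have : ∀ i, x i • (if i ∈ J then y i + e0 else y i) = x i • y i + (if i ∈ J then x i else 0) • e0 := by
      intro i; split_ifs <;> simp
    simp_rw [this, Finset.sum_add_distrib, ← Finset.sum_smul]
    rw [Finset.sum_ite_mem, Finset.univ_inter, sub_smul]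
    abel

lemma quot_form (hU : UU S) (hsym : ∀ v ∈ S, -v ∈ S) (h0 : e0 ≠ 0) (hS0 : e0 ∈ S)
    (φ : V →ₗ[ℝ] ℝ) (hφ : φ e0 = 1) (l : (V ⧸ Submodule.span ℝ {e0}) →ₗ[ℝ] ℝ) (g : V → ℝ) (hg : ∀ v, g (-v) = g v)
    (hl : ∀ y ∈ S, y + e0 ∈ S → qm e0 y ≠ 0 → g (y + e0) - g y = l (qm e0 y))
    (IH : ∀ g' : (V ⧸ Submodule.span ℝ {e0}) → ℝ, (∀ v, g' (-v) = g' v) → 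
      ∃ B : (V ⧸ Submodule.span ℝ {e0}) →ₗ[ℝ] (V ⧸ Submodule.span ℝ {e0}) →ₗ[ℝ] ℝ, ∀ v ∈ qm e0 '' S, v ≠ 0 → B v v = g' v) :
    ∃ R : (V ⧸ Submodule.span ℝ {e0}) →ₗ[ℝ] (V ⧸ Submodule.span ℝ {e0}) →ₗ[ℝ] ℝ, ∀ v ∈ S, qm e0 v ≠ 0 →
      R (qm e0 v) (qm e0 v) = g v - φ v * l (qm e0 v) := by
  classical
  have wd : ∀ v ∈ S, ∀ w ∈ S, qm e0 v = qm e0 w → qm e0 v ≠ 0 → g v - φ v * l (qm e0 v) = g w - φ w * l (qm e0 w) := by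
    intro v hv w hw hvw hne
    have : qm e0 (w - v) = 0 := by rw [map_sub, hvw, sub_self]
    obtain ⟨c, hc⟩ := (qm_eq_zero e0).1 this
    have hwv : w = v + c • e0 := by rw [hc]; abel
    rcases two_lift hU h0 hS0 hv hne (hwv ▸ hw) with h | h | h
    · rw [h, zero_smul, add_zero] at hwv; rw [hwv]
    · rw [h, one_smul] at hwv
      have := hl v hv (hwv ▸ hw) hne
      rw [← hvw, hwv, map_add, hφ]
      linarith
    · have hvw' : v = w + e0 := by rw [hwv, h]; simp
      have := hl w hw (hvw' ▸ hv) (hvw ▸ hne)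
      rw [hvw, hvw', map_add, hφ]
      linarith
  let g' : (V ⧸ Submodule.span ℝ {e0}) → ℝ := fun w =>
    if h : ∃ v ∈ S, qm e0 v = w then g h.choose - φ h.choose * l (qm e0 h.choose) else 0
  have hg' : ∀ v ∈ S, qm e0 v ≠ 0 → g' (qm e0 v) = g v - φ v * l (qm e0 v) := by
    intro v hv hne
    have h : ∃ v' ∈ S, qm e0 v' = qm e0 v := ⟨v, hv, rfl⟩
    simp only [g']
    rw [dif_pos h]
    obtain ⟨h1, h2⟩ := h.choose_spec
    exact wd _ h1 _ hv h2 (by rw [h2]; exact hne)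
  obtain ⟨B, hB⟩ := IH g' (by
    intro w
    by_cases hw : w = 0
    · rw [hw, neg_zero]
    by_cases h : ∃ v ∈ S, qm e0 v = w
    · obtain ⟨v, hv, rfl⟩ := h
      rw [hg' v hv hw, ← map_neg, hg' (-v) (hsym v hv) (by rw [map_neg]; exact neg_ne_zero.2 hw), hg, map_neg φ, map_neg (qm e0), map_neg l]
      ring
    · have h' : ¬ ∃ v ∈ S, qm e0 v = -w := by
        rintro ⟨v, hv, hvw⟩
        exact h ⟨-v, hsym v hv, by rw [map_neg, hvw, neg_neg]⟩
      simp only [g']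
      rw [dif_neg h, dif_neg h'])
  exact ⟨B, fun v hv hne => by rw [hB _ ⟨v, hv, rfl⟩ hne, hg' v hv hne]⟩

lemma one_of_D (hU : UU S) (h0 : e0 ≠ 0) (hS0 : e0 ∈ S) {k : ℕ} {y : Fin k → V} (h : LinearIndependent ℝ (fun i => qm e0 (y i)))
    (hy : ∀ i, y i ∈ S) (hy' : ∀ i, y i + e0 ∈ S) {z : V} (hz : z ∈ S) (hz' : z + e0 ∈ S) (hz0 : qm e0 z ≠ 0)
    (hzs : qm e0 z ∈ Submodule.span ℝ (Set.range fun i => qm e0 (y i))) : ∃ i, z = y i ∨ z = -(y i + e0) := by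
  classical
  obtain ⟨x, hx⟩ := (Submodule.mem_span_range_iff_exists_fun ℝ).1 hzs
  obtain ⟨c, hc⟩ := lift_sum e0 hx.symm
  have k1 := fun J => coef hU h0 hS0 h hy hy' c x (hc ▸ hz) J
  have k2 := fun J => coef hU h0 hS0 h hy hy' (c+1) x (by
    have : (c + 1) • e0 + ∑ i, x i • y i = z + e0 := by rw [hc, add_smul, one_smul]; abel
    rw [this]; exact hz') J
  have k3 := (UU_cons hU h0 hS0 h hy c x (hc ▸ hz)).2
  have k4 : ∀ J : Finset (Fin k), c - ∑ j ∈ J, x j = 0 ∨ c - ∑ j ∈ J, x j = -1 := by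
    intro J
    rcases k1 J with h | h | h
    · exact Or.inl h
    · exfalso; rcases k2 J with h' | h' | h' <;> linarith
    · exact Or.inr h
  have hex : ∃ i, x i ≠ 0 := by
    by_contra hcon
    push Not at hcon
    apply hz0
    rw [← hx]; simp [hcon]
  obtain ⟨i, hi⟩ := hex
  have huniq : ∀ j, j ≠ i → x j = 0 := by
    intro j hj
    have a0 := k4 ∅
    have a1 := k4 {i}
    have a2 := k4 {j}
    have a3 := k4 {j, i}
    rw [Finset.sum_pair hj] at a3
    simp only [Finset.sum_empty, Finset.sum_singleton] at a0 a1 a2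
    rcases k3 i with h | h | h
    · exact absurd h hi
    · rcases k3 j with h' | h' | h'
      · exact h'
      · exfalso; rcases a0 with a0 | a0 <;> rcases a3 with a3 | a3 <;> linarith
      · exfalso; rcases a1 with a1 | a1 <;> rcases a2 with a2 | a2 <;> linarith
    · rcases k3 j with h' | h' | h'
      · exact h'
      · exfalso; rcases a1 with a1 | a1 <;> rcases a2 with a2 | a2 <;> linarith
      · exfalso; rcases a0 with a0 | a0 <;> rcases a3 with a3 | a3 <;> linarith
  have hsum : ∑ j, x j • y j = x i • y i := by
    refine Finset.sum_eq_single i (fun j _ hj => by rw [huniq j hj, zero_smul]) (fun h => absurd (Finset.mem_univ i) h)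
  rw [hsum] at hc
  have a0 := k4 ∅
  have a1 := k4 {i}
  simp only [Finset.sum_empty, Finset.sum_singleton] at a0 a1
  refine ⟨i, ?_⟩
  rcases k3 i with h | h | h
  · exact absurd h hi
  · left
    have : c = 0 := by rw [h] at a1; rcases a0 with a0 | a0 <;> rcases a1 with a1 | a1 <;> linarith
    rw [hc, this, h]; simp
  · right
    have : c = -1 := by rw [h] at a1; rcases a0 with a0 | a0 <;> rcases a1 with a1 | a1 <;> linarith
    rw [hc, this, h]; simp

end

lemma exists_phi {V : Type} [AddCommGroup V] [Module ℝ V] {e0 : V} (h0 : e0 ≠ 0) : ∃ φ : V →ₗ[ℝ] ℝ, φ e0 = 1 := by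
  obtain ⟨l, hl⟩ := exists_functional (d := fun _ : Fin 1 => e0) (LinearIndependent.of_subsingleton (0 : Fin 1) h0) (fun _ => 1)
  exact ⟨l, hl 0⟩

theorem interp (m : ℕ) : ∀ (V : Type) [AddCommGroup V] [Module ℝ V] [FiniteDimensional ℝ V], Module.finrank ℝ V = m →
    ∀ S : Set V, UU S → (∀ v ∈ S, -v ∈ S) → ∀ g : V → ℝ, (∀ v, g (-v) = g v) →
    ∃ B : V →ₗ[ℝ] V →ₗ[ℝ] ℝ, ∀ v ∈ S, v ≠ 0 → B v v = g v := by
  induction m with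
  | zero =>
    intro V _ _ _ hm S hU hsym g hg
    have := Module.finrank_zero_iff.1 hm
    exact ⟨0, fun v _ hv => absurd (Subsingleton.elim v 0) hv⟩
  | succ m ih =>
    intro V _ _ _ hm S hU hsym g hg
    by_cases hne : ∃ e0 ∈ S, e0 ≠ 0
    swap
    · push Not at hne
      exact ⟨0, fun v hv hv0 => absurd (hne v hv) hv0⟩
    obtain ⟨e0, hS0, h0⟩ := hne
    obtain ⟨φ, hφ⟩ := exists_phi h0
    have hfr : Module.finrank ℝ (V ⧸ Submodule.span ℝ {e0}) = m := by
      have h1 := Submodule.finrank_quotient_add_finrank (Submodule.span ℝ {e0})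
      rw [finrank_span_singleton h0, hm] at h1
      omega
    let g1 : V → ℝ := fun v => g v - g e0 * φ v ^ 2
    have hg1 : ∀ v, g1 (-v) = g1 v := fun v => by simp [g1, hg]
    obtain ⟨k, d, hdD, hdli, hds⟩ := exists_li_fin {d : V ⧸ Submodule.span ℝ {e0} | d ≠ 0 ∧ ∃ y ∈ S, y + e0 ∈ S ∧ qm e0 y = d}
    choose hd0 y hy hy' hyd using hdD
    obtain ⟨l, hl⟩ := exists_functional hdli (fun i => g1 (y i + e0) - g1 (y i))
    have hli : LinearIndependent ℝ (fun i => qm e0 (y i)) := by simp_rw [hyd]; exact hdli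
    obtain ⟨R, hR⟩ := quot_form hU hsym h0 hS0 φ hφ l g1 hg1 (by
      intro z hz hz' hz0
      have hzs : qm e0 z ∈ Submodule.span ℝ (Set.range fun i => qm e0 (y i)) := by
        simp_rw [hyd]
        rw [hds]
        exact Submodule.subset_span ⟨hz0, z, hz, hz', rfl⟩
      obtain ⟨i, h | h⟩ := one_of_D hU h0 hS0 hli hy hy' hz hz' hz0 hzs
      · rw [h, hyd, hl]
      · have e1 : z + e0 = - y i := by rw [h]; abel
        rw [e1, h, hg1, hg1, map_neg, map_neg, map_add, qm_self, add_zero, hyd, hl]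
        ring)
      (fun g' hg' => ih _ hfr _ (UU_quot hU h0 hS0) (by
        rintro _ ⟨v, hv, rfl⟩; exact ⟨-v, hsym v hv, map_neg _ _⟩) g' hg')
    refine ⟨(g e0) • (LinearMap.mul ℝ ℝ).compl₁₂ φ φ + (LinearMap.mul ℝ ℝ).compl₁₂ φ (l ∘ₗ qm e0) + R.compl₁₂ (qm e0) (qm e0), fun v hv hv0 => ?_⟩
    simp only [LinearMap.add_apply, LinearMap.smul_apply, LinearMap.compl₁₂_apply, LinearMap.mul_apply', LinearMap.comp_apply, smul_eq_mul]
    by_cases hq : qm e0 v = 0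
    · obtain ⟨c, hc⟩ := (qm_eq_zero e0).1 hq
      have hcc := hU 1 (fun _ => e0) (LinearIndependent.of_subsingleton (0 : Fin 1) h0) (fun _ => hS0) (fun _ => c) (by simpa [hc] using hv) 0
      rw [hq, map_zero, map_zero, ← hc, map_smul, hφ]
      rcases hcc with h | h | h
      · exact absurd (by rw [← hc, h, zero_smul]) hv0
      · rw [h]; simp
      · rw [h]; simp [hg]
    · rw [hR v hv hq]
      simp only [g1]
      ring

lemma span_D {V : Type} [AddCommGroup V] [Module ℝ V] [FiniteDimensional ℝ V] {S : Set V} (hU : UU S) (hsym : ∀ v ∈ S, -v ∈ S)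
    (hP : ∀ B : V →ₗ[ℝ] V →ₗ[ℝ] ℝ, (∀ v ∈ S, B v v = 0) → ∀ v, B v v = 0) {e0 : V} (h0 : e0 ≠ 0) (hS0 : e0 ∈ S) :
    Submodule.span ℝ {d : V ⧸ Submodule.span ℝ {e0} | ∃ y ∈ S, y + e0 ∈ S ∧ qm e0 y = d} = ⊤ := by
  by_contra hne
  obtain ⟨l, hl0, hl⟩ := Submodule.exists_le_ker_of_lt_top _ (lt_top_iff_ne_top.2 hne)
  obtain ⟨φ, hφ⟩ := exists_phi h0
  obtain ⟨R, hR⟩ := quot_form hU hsym h0 hS0 φ hφ l (fun _ => 0) (fun _ => rfl) (by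
      intro z hz hz' hz0
      have : l (qm e0 z) = 0 := hl (Submodule.subset_span ⟨z, hz, hz', rfl⟩)
      rw [this, sub_self]) (fun g' hg' => interp _ _ rfl _ (UU_quot hU h0 hS0) (by
        rintro _ ⟨v, hv, rfl⟩; exact ⟨-v, hsym v hv, map_neg _ _⟩) g' hg')
  have hB := hP ((LinearMap.mul ℝ ℝ).compl₁₂ φ (l ∘ₗ qm e0) + R.compl₁₂ (qm e0) (qm e0)) (by
    intro v hv
    simp only [LinearMap.add_apply, LinearMap.compl₁₂_apply, LinearMap.mul_apply', LinearMap.comp_apply]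
    by_cases hq : qm e0 v = 0
    · rw [hq]; simp
    · rw [hR v hv hq]; ring)
  apply hl0
  ext v
  have h1 := hB v
  have h2 := hB (v + e0)
  simp only [LinearMap.add_apply, LinearMap.compl₁₂_apply, LinearMap.mul_apply', LinearMap.comp_apply, map_add (qm e0), qm_self, add_zero, map_add φ, hφ] at h1 h2
  simp only [LinearMap.comp_apply, LinearMap.zero_apply]
  linarith

end

section
open scoped RealInnerProductSpace
open Metric MeasureTheory

def IntT {n : ℕ} (T : Fin n → Euc n) : Prop := ∀ (k : ℕ) (b : Fin k → Euc n), (∀ i, ‖b i‖ = 1) → LinearIndependent ℝ b →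
  (∀ i, b i ∈ Lb T) → ∀ x : Fin k → ℝ, ∑ i, x i • b i ∈ Lb T → ∀ i, ∃ m : ℤ, x i = m

def US {n : ℕ} (T : Fin n → Euc n) : Set (Euc n) := {v | v ∈ Lb T ∧ ‖v‖ = 1}

lemma US_UU {n : ℕ} {T : Fin n → Euc n} (hI : IntT T) : UU (US T) := by
  classical
  intro k b hli hb x hx i
  obtain ⟨m, hm⟩ := hI k b (fun i => (hb i).2) hli (fun i => (hb i).1) x hx.1 i
  by_cases h0 : x i = 0
  · exact Or.inl h0
  right
  have hli' := swap_li hli i (v := ∑ j, x j • b j) rfl h0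
  have hmem : ∀ j, Function.update b i (∑ j, x j • b j) j ∈ US T := by
    intro j
    by_cases hj : j = i
    · rw [hj, Function.update_self]; exact hx
    · rw [Function.update_of_ne hj]; exact hb j
  have hc := swap_coord (b := b) i (v := ∑ j, x j • b j) rfl h0 (Pi.single i 1)
  have hs : ∑ j, (Pi.single i (1:ℝ) : Fin k → ℝ) j • b j = b i := by
    rw [Finset.sum_eq_single i]
    · simp
    · intro j _ hj; simp [hj]
    · simp
  rw [hs] at hc
  have h2 := hI k _ (fun j => (hmem j).2) hli' (fun j => (hmem j).1) _ (by rw [← hc]; exact (hb i).1) i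
  obtain ⟨p, hp⟩ := h2
  simp only [if_true, Pi.single_eq_same] at hp
  have h3 : (m : ℝ) * p = 1 := by rw [← hp, ← hm]; field_simp
  have h4 : m * p = 1 := by exact_mod_cast h3
  rcases Int.eq_one_or_neg_one_of_mul_eq_one h4 with h | h
  · left; rw [hm, h]; simp
  · right; rw [hm, h]; simp

lemma US_neg {n : ℕ} {T : Fin n → Euc n} : ∀ v ∈ US T, -v ∈ US T := fun v hv => ⟨Lb_neg hv.1, by rw [norm_neg]; exact hv.2⟩

lemma US_ne {n : ℕ} {T : Fin n → Euc n} {v} (hv : v ∈ US T) : v ≠ 0 := by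
  rintro rfl
  have := hv.2
  simp at this

lemma coef_abs {V : Type} [AddCommGroup V] [Module ℝ V] {S : Set V} {e0 : V} (hU : UU S) (h0 : e0 ≠ 0) (hS0 : e0 ∈ S) {k : ℕ} {y : Fin k → V} (h : LinearIndependent ℝ (fun i => qm e0 (y i)))
    (hy : ∀ i, y i ∈ S) (hy' : ∀ i, y i + e0 ∈ S) (c : ℝ) (x : Fin k → ℝ) (hv : c • e0 + ∑ i, x i • y i ∈ S) :
    ∑ i, |x i| ≤ 2 := by
  have h1 := coef hU h0 hS0 h hy hy' c x hv (Finset.univ.filter fun i => 0 < x i)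
  have h2 := coef hU h0 hS0 h hy hy' c x hv (Finset.univ.filter fun i => ¬ 0 < x i)
  have h3 : ∑ i, |x i| = (∑ i ∈ Finset.univ.filter (fun i => 0 < x i), x i) - ∑ i ∈ Finset.univ.filter (fun i => ¬ 0 < x i), x i := by
    rw [← Finset.sum_filter_add_sum_filter_not Finset.univ (fun i => 0 < x i), sub_eq_add_neg, ← Finset.sum_neg_distrib]
    congr 1
    · exact Finset.sum_congr rfl fun i hi => abs_of_pos (Finset.mem_filter.1 hi).2
    · exact Finset.sum_congr rfl fun i hi => abs_of_nonpos (not_lt.1 (Finset.mem_filter.1 hi).2)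
  rw [h3]
  rcases h1 with h1 | h1 | h1 <;> rcases h2 with h2 | h2 | h2 <;> linarith

lemma pair_form {V : Type} [AddCommGroup V] [Module ℝ V] {S : Set V} {e0 : V} (hU : UU S) (hsym : ∀ v ∈ S, -v ∈ S) (h0 : e0 ≠ 0) (hS0 : e0 ∈ S) {k : ℕ} {y : Fin k → V} (h : LinearIndependent ℝ (fun i => qm e0 (y i)))
    (hy : ∀ i, y i ∈ S) (hy' : ∀ i, y i + e0 ∈ S) (c : ℝ) (x : Fin k → ℝ) (hv : c • e0 + ∑ i, x i • y i ∈ S) {i j : Fin k} (hij : i ≠ j)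
    (hi : x i ≠ 0) (hj : x j ≠ 0) : y i - y j ∈ S ∨ y i + y j + e0 ∈ S := by
  have k3 := (UU_cons hU h0 hS0 h hy c x hv).2
  have kab := coef_abs hU h0 hS0 h hy hy' c x hv
  have hab : ∀ p, x p ≠ 0 → |x p| = 1 := by
    intro p hp
    rcases k3 p with h | h | h
    · exact absurd h hp
    · rw [h]; simp
    · rw [h]; simp
  have hz : ∀ p, p ≠ i → p ≠ j → x p = 0 := by
    intro p hpi hpj
    by_contra hp
    have : ∑ q ∈ {p, i, j}, |x q| ≤ ∑ q, |x q| := Finset.sum_le_univ_sum_of_nonneg fun q => abs_nonneg _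
    rw [Finset.sum_insert (by simp [hpi, hpj]), Finset.sum_pair hij, hab p hp, hab i hi, hab j hj] at this
    linarith
  have hsum : ∑ p, x p • y p = x i • y i + x j • y j := by
    rw [← Finset.sum_pair (f := fun p => x p • y p) hij]
    symm
    apply Finset.sum_subset (Finset.subset_univ _)
    intro p _ hp
    simp only [Finset.mem_insert, Finset.mem_singleton, not_or] at hp
    rw [hz p hp.1 hp.2, zero_smul]
  have a0 := coef hU h0 hS0 h hy hy' c x hv ∅
  have a1 := coef hU h0 hS0 h hy hy' c x hv {i}
  have a2 := coef hU h0 hS0 h hy hy' c x hv {j}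
  have a3 := coef hU h0 hS0 h hy hy' c x hv {i, j}
  rw [Finset.sum_pair hij] at a3
  simp only [Finset.sum_empty, Finset.sum_singleton] at a0 a1 a2
  rw [hsum] at hv
  rcases k3 i with h | h | h
  · exact absurd h hi
  · rcases k3 j with h' | h' | h'
    · exact absurd h' hj
    · right
      have hc : c = 1 := by rcases a0 with a0 | a0 | a0 <;> rcases a3 with a3 | a3 | a3 <;> linarith
      rw [h, h', hc] at hv
      convert hv using 1; simp; abel
    · left
      have hc : c = 0 := by rcases a1 with a1 | a1 | a1 <;> rcases a2 with a2 | a2 | a2 <;> linarith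
      rw [h, h', hc] at hv
      convert hv using 1; simp; abel
  · rcases k3 j with h' | h' | h'
    · exact absurd h' hj
    · left
      have hc : c = 0 := by rcases a1 with a1 | a1 | a1 <;> rcases a2 with a2 | a2 | a2 <;> linarith
      rw [h, h', hc] at hv
      convert hsym _ hv using 1; simp; abel
    · right
      have hc : c = -1 := by rcases a0 with a0 | a0 | a0 <;> rcases a3 with a3 | a3 | a3 <;> linarith
      rw [h, h', hc] at hv
      convert hsym _ hv using 1; simp; abel

lemma pairs {m : ℕ} {T : Fin (m+1) → Euc (m+1)} (hA : Adm T) (hcrit : |gdet T| = dB (m+1)) (hI : IntT T) {e0 : Euc (m+1)} (hS0 : e0 ∈ US T)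
    {y : Fin m → Euc (m+1)} (h : LinearIndependent ℝ (fun i => qm e0 (y i)))
    (hy : ∀ i, y i ∈ US T) (hy' : ∀ i, y i + e0 ∈ US T) {i j : Fin m} (hij : i ≠ j) : y i - y j ∈ US T ∨ y i + y j + e0 ∈ US T := by
  classical
  by_contra hcon
  have hU := US_UU hI
  have h0 := US_ne hS0
  have hli := li_cons e0 h0 h
  have key := perfect_mat hA hcrit hli (fun p q => if p = i.succ then (if q = j.succ then 1 else 0) else 0) (by
    intro x hx hx1
    have hv : x 0 • e0 + ∑ i, x (Fin.succ i) • y i ∈ US T := by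
      have e : x 0 • e0 + ∑ i, x (Fin.succ i) • y i = ∑ i, x i • (Fin.cons e0 y : Fin (m+1) → Euc (m+1)) i := by
        rw [Fin.sum_univ_succ]; simp
      rw [e]; exact ⟨hx, hx1⟩
    have : x i.succ * x j.succ = 0 := by
      by_contra hne
      exact hcon (pair_form hU US_neg h0 hS0 h hy hy' _ _ hv hij (left_ne_zero_of_mul hne) (right_ne_zero_of_mul hne))
    simpa using this) (fun _ => 1)
  simp at key

lemma exists_y {m : ℕ} {T : Fin (m+1) → Euc (m+1)} (hA : Adm T) (hcrit : |gdet T| = dB (m+1)) (hI : IntT T) :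
    ∃ e0 ∈ US T, ∃ y : Fin m → Euc (m+1), LinearIndependent ℝ (fun i => qm e0 (y i)) ∧ (∀ i, y i ∈ US T) ∧ (∀ i, y i + e0 ∈ US T) := by
  have hne : ∃ e0, e0 ∈ US T := by
    by_contra hcon
    push Not at hcon
    have := perfect hA hcrit (innerₗ _) (fun v hv hv1 => absurd ⟨hv, hv1⟩ (hcon v)) (T 0)
    simp only [innerₗ_apply_apply, inner_self_eq_zero] at this
    exact ((gdet_ne_zero_iff T).1 (crit_ne hcrit)).ne_zero 0 this
  obtain ⟨e0, hS0⟩ := hne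
  have hspan := span_D (US_UU hI) US_neg (fun B hB v => perfect hA hcrit B (fun v hv hv1 => hB v ⟨hv, hv1⟩) v) (US_ne hS0) hS0
  obtain ⟨k, d, hd, hdli, hds⟩ := exists_li_fin {d : Euc (m+1) ⧸ Submodule.span ℝ {e0} | ∃ y ∈ US T, y + e0 ∈ US T ∧ qm e0 y = d}
  rw [hspan] at hds
  have hk : k = m := by
    have h1 := Submodule.finrank_quotient_add_finrank (Submodule.span ℝ {e0})
    rw [finrank_span_singleton (US_ne hS0), finrank_euclideanSpace_fin, Module.finrank_eq_card_basis (Module.Basis.mk hdli hds.ge)] at h1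
    simpa using h1
  subst hk
  choose y hy hy' hyd using hd
  exact ⟨e0, hS0, y, by simp_rw [hyd]; exact hdli, hy, hy'⟩

lemma exists_y' {m : ℕ} {T : Fin (m+2) → Euc (m+2)} (hA : Adm T) (hcrit : |gdet T| = dB (m+2)) (hI : IntT T) :
    ∃ e0 ∈ US T, ∃ y : Fin (m+1) → Euc (m+2), LinearIndependent ℝ (fun i => qm e0 (y i)) ∧ (∀ i, y i ∈ US T) ∧ (∀ i, y i + e0 ∈ US T) ∧
      ∀ i, i ≠ 0 → y 0 - y i ∈ US T := by
  classical
  obtain ⟨e0, hS0, y, hli, hy, hy'⟩ := exists_y hA hcrit hI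
  have hp : ∀ i, i ≠ 0 → y 0 - y i ∈ US T ∨ y 0 + y i + e0 ∈ US T := fun i hi => pairs hA hcrit hI hS0 hli hy hy' hi.symm
  refine ⟨e0, hS0, fun i => if i = 0 ∨ y 0 - y i ∈ US T then y i else -(y i + e0), ?_, ?_, ?_, ?_⟩
  · let w : Fin (m+1) → ℝˣ := fun i => if i = 0 ∨ y 0 - y i ∈ US T then 1 else -1
    convert hli.units_smul w using 1
    funext i
    simp only [w, Pi.smul_apply']
    split_ifs
    · simp
    · rw [map_neg, map_add, qm_self, add_zero]
      simp
  · intro i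
    simp only
    split_ifs
    · exact hy i
    · exact US_neg _ (hy' i)
  · intro i
    simp only
    split_ifs
    · exact hy' i
    · convert US_neg _ (hy i) using 1; abel
  · intro i hi
    simp only [true_or, if_true, hi, false_or]
    split_ifs with h
    · exact h
    · have := (hp i hi).resolve_left h
      convert this using 1; abel

lemma inner_half {n : ℕ} {v w : Euc n} (hv : ‖v‖ = 1) (hw : ‖w‖ = 1) (h : ‖v - w‖ = 1) : ⟪v, w⟫ = 1/2 := by
  have := norm_sub_sq_real v w
  rw [hv, hw, h] at this
  linarith

lemma exists_An {m : ℕ} {T : Fin (m+2) → Euc (m+2)} (hA : Adm T) (hcrit : |gdet T| = dB (m+2)) (hI : IntT T) :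
    ∃ b : Fin (m+2) → Euc (m+2), LinearIndependent ℝ b ∧ (∀ i, b i ∈ US T) ∧ ∀ i j, i ≠ j → ⟪b i, b j⟫ = 1/2 := by
  classical
  obtain ⟨e0, hS0, y, hli, hy, hy', hyy⟩ := exists_y' hA hcrit hI
  have h0 := US_ne hS0
  have e1 : ∀ i, ⟪-e0, y i⟫ = 1/2 := by
    intro i
    apply inner_half (by rw [norm_neg]; exact hS0.2) (hy i).2
    rw [← (hy' i).2, ← norm_neg]; congr 1; abel
  have e2 : ∀ i, i ≠ 0 → ⟪y 0, y i⟫ = 1/2 := fun i hi => inner_half (hy 0).2 (hy i).2 (hyy i hi).2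
  have e3 : ∀ i j, i ≠ 0 → j ≠ 0 → i ≠ j → ⟪y i, y j⟫ = 1/2 := by
    intro i j hi hj hij
    rcases pairs hA hcrit hI hS0 hli hy hy' hij with h | h
    · exact inner_half (hy i).2 (hy j).2 h.2
    · exfalso
      have s : ∀ i, ⟪y i, y i⟫ = 1 := fun i => by rw [real_inner_self_eq_norm_sq, (hy i).2]; norm_num
      have s0 : ⟪e0, e0⟫ = 1 := by rw [real_inner_self_eq_norm_sq, hS0.2]; norm_num
      have a1 := e1 i
      have a2 := e1 j
      rw [inner_neg_left] at a1 a2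
      have n1 : ⟪y i + y j + e0, y i + y j + e0⟫ = 1 := by rw [real_inner_self_eq_norm_sq, h.2]; norm_num
      simp only [inner_add_left, inner_add_right, s, s0, real_inner_comm e0, real_inner_comm (y i) (y j)] at n1
      have c1 := real_inner_comm (y i) (y j)
      have c2 := real_inner_comm e0 (y i)
      have c3 := real_inner_comm e0 (y j)
      have z : ⟪y i, y j⟫ = 0 := by linarith
      have hw : y i + y j - y 0 ∈ US T := by
        refine ⟨Lb_sub (Lb_add (hy i).1 (hy j).1) (hy 0).1, ?_⟩
        have : ⟪y i + y j - y 0, y i + y j - y 0⟫ = 1 := by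
          simp only [inner_add_left, inner_add_right, inner_sub_left, inner_sub_right, s]
          have b1 := e2 i hi
          have b2 := e2 j hj
          have c4 := real_inner_comm (y 0) (y i)
          have c5 := real_inner_comm (y 0) (y j)
          linarith
        rw [real_inner_self_eq_norm_sq] at this
        exact (pow_eq_one_iff_of_nonneg (norm_nonneg _) two_ne_zero).1 this
      have ex : (0:ℝ) • e0 + ∑ p, ((if p = i then (1:ℝ) else 0) + (if p = j then 1 else 0) - (if p = 0 then 1 else 0)) • y p = y i + y j - y 0 := by
        simp [sub_smul, add_smul, Finset.sum_add_distrib, Finset.sum_sub_distrib, ite_smul]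
      have := coef_abs (US_UU hI) h0 hS0 hli hy hy' 0 _ (by rw [ex]; exact hw)
      have h3 : ∑ q ∈ {i, j, 0}, |((if q = i then (1:ℝ) else 0) + (if q = j then 1 else 0) - (if q = 0 then 1 else 0))| ≤ ∑ q, |((if q = i then (1:ℝ) else 0) + (if q = j then 1 else 0) - (if q = 0 then 1 else 0))| := Finset.sum_le_univ_sum_of_nonneg fun q => abs_nonneg _
      rw [Finset.sum_insert (by simp [hij, hi]), Finset.sum_pair hj] at h3
      simp [hij, hi, hj, hij.symm, hi.symm, hj.symm] at h3
      linarith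
  refine ⟨Fin.cons (-e0) y, ?_, ?_, ?_⟩
  · let w : Fin (m+2) → ℝˣ := Fin.cons (-1) (fun _ => 1)
    convert (li_cons e0 h0 hli).units_smul w using 1
    funext i
    refine Fin.cases ?_ (fun j => ?_) i
    · simp [w]
    · simp [w]
  · intro i
    refine Fin.cases ?_ (fun j => ?_) i
    · exact US_neg _ hS0
    · exact hy j
  · intro i j
    refine Fin.cases ?_ (fun i' => ?_) i <;> refine Fin.cases ?_ (fun j' => ?_) j
    · intro h; exact absurd rfl h
    · intro _; exact e1 j'
    · intro _; simp only [Fin.cons_zero, Fin.cons_succ]; rw [real_inner_comm]; exact e1 i'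
    · intro h
      have h : i' ≠ j' := fun h' => h (by rw [h'])
      simp only [Fin.cons_succ]
      by_cases hi : i' = 0
      · subst hi; exact e2 _ h.symm
      · by_cases hj : j' = 0
        · subst hj; rw [real_inner_comm]; exact e2 _ h
        · exact e3 _ _ hi hj h

lemma An_gdet {n : ℕ} {b : Fin n → Euc n} (h1 : ∀ i, ‖b i‖ = 1) (h : ∀ i j, i ≠ j → ⟪b i, b j⟫ = 1/2) : gdet b ^ 2 = (1/2)^n * (1 + n) := by
  rw [gdet_sq]
  have : gram b = (1/2 : ℝ) • (1 + Matrix.replicateCol Unit (fun _ => (1:ℝ)) * Matrix.replicateRow Unit (fun _ => (1:ℝ))) := by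
    ext i j
    by_cases hij : i = j
    · subst hij
      simp [gram, Matrix.mul_apply, h1]; norm_num
    · simp [gram, Matrix.mul_apply, h i j hij, Matrix.one_apply_ne hij]
  rw [this, Matrix.det_smul, Matrix.det_one_add_replicateCol_mul_replicateRow]
  simp [dotProduct]

lemma unimod_bound {m : ℕ} {T : Fin (m+2) → Euc (m+2)} (hA : Adm T) (hcrit : |gdet T| = dB (m+2)) (hI : IntT T) :
    (1/2)^(m+2) * (1 + ((m+2 : ℕ) : ℝ)) ≤ gdet T ^ 2 := by
  obtain ⟨b, hli, hb, hbb⟩ := exists_An hA hcrit hI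
  rw [← An_gdet (fun i => (hb i).2) hbb]
  apply sq_le_sq.2
  apply abs_gdet_le_of_subset _ (crit_ne hcrit)
  intro i
  have hx := (bas hli).sum_repr (T i)
  rw [bas_coe] at hx
  have hInt := hI _ b (fun i => (hb i).2) hli (fun i => (hb i).1) ((bas hli).repr (T i)) (by rw [hx]; exact Lb_self i)
  choose z hz using hInt
  exact ⟨z, by rw [← hx]; exact Finset.sum_congr rfl fun j _ => by rw [hz]⟩

theorem crit4 {T : Fin 4 → Euc 4} (hA : Adm T) (hcrit : |gdet T| = dB 4) : gdet T ^ 2 = 1/4 ∧ ∃ f, Frame T f := by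
  have hle : gdet T ^ 2 ≤ 1/4 := by rw [← sq_abs, hcrit]; exact dB4_le
  by_cases hD : D4type T
  · exact D4_four hA (crit_ne hcrit) hD
  · exfalso
    have hI : IntT T := by
      intro k b h1 hli hbT x hw
      have hk : k ≤ 4 := by simpa using hli.fintype_card_le_finrank
      rcases dichotomy (by omega) hA hD b h1 hli hbT x hw with h | h
      · exact h
      · omega
    have := unimod_bound hA hcrit hI
    norm_num at this
    linarith

theorem crit5 {T : Fin 5 → Euc 5} (hA : Adm T) (hcrit : |gdet T| = dB 5) : gdet T ^ 2 = 1/8 ∧ ∃ f, Frame T f := by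
  have hle : gdet T ^ 2 ≤ 1/8 := by rw [← sq_abs, hcrit]; exact dB5_le
  by_cases hD : D4type T
  · exact D4_five hA (crit_ne hcrit) hle hD
  · exfalso
    have hI : IntT T := by
      intro k b h1 hli hbT x hw
      have hk : k ≤ 5 := by simpa using hli.fintype_card_le_finrank
      rcases dichotomy hk hA hD b h1 hli hbT x hw with h | ⟨rfl, h⟩
      · exact h
      · exact (W5_false hA hcrit hle hD (W5_of h1 hli hbT x h hw)).elim
    have := unimod_bound hA hcrit hI
    norm_num at this
    linarith

lemma dB4_eq : dB 4 ^ 2 = 1/4 := by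
  obtain ⟨b, hA, hb⟩ := exists_critical 4
  rw [← hb, sq_abs]; exact (crit4 hA hb).1

lemma dB5_eq : dB 5 ^ 2 = 1/8 := by
  obtain ⟨b, hA, hb⟩ := exists_critical 5
  rw [← hb, sq_abs]; exact (crit5 hA hb).1

end

section
open scoped RealInnerProductSpace
open Metric MeasureTheory

lemma exists_frame_u (m : ℕ) (u : Euc (m+2)) (hu : ‖u‖ = 1) : ∃ f : Fin (m+2) → Euc (m+2), Orthonormal ℝ f ∧ (1/√2 : ℝ) • (f 0 + f 1) = u := by
  let e : Fin (m+2) → Euc (m+2) := fun i => EuclideanSpace.single i 1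
  let w : Euc (m+2) := (1/√2 : ℝ) • (e 0 + e 1)
  have he : Orthonormal ℝ e := std_on (m+2)
  have hw : ‖w‖ = ‖u‖ := by
    rw [hu]
    have h1 : ‖w‖^2 = 1 := by
      have : ⟪e 0, e 1⟫ = 0 := he.2 (by simp)
      simp only [w]
      rw [norm_smul, mul_pow, norm_add_sq_real, this, he.1, he.1, Real.norm_eq_abs, sq_abs, sqrt2_inv_sq]; norm_num
    exact (pow_eq_one_iff_of_nonneg (norm_nonneg _) two_ne_zero).1 h1
  let R := (ℝ ∙ (w - u))ᗮ.reflection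
  refine ⟨fun i => R (e i), ?_, ?_⟩
  · exact he.comp_linearIsometryEquiv R
  · rw [← map_add, ← map_smul]
    exact Submodule.reflection_sub hw

def smat (m : ℕ) (s : ℝ) : Matrix (Fin (m+2)) (Fin (m+2)) ℝ :=
  1 + (Matrix.of fun i (k : Fin 2) => if i = Fin.castLE (by omega) k then (1:ℝ) else 0) *
    (Matrix.of fun (k : Fin 2) j => if j = Fin.castLE (by omega) (Fin.rev k) then -s else 0)

lemma smat_det (m : ℕ) (s : ℝ) : (smat m s).det = 1 - s^2 := by
  rw [smat, Matrix.det_one_add_mul_comm, Matrix.det_fin_two]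
  have e0 : (Fin.castLE (by omega) (0 : Fin 2) : Fin (m+2)) = 0 := rfl
  have e1 : (Fin.castLE (by omega) (1 : Fin 2) : Fin (m+2)) = 1 := rfl
  have r0 : Fin.rev (0 : Fin 2) = 1 := rfl
  have r1 : Fin.rev (1 : Fin 2) = 0 := rfl
  simp only [Matrix.add_apply, Matrix.mul_apply, Matrix.of_apply, r0, r1, e0, e1]
  simp
  ring

lemma smat_apply (m : ℕ) (s : ℝ) (z : Fin (m+2) → ℝ) (i) : ∑ j, smat m s i j * z j = z i - (if i = 0 then s * z 1 else 0) - (if i = 1 then s * z 0 else 0) := by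
  simp only [smat, Matrix.add_apply, Matrix.mul_apply, Fin.sum_univ_two, Matrix.of_apply, add_mul, Finset.sum_add_distrib, Matrix.one_apply]
  have e0 : (Fin.castLE (by omega) (0 : Fin 2) : Fin (m+2)) = 0 := rfl
  have e1 : (Fin.castLE (by omega) (1 : Fin 2) : Fin (m+2)) = 1 := rfl
  have r0 : Fin.rev (0 : Fin 2) = 1 := rfl
  have r1 : Fin.rev (1 : Fin 2) = 0 := rfl
  rw [r0, r1, e0, e1]
  split_ifs with h h' <;> simp_all <;> ring

def sfr {m : ℕ} (s : ℝ) (f : Fin (m+2) → Euc (m+2)) : Fin (m+2) → Euc (m+2) := fun j => ∑ i, smat m s i j • f i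

lemma int_ineq {s : ℝ} (hs : 0 < s) (hs' : s ≤ 1/4) (a b R : ℤ) (hR : 0 ≤ R) (h2 : 2 ≤ a^2 + b^2 + R) (hex : ¬ (a * b = 1 ∧ R = 0)) :
    2 ≤ ((a:ℝ) - s * b)^2 + ((b:ℝ) - s * a)^2 + R := by
  have h2' : (2:ℝ) ≤ (a:ℝ)^2 + (b:ℝ)^2 + R := by exact_mod_cast h2
  have hR' : (0:ℝ) ≤ R := by exact_mod_cast hR
  have key : ((a:ℝ) - s * b)^2 + ((b:ℝ) - s * a)^2 + R = a^2 + b^2 + R - 4 * s * (a * b) + s^2 * (a^2 + b^2) := by ring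
  rw [key]
  have hp : 0 ≤ s^2 * ((a:ℝ)^2 + (b:ℝ)^2) := by positivity
  rcases le_or_gt (a * b) 0 with h | h
  · have h' : (a:ℝ) * b ≤ 0 := by exact_mod_cast h
    nlinarith
  · by_cases h1 : a * b = 1
    · have h1' : (a:ℝ) * b = 1 := by exact_mod_cast h1
      have hR1 : 1 ≤ R := by
        have : R ≠ 0 := fun h0 => hex ⟨h1, h0⟩
        omega
      have hR1' : (1:ℝ) ≤ R := by exact_mod_cast hR1
      rw [h1']
      nlinarith [sq_nonneg ((a:ℝ) - b)]
    · have h2 : 2 ≤ a * b := by omega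
      have h2' : (2:ℝ) ≤ (a:ℝ) * b := by exact_mod_cast h2
      nlinarith [sq_nonneg ((a:ℝ) - b)]

lemma exists_u {n : ℕ} {K : Set (Euc n)} (hK : IsSymCB K) (hKB : K ⊆ unitBall n) (hne : K ≠ unitBall n) :
    ∃ u : Euc n, ‖u‖ = 1 ∧ ∃ s : ℝ, 0 < s ∧ s ≤ 1/4 ∧ (1 - s) • u ∉ K ∧ -((1 - s) • u) ∉ K := by
  have hneg : ∀ v, v ∈ K → -v ∈ K := by
    intro v hv
    rw [← hK.symm]; simpa using hv
  have h0 : (0 : Euc n) ∈ K := by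
    obtain ⟨v, hv⟩ := hK.nonempty_interior
    have hv := interior_subset hv
    have := hK.convex hv (hneg v hv) (by norm_num : (0:ℝ) ≤ 1/2) (by norm_num : (0:ℝ) ≤ 1/2) (by norm_num)
    simpa using this
  obtain ⟨p, hpB, hpK⟩ := Set.exists_of_ssubset (hKB.ssubset_of_ne hne)
  have hp0 : p ≠ 0 := by rintro rfl; exact hpK h0
  have hpn : 0 < ‖p‖ := norm_pos_iff.2 hp0
  have hp1 : ‖p‖ ≤ 1 := by simpa [unitBall] using hpB
  have hu : (‖p‖⁻¹ • p) ∉ K := by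
    intro h
    apply hpK
    have := hK.convex h h0 hpn.le (by linarith : 0 ≤ 1 - ‖p‖) (by ring)
    rw [smul_zero, add_zero, smul_smul, mul_inv_cancel₀ hpn.ne', one_smul] at this
    exact this
  set u := ‖p‖⁻¹ • p with hudef
  have hc : Continuous fun s : ℝ => (1 - s) • u := by fun_prop
  have hop : IsOpen ((fun s : ℝ => (1 - s) • u) ⁻¹' Kᶜ) := hK.compact.isClosed.isOpen_compl.preimage hc
  obtain ⟨ε, hε, hball⟩ := Metric.isOpen_iff.1 hop 0 (by simpa using hu)
  have hmem := hball (show min (ε/2) (1/4) ∈ Metric.ball (0:ℝ) ε by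
    rw [Metric.mem_ball, dist_zero_right, Real.norm_eq_abs, abs_of_pos (by positivity)]
    exact lt_of_le_of_lt (min_le_left _ _) (by linarith))
  refine ⟨u, ?_, min (ε/2) (1/4), by positivity, min_le_right _ _, hmem, ?_⟩
  · rw [hudef, norm_smul, norm_inv, norm_norm, inv_mul_cancel₀ hpn.ne']
  · intro h
    apply hmem
    have := hneg _ h
    rwa [neg_neg] at this

lemma part1 {m : ℕ} (M : Matrix (Fin (m+2)) (Fin (m+2)) ℤ) (hM : ∀ j, Even (∑ i, M i j))
    (hd : dB (m+2) ^ 2 = (M.det : ℝ)^2 * (1/2)^(m+2)) (K : Set (Euc (m+2))) (hK : IsSymCB K) (hKB : K ⊆ unitBall (m+2)) (hne : K ≠ unitBall (m+2)) :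
    critDet K < critDet (unitBall (m+2)) := by
  obtain ⟨u, hu, s, hs, hs', hsK, hsK'⟩ := exists_u hK hKB hne
  obtain ⟨f, hf, hfu⟩ := exists_frame_u m u hu
  set c := dbas (sfr s f) M with hc
  have hdet : |gdet c| = (1 - s^2) * dB (m+2) := by
    have e : ∀ j, c j = ∑ i, (smat m s * ((1/√2 : ℝ) • M.map (Int.castRingHom ℝ))) i j • f i := by
      intro j
      simp only [hc, dbas, sfr, Finset.smul_sum, Matrix.mul_apply, Finset.sum_smul]
      rw [Finset.sum_comm]
      refine Finset.sum_congr rfl fun i _ => Finset.sum_congr rfl fun k _ => ?_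
      rw [smul_smul]; congr 1; simp; ring
    have e2 : ∀ j, dbas f M j = ∑ i, ((1/√2 : ℝ) • M.map (Int.castRingHom ℝ)) i j • f i := by
      intro j; simp [dbas, mul_comm]
    have h1 := gdet_comb f c _ e
    have h2 := gdet_comb f _ _ e2
    have h3 : |gdet (dbas f M)| = dB (m+2) := by
      rw [← abs_of_pos (dB_pos (m+2)), ← sq_eq_sq_iff_abs_eq_abs, hd, dbas_gdet hf]
    rw [h1, Matrix.det_mul, smat_det, ← h3, h2]
    rw [show gdet f * ((1 - s^2) * ((1/√2 : ℝ) • M.map (Int.castRingHom ℝ)).det) = (1 - s^2) * (gdet f * ((1/√2 : ℝ) • M.map (Int.castRingHom ℝ)).det) by ring, abs_mul, abs_of_nonneg (by nlinarith : 0 ≤ 1 - s^2)]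
  have hpos := dB_pos (m+2)
  have hlt : (1 - s^2) * dB (m+2) < dB (m+2) := by nlinarith [mul_pos (mul_pos hs hs) hpos]
  have hne0 : gdet c ≠ 0 := by
    intro h0
    rw [h0, abs_zero] at hdet
    have : 0 < (1 - s^2) * dB (m+2) := mul_pos (by nlinarith) hpos
    linarith
  refine lt_of_le_of_lt (critDet_le hne0 ?_) (hdet ▸ hlt)
  rintro v ⟨hvL, hvK⟩
  by_contra hv0
  rw [Set.mem_singleton_iff] at hv0
  have hvK' := interior_subset hvK
  have hvn : ‖v‖ < 1 := by
    have := interior_mono hKB hvK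
    rw [unitBall, interior_closedBall _ one_ne_zero] at this
    simpa using this
  obtain ⟨z, hz, hvz⟩ := dbas_mem M hM hvL
  have hz0 : z ≠ 0 := by rintro rfl; apply hv0; rw [hvz]; simp
  have hS := even_sum_sq z hz hz0
  have hv2 : v = ∑ i, ((1/√2) * ((z i : ℝ) - (if i = 0 then s * z 1 else 0) - (if i = 1 then s * z 0 else 0))) • f i := by
    rw [hvz]
    simp only [sfr, Finset.smul_sum]
    rw [Finset.sum_comm]
    refine Finset.sum_congr rfl fun i _ => ?_
    rw [← smat_apply m s (fun j => (z j : ℝ)) i, Finset.mul_sum, Finset.sum_smul]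
    refine Finset.sum_congr rfl fun k _ => ?_
    rw [smul_smul]; congr 1; ring
  have hnorm : ‖v‖^2 = 1/2 * (((z 0 : ℝ) - s * z 1)^2 + ((z 1 : ℝ) - s * z 0)^2 + ((∑ i : Fin m, z i.succ.succ ^ 2 : ℤ) : ℝ)) := by
    rw [hv2, on_norm hf]
    simp_rw [mul_pow, sqrt2_inv_sq]
    rw [← Finset.mul_sum, Fin.sum_univ_succ, Fin.sum_univ_succ]
    simp [Fin.ext_iff]
    ring
  rw [Fin.sum_univ_succ, Fin.sum_univ_succ] at hS
  by_cases hex : z 0 * z 1 = 1 ∧ (∑ i : Fin m, z i.succ.succ ^ 2) = 0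
  · obtain ⟨h1, h2⟩ := hex
    have h3 : ∀ i : Fin m, z i.succ.succ = 0 := by
      intro i
      have := (Finset.sum_eq_zero_iff_of_nonneg (fun i _ => sq_nonneg _)).1 h2 i (Finset.mem_univ i)
      simpa using this
    have hcases : (z 0 = 1 ∧ z 1 = 1) ∨ (z 0 = -1 ∧ z 1 = -1) := by
      rcases Int.eq_one_or_neg_one_of_mul_eq_one h1 with h | h
      · left; rw [h] at h1; exact ⟨h, by linarith⟩
      · right; rw [h] at h1; exact ⟨h, by linarith⟩
    rw [Fin.sum_univ_succ, Fin.sum_univ_succ] at hv2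
    have hv3 : v = ((1/√2) * ((z 0 : ℝ) - s * z 1)) • f 0 + ((1/√2) * ((z 1 : ℝ) - s * z 0)) • f 1 := by
      rw [hv2]; simp [Fin.ext_iff, h3]
    rcases hcases with ⟨ha, hb⟩ | ⟨ha, hb⟩
    · apply hsK
      convert hvK' using 1
      rw [hv3, ha, hb, ← hfu]
      push_cast
      module
    · apply hsK'
      convert hvK' using 1
      rw [hv3, ha, hb, ← hfu]
      push_cast
      module
  · have := int_ineq hs hs' (z 0) (z 1) _ (Finset.sum_nonneg fun i _ => sq_nonneg _) (by simpa [add_assoc] using hS) hex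
    nlinarith [norm_nonneg v]

theorem part1_4 (K : Set (Euc 4)) (hK : IsSymCB K) (hKB : K ⊆ unitBall 4) (hne : K ≠ unitBall 4) : critDet K < critDet (unitBall 4) :=
  part1 (m := 2) DM4 DM4_even (by rw [dB4_eq, DM4_det]; norm_num) K hK hKB hne
theorem part1_5 (K : Set (Euc 5)) (hK : IsSymCB K) (hKB : K ⊆ unitBall 5) (hne : K ≠ unitBall 5) : critDet K < critDet (unitBall 5) :=
  part1 (m := 3) DM5 DM5_even (by rw [dB5_eq, DM5_det]; norm_num) K hK hKB hne

end

section
open scoped RealInnerProductSpace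
open Metric MeasureTheory

lemma prod_bound {ι : Type*} (s : Finset ι) (q : ι → ℝ) {M : ℝ} (hM1 : M ≤ 1) (h : ∀ i, |q i| ≤ M) :
    |∑ i ∈ s, q i| ≤ s.card * M ∧ |∏ i ∈ s, (1 + q i) - 1 - ∑ i ∈ s, q i| ≤ 4 ^ s.card * M^2 := by
  classical
  induction s using Finset.induction_on with
  | empty => simp; positivity
  | insert a s ha ih =>
    rw [Finset.prod_insert ha, Finset.sum_insert ha, Finset.card_insert_of_notMem ha]
    have hM0 : 0 ≤ M := (abs_nonneg _).trans (h a)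
    constructor
    · push_cast
      calc _ ≤ |q a| + |∑ i ∈ s, q i| := abs_add_le _ _
        _ ≤ _ := by linarith [ih.1, h a]
    · have e : (1 + q a) * ∏ i ∈ s, (1 + q i) - 1 - (q a + ∑ i ∈ s, q i) = (∏ i ∈ s, (1 + q i) - 1 - ∑ i ∈ s, q i) * (1 + q a) + q a * ∑ i ∈ s, q i := by ring
      rw [e]
      have h1 : |1 + q a| ≤ 2 := by
        calc _ ≤ |1| + |q a| := abs_add_le _ _
          _ ≤ _ := by rw [abs_one]; linarith [h a]
      have hc : (s.card : ℝ) ≤ 2 * 4 ^ s.card := by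
        have h4 : s.card < 4 ^ s.card := Nat.lt_pow_self (by norm_num)
        have h4' : (s.card : ℝ) < 4 ^ s.card := by exact_mod_cast h4
        have : (0:ℝ) < 4 ^ s.card := by positivity
        linarith
      calc _ ≤ |∏ i ∈ s, (1 + q i) - 1 - ∑ i ∈ s, q i| * |1 + q a| + |q a| * |∑ i ∈ s, q i| := by
              rw [← abs_mul, ← abs_mul]; exact abs_add_le _ _
        _ ≤ (4 ^ s.card * M^2) * 2 + M * (s.card * M) := by
              gcongr
              · exact ih.2
              · exact h a
              · exact ih.1
        _ ≤ _ := by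
              rw [pow_succ (4:ℝ)]
              nlinarith [mul_le_mul_of_nonneg_right hc (sq_nonneg M)]

lemma perm_bound {n : ℕ} (A : Matrix (Fin n) (Fin n) ℝ) {M : ℝ} (hM0 : 0 ≤ M) (hM1 : M ≤ 1) (h : ∀ i j, |(A - 1) i j| ≤ M) (σ : Equiv.Perm (Fin n)) (hσ : σ ≠ 1) :
    |∏ i, A (σ i) i| ≤ 2 ^ n * M^2 := by
  classical
  obtain ⟨i0, hi0⟩ : ∃ i, σ i ≠ i := by
    by_contra hcon
    push Not at hcon
    exact hσ (Equiv.ext hcon)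
  have hj0 : σ (σ i0) ≠ σ i0 := fun h => hi0 (σ.injective h)
  rw [Finset.abs_prod]
  have hoff : ∀ i, σ i ≠ i → |A (σ i) i| ≤ M := by
    intro i hi
    have := h (σ i) i
    simpa [Matrix.one_apply_ne hi] using this
  have hall : ∀ i, |A (σ i) i| ≤ 2 := by
    intro i
    have := h (σ i) i
    have e : A (σ i) i = (A - 1) (σ i) i + (1 : Matrix (Fin n) (Fin n) ℝ) (σ i) i := by simp
    have h1 : |(1 : Matrix (Fin n) (Fin n) ℝ) (σ i) i| ≤ 1 := by
      rw [Matrix.one_apply]; split_ifs <;> simp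
    rw [e]
    exact (abs_add_le _ _).trans (by linarith)
  calc ∏ i, |A (σ i) i| ≤ ∏ i, (2 * (if i = i0 then M else 1) * (if i = σ i0 then M else 1)) := by
        apply Finset.prod_le_prod (fun i _ => abs_nonneg _)
        intro i _
        by_cases h1 : i = i0
        · have h2 : i ≠ σ i0 := by rw [h1]; exact hi0.symm
          rw [if_pos h1, if_neg h2]
          have := hoff i (by rw [h1]; exact hi0)
          linarith
        · rw [if_neg h1]
          by_cases h2 : i = σ i0
          · rw [if_pos h2]
            have := hoff i (by rw [h2]; exact hj0)
            linarith
          · rw [if_neg h2]; linarith [hall i]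
    _ = _ := by
        rw [Finset.prod_mul_distrib, Finset.prod_mul_distrib]
        simp [sq, mul_assoc]

lemma det_bound {n : ℕ} (A : Matrix (Fin n) (Fin n) ℝ) {M : ℝ} (hM0 : 0 ≤ M) (hM1 : M ≤ 1) (h : ∀ i j, |(A - 1) i j| ≤ M) :
    |A.det - 1 - ∑ i, (A - 1) i i| ≤ (4 ^ n + n.factorial * 2 ^ n) * M^2 := by
  classical
  rw [Matrix.det_apply, ← Finset.add_sum_erase _ _ (Finset.mem_univ (1 : Equiv.Perm (Fin n)))]
  have e1 : ∏ i, A ((1 : Equiv.Perm (Fin n)) i) i = ∏ i, (1 + (A - 1) i i) := by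
    refine Finset.prod_congr rfl fun i _ => ?_
    simp
  have h1 := (prod_bound Finset.univ (fun i => (A - 1) i i) hM1 (fun i => h i i)).2
  rw [Finset.card_univ, Fintype.card_fin] at h1
  have h2 : |∑ σ ∈ Finset.univ.erase (1 : Equiv.Perm (Fin n)), Equiv.Perm.sign σ • ∏ i, A (σ i) i| ≤ n.factorial * 2^n * M^2 := by
    calc _ ≤ ∑ σ ∈ Finset.univ.erase (1 : Equiv.Perm (Fin n)), |Equiv.Perm.sign σ • ∏ i, A (σ i) i| := Finset.abs_sum_le_sum_abs _ _
      _ ≤ ∑ σ ∈ Finset.univ.erase (1 : Equiv.Perm (Fin n)), (2^n * M^2) := by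
          apply Finset.sum_le_sum
          intro σ hσ
          have := perm_bound A hM0 hM1 h σ (Finset.ne_of_mem_erase hσ)
          rcases Int.units_eq_one_or (Equiv.Perm.sign σ) with hs | hs <;> rw [hs]
          · simpa using this
          · simpa using this
      _ ≤ ∑ σ : Equiv.Perm (Fin n), (2^n * M^2) := Finset.sum_le_sum_of_subset_of_nonneg (Finset.subset_univ _) (fun _ _ _ => by positivity)
      _ = _ := by
          rw [Finset.sum_const, Finset.card_univ, Fintype.card_perm, Fintype.card_fin, nsmul_eq_mul]; ring
  rw [Equiv.Perm.sign_one, one_smul, e1]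
  rw [abs_le] at *
  constructor <;> linarith [h1.1, h1.2, h2.1, h2.2]

lemma cone_inner {n : ℕ} {u y z : Euc n} (hu : ‖u‖ = 1) (hy : 9/10 * ‖y‖^2 < ⟪y, u⟫^2) (hz : 9/10 * ‖z‖^2 < ⟪z, u⟫^2) :
    8/10 * (‖y‖ * ‖z‖) ≤ |⟪y, z⟫| := by
  set α := ⟪y, u⟫ with hα
  set β := ⟪z, u⟫ with hβ
  have huu : ⟪u, u⟫ = 1 := by rw [real_inner_self_eq_norm_sq, hu]; norm_num
  have hp : ⟪y - α • u, z - β • u⟫ = ⟪y, z⟫ - α * β := by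
    simp only [inner_sub_left, inner_sub_right, real_inner_smul_left, real_inner_smul_right, huu, real_inner_comm z u]
    rw [← hα, real_inner_comm, ← hβ]; ring
  have hp1 : ‖y - α • u‖^2 = ‖y‖^2 - α^2 := by
    rw [norm_sub_sq_real, real_inner_smul_right, ← hα, norm_smul, hu, Real.norm_eq_abs, mul_one, sq_abs]; ring
  have hp2 : ‖z - β • u‖^2 = ‖z‖^2 - β^2 := by
    rw [norm_sub_sq_real, real_inner_smul_right, ← hβ, norm_smul, hu, Real.norm_eq_abs, mul_one, sq_abs]; ring
  have hcs := abs_real_inner_le_norm (y - α • u) (z - β • u)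
  rw [hp] at hcs
  have b1 : ‖y - α • u‖ * ‖z - β • u‖ ≤ 1/10 * (‖y‖ * ‖z‖) := by
    apply abs_le_of_sq_le_sq' _ (by positivity) |>.2
    rw [mul_pow, mul_pow, mul_pow, hp1, hp2]
    have : ‖y‖^2 - α^2 ≤ 1/10 * ‖y‖^2 := by linarith
    have : ‖z‖^2 - β^2 ≤ 1/10 * ‖z‖^2 := by linarith
    calc _ ≤ (1/10 * ‖y‖^2) * (1/10 * ‖z‖^2) := by
          apply mul_le_mul <;> first | assumption | positivity | skip
          rw [← hp2]; positivity
      _ = _ := by ring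
  have b2 : 9/10 * (‖y‖ * ‖z‖) ≤ |α * β| := by
    apply abs_le_of_sq_le_sq' _ (by positivity) |>.2
    rw [sq_abs, mul_pow, mul_pow, mul_pow]
    calc _ = (9/10 * ‖y‖^2) * (9/10 * ‖z‖^2) := by ring
      _ ≤ _ := by
          apply mul_le_mul hy.le hz.le <;> positivity
  have b3 : |α * β| ≤ |⟪y, z⟫| + |⟪y, z⟫ - α * β| := by
    have := abs_sub_abs_le_abs_sub (α * β) ⟪y, z⟫
    rw [abs_sub_comm] at this
    linarith
  linarith

def YY {n : ℕ} (F : Fin n → Euc n) (i j : Fin n) (ε : ℝ) : Euc n := (1/√2 : ℝ) • (F i + ε • F j)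

lemma YY_inner {n : ℕ} (F : Fin n → Euc n) (i j k l : Fin n) (ε ε' : ℝ) : ⟪YY F i j ε, YY F k l ε'⟫ =
    1/2 * (⟪F i, F k⟫ + ε' * ⟪F i, F l⟫ + ε * ⟪F j, F k⟫ + ε * ε' * ⟪F j, F l⟫) := by
  simp only [YY, real_inner_smul_left, real_inner_smul_right, inner_add_left, inner_add_right]
  have := sqrt2_inv_sq
  rw [← this]; ring

def Cone {n : ℕ} (u y : Euc n) : Prop := 9/10 * ‖y‖^2 < ⟪y, u⟫^2

/-- lower bounds for a lattice vector -/
def Good {n : ℕ} (u : Euc n) (t : ℝ) (y : Euc n) : Prop := 1 ≤ ‖y‖^2 ∨ (Cone u y ∧ 1 - t ≤ ‖y‖^2)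

lemma bad_pair {n : ℕ} (i1 j1 : Fin n) (h1 : i1 ≠ j1) {F : Fin n → Euc n} {u : Euc n} (hu : ‖u‖ = 1) {t η : ℝ} (ht : t ≤ 1/100) (ht0 : 0 ≤ t) (hη : η ≤ 1/100)
    (hF : ∀ i j, |⟪F i, F j⟫ - if i = j then 1 else 0| ≤ η)
    (hg : ∀ i j, i ≠ j → ∀ ε : ℝ, (ε = 1 ∨ ε = -1) → Good u t (YY F i j ε)) :
    ∃ i0 j0, i0 ≠ j0 ∧ ∀ i j, i ≠ j → ¬ (i = i0 ∧ j = j0) → ¬ (i = j0 ∧ j = i0) → ∀ ε : ℝ, (ε = 1 ∨ ε = -1) → 1 ≤ ‖YY F i j ε‖^2 := by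
  classical
  by_cases hex : ∃ i j ε, i ≠ j ∧ (ε = 1 ∨ ε = -1) ∧ Cone u (YY F i j ε)
  swap
  · refine ⟨i1, j1, h1, fun i j hij _ _ ε hε => ?_⟩
    rcases hg i j hij ε hε with h | h
    · exact h
    · exact absurd ⟨i, j, ε, hij, hε, h.1⟩ hex
  obtain ⟨i0, j0, ε0, hij0, hε0, hc0⟩ := hex
  refine ⟨i0, j0, hij0, fun i j hij hn1 hn2 ε hε => ?_⟩
  rcases hg i j hij ε hε with h | ⟨hc, hn⟩
  · exact h
  exfalso
  have hn0 : 1 - t ≤ ‖YY F i0 j0 ε0‖^2 := by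
    rcases hg i0 j0 hij0 ε0 hε0 with h | h
    · linarith
    · exact h.2
  have key := cone_inner hu hc hc0
  have hlow : 1 - t ≤ ‖YY F i j ε‖ * ‖YY F i0 j0 ε0‖ := by
    apply abs_le_of_sq_le_sq' _ (by positivity) |>.2
    rw [mul_pow, sq (1 - t)]
    apply mul_le_mul hn hn0 <;> first | linarith | positivity
  have habs : ∀ a b : Fin n, -η ≤ ⟪F a, F b⟫ - (if a = b then 1 else 0) ∧ ⟪F a, F b⟫ - (if a = b then 1 else 0) ≤ η := fun a b => abs_le.1 (hF a b)
  have hup : |⟪YY F i j ε, YY F i0 j0 ε0⟫| ≤ 1/2 + 2 * η := by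
    rw [YY_inner]
    have a1 := habs i i0
    have a2 := habs i j0
    have a3 := habs j i0
    have a4 := habs j j0
    rw [abs_le]
    by_cases c1 : i = i0
    · have c2 : i ≠ j0 := by rw [c1]; exact hij0
      have c3 : j ≠ i0 := by rw [← c1]; exact hij.symm
      have c4 : j ≠ j0 := fun h => hn1 ⟨c1, h⟩
      rw [if_pos c1] at a1; rw [if_neg c2] at a2; rw [if_neg c3] at a3; rw [if_neg c4] at a4
      rcases hε with rfl | rfl <;> rcases hε0 with rfl | rfl <;> constructor <;> linarith [a1.1, a1.2, a2.1, a2.2, a3.1, a3.2, a4.1, a4.2]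
    · rw [if_neg c1] at a1
      by_cases c2 : i = j0
      · have c3 : j ≠ i0 := fun h => hn2 ⟨c2, h⟩
        have c4 : j ≠ j0 := by rw [← c2]; exact hij.symm
        rw [if_pos c2] at a2; rw [if_neg c3] at a3; rw [if_neg c4] at a4
        rcases hε with rfl | rfl <;> rcases hε0 with rfl | rfl <;> constructor <;> linarith [a1.1, a1.2, a2.1, a2.2, a3.1, a3.2, a4.1, a4.2]
      · rw [if_neg c2] at a2
        by_cases c3 : j = i0
        · have c4 : j ≠ j0 := by rw [c3]; exact hij0
          rw [if_pos c3] at a3; rw [if_neg c4] at a4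
          rcases hε with rfl | rfl <;> rcases hε0 with rfl | rfl <;> constructor <;> linarith [a1.1, a1.2, a2.1, a2.2, a3.1, a3.2, a4.1, a4.2]
        · rw [if_neg c3] at a3
          by_cases c4 : j = j0
          · rw [if_pos c4] at a4
            rcases hε with rfl | rfl <;> rcases hε0 with rfl | rfl <;> constructor <;> linarith [a1.1, a1.2, a2.1, a2.2, a3.1, a3.2, a4.1, a4.2]
          · rw [if_neg c4] at a4
            rcases hε with rfl | rfl <;> rcases hε0 with rfl | rfl <;> constructor <;> linarith [a1.1, a1.2, a2.1, a2.2, a3.1, a3.2, a4.1, a4.2]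
  linarith

/-- trace bound -/
def TraceB (n : ℕ) : Prop := ∀ (d : Fin n → ℝ) (t : ℝ), 0 ≤ t → ∀ i0 j0, i0 ≠ j0 →
  (∀ i j, i ≠ j → ¬ (i = i0 ∧ j = j0) → ¬ (i = j0 ∧ j = i0) → 0 ≤ d i + d j) → (0 ≤ d i0 + d j0 + 2 * t) →
  0 ≤ ∑ i, d i ∧ ∀ i, |d i| ≤ ∑ i, d i + 5 * t

lemma traceB4 : TraceB 4 := by
  intro d t ht i0 j0 hij h hb
  obtain ⟨p, rfl, rfl⟩ := perm4 i0 j0 hij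
  rw [← Equiv.sum_comp p]
  have hp : ∀ i j : Fin 4, i ≠ j → ¬ (i = 0 ∧ j = 1) → ¬ (i = 1 ∧ j = 0) → 0 ≤ d (p i) + d (p j) := by
    intro i j hij h1 h2
    exact h _ _ (fun hh => hij (p.injective hh)) (fun hh => h1 ⟨p.injective hh.1, p.injective hh.2⟩) (fun hh => h2 ⟨p.injective hh.1, p.injective hh.2⟩)
  have h02 := hp 0 2 (by decide) (by decide) (by decide)
  have h03 := hp 0 3 (by decide) (by decide) (by decide)
  have h12 := hp 1 2 (by decide) (by decide) (by decide)
  have h13 := hp 1 3 (by decide) (by decide) (by decide)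
  have h23 := hp 2 3 (by decide) (by decide) (by decide)
  rw [Fin.sum_univ_four]
  refine ⟨by linarith, fun i => ?_⟩
  obtain ⟨i, rfl⟩ := p.surjective i
  rw [abs_le]
  fin_cases i <;> constructor <;> simp only [Fin.zero_eta, Fin.mk_one, Fin.reduceFinMk] <;> linarith

lemma traceB5 : TraceB 5 := by
  intro d t ht i0 j0 hij h hb
  obtain ⟨p, rfl, rfl⟩ := perm5 i0 j0 hij
  rw [← Equiv.sum_comp p]
  have hp : ∀ i j : Fin 5, i ≠ j → ¬ (i = 0 ∧ j = 1) → ¬ (i = 1 ∧ j = 0) → 0 ≤ d (p i) + d (p j) := by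
    intro i j hij h1 h2
    exact h _ _ (fun hh => hij (p.injective hh)) (fun hh => h1 ⟨p.injective hh.1, p.injective hh.2⟩) (fun hh => h2 ⟨p.injective hh.1, p.injective hh.2⟩)
  have h02 := hp 0 2 (by decide) (by decide) (by decide)
  have h03 := hp 0 3 (by decide) (by decide) (by decide)
  have h04 := hp 0 4 (by decide) (by decide) (by decide)
  have h12 := hp 1 2 (by decide) (by decide) (by decide)
  have h13 := hp 1 3 (by decide) (by decide) (by decide)
  have h14 := hp 1 4 (by decide) (by decide) (by decide)
  have h23 := hp 2 3 (by decide) (by decide) (by decide)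
  have h24 := hp 2 4 (by decide) (by decide) (by decide)
  have h34 := hp 3 4 (by decide) (by decide) (by decide)
  rw [Fin.sum_univ_five]
  refine ⟨by linarith, fun i => ?_⟩
  obtain ⟨i, rfl⟩ := p.surjective i
  rw [abs_le]
  fin_cases i <;> constructor <;> simp only [Fin.zero_eta, Fin.mk_one, Fin.reduceFinMk] <;> linarith

lemma no_close {n : ℕ} (hT : TraceB n) (i1 j1 : Fin n) (h1 : i1 ≠ j1) {c : ℝ} (hc : 0 < c) : ∃ η : ℝ, 0 < η ∧ ∀ t : ℝ, 0 < t → t ≤ η → ∀ u : Euc n, ‖u‖ = 1 → ∀ F : Fin n → Euc n,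
    (∀ i j, |⟪F i, F j⟫ - if i = j then 1 else 0| ≤ η) →
    (∀ i j, i ≠ j → ∀ ε : ℝ, (ε = 1 ∨ ε = -1) → Good u t (YY F i j ε)) → gdet F ^ 2 ≤ 1 - c * t → False := by
  set C : ℝ := 4 ^ n + n.factorial * 2 ^ n with hC
  have hCpos : 0 < C := by positivity
  set η : ℝ := min (1/100) (min (1 / (2 * C)) (c / (12 * C))) with hη
  have hη0 : 0 < η := by positivity
  have e1 : η ≤ 1/100 := min_le_left _ _
  have e2 : C * η ≤ 1/2 := by
    have : η ≤ 1 / (2 * C) := (min_le_right _ _).trans (min_le_left _ _)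
    calc C * η ≤ C * (1 / (2 * C)) := by gcongr
      _ = 1/2 := by field_simp
  have e3 : C * η ≤ c / 12 := by
    have : η ≤ c / (12 * C) := (min_le_right _ _).trans (min_le_right _ _)
    calc C * η ≤ C * (c / (12 * C)) := by gcongr
      _ = c/12 := by field_simp
  refine ⟨η, hη0, fun t ht0 ht u hu F hF hg hdet => ?_⟩
  obtain ⟨i0, j0, hij0, hgood⟩ := bad_pair i1 j1 h1 hu (ht.trans e1) ht0.le e1 hF hg
  set A := gram F with hA
  have hAq : ∀ i j, (A - 1) i j = ⟪F i, F j⟫ - if i = j then 1 else 0 := by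
    intro i j; simp [hA, gram, Matrix.one_apply]
  have hnorm : ∀ i j, i ≠ j → ∀ ε : ℝ, (ε = 1 ∨ ε = -1) → ‖YY F i j ε‖^2 = 1 + 1/2 * ((A - 1) i i + (A - 1) j j) + ε * (A - 1) i j := by
    intro i j hij ε hε
    rw [← real_inner_self_eq_norm_sq, YY_inner, hAq, hAq, hAq, if_pos rfl, if_pos rfl, if_neg hij, real_inner_comm (F i) (F j)]
    rcases hε with rfl | rfl <;> ring
  have hlow : ∀ i j, i ≠ j → 2 * |(A - 1) i j| ≤ (A - 1) i i + (A - 1) j j + 2 * t := by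
    intro i j hij
    have b : ∀ ε : ℝ, (ε = 1 ∨ ε = -1) → 1 - t ≤ ‖YY F i j ε‖^2 := by
      intro ε hε
      rcases hg i j hij ε hε with h | h
      · linarith
      · exact h.2
    have b1 := b 1 (Or.inl rfl)
    have b2 := b (-1) (Or.inr rfl)
    rw [hnorm i j hij _ (Or.inl rfl)] at b1
    rw [hnorm i j hij _ (Or.inr rfl)] at b2
    rcases abs_cases ((A - 1) i j) with h | h <;> linarith
  obtain ⟨htr, hd⟩ := hT (fun i => (A - 1) i i) t ht0.le i0 j0 hij0 (by
    intro i j hij hn1 hn2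
    have b1 := hgood i j hij hn1 hn2 1 (Or.inl rfl)
    have b2 := hgood i j hij hn1 hn2 (-1) (Or.inr rfl)
    rw [hnorm i j hij _ (Or.inl rfl)] at b1
    rw [hnorm i j hij _ (Or.inr rfl)] at b2
    linarith) (by
    have := hlow i0 j0 hij0
    have := abs_nonneg ((A - 1) i0 j0)
    linarith)
  set τ := ∑ i, (A - 1) i i with hτ
  set M := min η (τ + 6 * t) with hM
  have hM0 : 0 ≤ M := le_min hη0.le (by positivity)
  have hMb : ∀ i j, |(A - 1) i j| ≤ M := by
    intro i j
    refine le_min (by rw [hAq]; exact hF i j) ?_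
    by_cases hij : i = j
    · subst hij; have := hd i; linarith
    · have := hlow i j hij
      have h1 := (abs_le.1 (hd i)).2
      have h2 := (abs_le.1 (hd j)).2
      linarith
  have hb := det_bound A hM0 ((min_le_left _ _).trans (e1.trans (by norm_num))) hMb
  rw [← hC, ← gdet_sq] at hb
  have hb' := (abs_le.1 hb).1
  have hMM : C * M^2 ≤ C * η * (τ + 6 * t) := by
    rw [sq, mul_assoc]
    gcongr
    · exact min_le_left _ _
    · exact min_le_right _ _
  have p1 : C * η * τ ≤ 1/2 * τ := mul_le_mul_of_nonneg_right e2 htr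
  have p2 : C * η * t ≤ c / 12 * t := mul_le_mul_of_nonneg_right e3 ht0.le
  have p3 : 0 < c * t := mul_pos hc ht0
  nlinarith

end

section
open scoped RealInnerProductSpace
open Metric MeasureTheory

def KK {n : ℕ} (u : Euc n) (t : ℝ) : Set (Euc n) :=
  {y | ‖y‖^2 ≤ 1 ∧ (1 - 9/10 * t) * ‖y‖^2 + t * ⟪y, u⟫^2 ≤ 1}

lemma inner_sq_le {n : ℕ} {u : Euc n} (hu : ‖u‖ = 1) (y : Euc n) : ⟪y, u⟫^2 ≤ ‖y‖^2 := by
  have := abs_real_inner_le_norm y u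
  rw [hu, mul_one] at this
  rw [← sq_abs]
  gcongr

lemma KK_sub {n : ℕ} (u : Euc n) (t : ℝ) : KK u t ⊆ unitBall n := by
  intro y hy
  have := hy.1
  simp only [unitBall, mem_closedBall, dist_zero_right]
  exact (sq_le_one_iff₀ (norm_nonneg _)).1 this

lemma KK_sup {n : ℕ} {u : Euc n} (hu : ‖u‖ = 1) {t : ℝ} (ht0 : 0 < t) (ht : t ≤ 1/2) {y : Euc n} (hy : ‖y‖ ≤ 1 - t) : y ∈ KK u t := by
  have h1 : ‖y‖^2 ≤ (1 - t)^2 := by gcongr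
  have h2 := inner_sq_le hu y
  have h3 := norm_nonneg y
  refine ⟨by nlinarith, ?_⟩
  have : t * ⟪y, u⟫^2 ≤ t * ‖y‖^2 := by gcongr
  have h4 : (1 + t/10) * ‖y‖^2 ≤ (1 + t/10) * (1 - t)^2 := by gcongr
  nlinarith [mul_pos ht0 ht0, mul_pos (mul_pos ht0 ht0) ht0]

lemma KK_sym {n : ℕ} {u : Euc n} (hu : ‖u‖ = 1) {t : ℝ} (ht0 : 0 < t) (ht : t ≤ 1/2) : IsSymCB (KK u t) := by
  have c1 : ConvexOn ℝ Set.univ (fun y : Euc n => ‖y‖^2) := convexOn_univ_norm.pow (fun _ _ => norm_nonneg _) 2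
  have c2 : ConvexOn ℝ Set.univ (fun y : Euc n => ⟪y, u⟫^2) := by
    have := (even_two.convexOn_pow (𝕜 := ℝ)).comp_linearMap (innerₗ (Euc n) u)
    have e : (fun y : Euc n => ⟪y, u⟫^2) = (fun x : ℝ => x^2) ∘ (innerₗ (Euc n) u) := by
      funext y
      simp [real_inner_comm]
    rw [e]
    simpa using this
  have c3 : ConvexOn ℝ Set.univ (fun y : Euc n => (1 - 9/10 * t) * ‖y‖^2 + t * ⟪y, u⟫^2) :=
    (c1.smul (by linarith : 0 ≤ 1 - 9/10 * t)).add (c2.smul ht0.le)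
  refine ⟨?_, ?_, ?_, ?_⟩
  · have := (c1.convex_le 1).inter (c3.convex_le 1)
    convert this using 1
    ext y; simp [KK]
  · apply (isCompact_closedBall (0 : Euc n) 1).of_isClosed_subset _ (KK_sub u t)
    have o1 : IsClosed {y : Euc n | ‖y‖^2 ≤ 1} := isClosed_le (by fun_prop) (by fun_prop)
    have o2 : IsClosed {y : Euc n | (1 - 9/10 * t) * ‖y‖^2 + t * ⟪y, u⟫^2 ≤ 1} := isClosed_le (by fun_prop) (by fun_prop)
    exact o1.inter o2
  · refine ⟨0, ?_⟩
    rw [mem_interior]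
    refine ⟨ball 0 (1 - t), fun y hy => KK_sup hu ht0 ht ?_, isOpen_ball, by simp; linarith⟩
    rw [mem_ball, dist_zero_right] at hy
    exact hy.le
  · ext y; simp [KK]

lemma KK_haus {n : ℕ} {u : Euc n} (hu : ‖u‖ = 1) {t : ℝ} (ht0 : 0 < t) (ht : t ≤ 1/2) : hausdorffDist (KK u t) (unitBall n) ≤ t := by
  apply hausdorffDist_le_of_mem_dist ht0.le
  · intro x hx
    exact ⟨x, KK_sub u t hx, by simp [ht0.le]⟩
  · intro x hx
    have hx : ‖x‖ ≤ 1 := by simpa [unitBall] using hx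
    refine ⟨(1 - t) • x, KK_sup hu ht0 ht ?_, ?_⟩
    · rw [norm_smul, Real.norm_eq_abs, abs_of_nonneg (by linarith)]
      nlinarith [norm_nonneg x]
    · have : x - (1 - t) • x = t • x := by module
      rw [dist_eq_norm, this, norm_smul, Real.norm_eq_abs, abs_of_pos ht0]
      nlinarith [norm_nonneg x]

lemma KK_good {n : ℕ} {u : Euc n} (hu : ‖u‖ = 1) {t : ℝ} (ht0 : 0 < t) {L : Set (Euc n)} (hL : IsAdmissible L (KK u t)) :
    ∀ v ∈ L, v ≠ 0 → Good u t v := by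
  intro v hv hv0
  rcases le_or_gt 1 (‖v‖^2) with h | h
  · exact Or.inl h
  right
  have hq : 1 ≤ (1 - 9/10 * t) * ‖v‖^2 + t * ⟪v, u⟫^2 := by
    by_contra hcon
    push Not at hcon
    apply hv0
    apply hL
    refine ⟨hv, ?_⟩
    rw [mem_interior]
    refine ⟨{y | ‖y‖^2 < 1 ∧ (1 - 9/10 * t) * ‖y‖^2 + t * ⟪y, u⟫^2 < 1}, fun y hy => ⟨hy.1.le, hy.2.le⟩, ?_, ⟨h, hcon⟩⟩
    have o1 : IsOpen {y : Euc n | ‖y‖^2 < 1} := isOpen_lt (by fun_prop) (by fun_prop)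
    have o2 : IsOpen {y : Euc n | (1 - 9/10 * t) * ‖y‖^2 + t * ⟪y, u⟫^2 < 1} := isOpen_lt (by fun_prop) (by fun_prop)
    exact o1.inter o2
  have hi := inner_sq_le hu v
  constructor
  · unfold Cone
    have : 0 < t * (⟪v, u⟫^2 - 9/10 * ‖v‖^2) := by nlinarith
    have := pos_of_mul_pos_right this ht0.le
    linarith
  · have : t * ⟪v, u⟫^2 ≤ t * ‖v‖^2 := by gcongr
    nlinarith [sq_nonneg ‖v‖]

open scoped Pointwise in
lemma KK_vol {n : ℕ} (hn : 2 ≤ n) {u : Euc n} (hu : ‖u‖ = 1) : ∃ c : ℝ, 0 < c ∧ ∀ t : ℝ, 0 < t → t ≤ 1/2 →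
    (volume (KK u t)).toReal ≤ (1 - c * t) * (volume (unitBall n)).toReal := by
  set C : Set (Euc n) := {y | 19/20 * ‖y‖^2 ≤ ⟪y, u⟫^2} with hC
  have hCc : IsClosed C := isClosed_le (by fun_prop) (by fun_prop)
  have hBfin : volume (unitBall n) ≠ ⊤ := measure_closedBall_lt_top.ne
  have fin : ∀ s, s ⊆ unitBall n → volume s ≠ ⊤ := fun s hs => ((measure_mono hs).trans_lt hBfin.lt_top).ne
  set V := volume.real (unitBall n) with hV
  set W := volume.real (unitBall n ∩ C) with hW
  have hWpos : 0 < W := by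
    rw [hW, measureReal_def]
    refine ENNReal.toReal_pos (ne_of_gt ?_) (fin _ Set.inter_subset_left)
    let O : Set (Euc n) := {y | ‖y‖ < 1 ∧ 19/20 * ‖y‖^2 < ⟪y, u⟫^2}
    have o1 : IsOpen {y : Euc n | ‖y‖ < 1} := isOpen_lt (by fun_prop) (by fun_prop)
    have o2 : IsOpen {y : Euc n | 19/20 * ‖y‖^2 < ⟪y, u⟫^2} := isOpen_lt (by fun_prop) (by fun_prop)
    have hO : IsOpen O := o1.inter o2
    refine lt_of_lt_of_le (hO.measure_pos volume ⟨(1/2 : ℝ) • u, ?_⟩) (measure_mono fun y hy => ⟨?_, hy.2.le⟩)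
    · constructor
      · rw [norm_smul, hu]; norm_num
      · rw [norm_smul, hu, real_inner_smul_left, real_inner_self_eq_norm_sq, hu]; norm_num
    · simp only [unitBall, mem_closedBall, dist_zero_right]; exact hy.1.le
  have hVpos : 0 < V := hWpos.trans_le (measureReal_mono Set.inter_subset_left hBfin)
  refine ⟨W / (40 * V), by positivity, fun t ht0 ht => ?_⟩
  set r : ℝ := (√(1 + t/20))⁻¹ with hr
  have hr0 : 0 < r := by positivity
  have hr2 : r^2 * (1 + t/20) = 1 := by
    rw [hr, inv_pow, Real.sq_sqrt (by positivity)]; field_simp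
  have hr1 : r ≤ 1 := by
    by_contra hcon
    push Not at hcon
    nlinarith
  have hsub : KK u t ∩ C ⊆ r • (unitBall n ∩ C) := by
    rintro y ⟨hy, hyC⟩
    rw [Set.mem_smul_set_iff_inv_smul_mem₀ hr0.ne']
    have hyC' : 19/20 * ‖y‖^2 ≤ ⟪y, u⟫^2 := hyC
    constructor
    · simp only [unitBall, mem_closedBall, dist_zero_right]
      rw [norm_smul, norm_inv, Real.norm_eq_abs, abs_of_pos hr0, inv_mul_le_one₀ hr0]
      apply abs_le_of_sq_le_sq' _ hr0.le |>.2
      have h1 := hy.2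
      have : t * (19/20 * ‖y‖^2) ≤ t * ⟪y, u⟫^2 := by gcongr
      have h2 : ‖y‖^2 * (1 + t/20) ≤ r^2 * (1 + t/20) := by rw [hr2]; linarith
      exact le_of_mul_le_mul_right h2 (by positivity)
    · show 19/20 * ‖r⁻¹ • y‖^2 ≤ ⟪r⁻¹ • y, u⟫^2
      rw [norm_smul, real_inner_smul_left, mul_pow, mul_pow, Real.norm_eq_abs, sq_abs]
      have := mul_le_mul_of_nonneg_left hyC' (sq_nonneg r⁻¹)
      linarith
  have s1 : volume.real (KK u t ∩ C) ≤ r^n * W := by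
    have e : volume.real (r • (unitBall n ∩ C)) = r^n * W := by
      rw [measureReal_def, Measure.addHaar_smul, ENNReal.toReal_mul, finrank_euclideanSpace_fin, ENNReal.toReal_ofReal (abs_nonneg _), abs_of_pos (by positivity)]
      rfl
    rw [← e]
    have e2 : volume (r • (unitBall n ∩ C)) ≠ ⊤ := by
      rw [Measure.addHaar_smul]
      exact ENNReal.mul_ne_top ENNReal.ofReal_ne_top (fin _ Set.inter_subset_left)
    exact measureReal_mono hsub e2
  have s2 : volume.real (KK u t \ C) ≤ volume.real (unitBall n \ C) :=
    measureReal_mono (Set.sdiff_subset_sdiff_left (KK_sub u t)) (fin _ Set.sdiff_subset)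
  have s3 : volume.real (KK u t ∩ C) + volume.real (KK u t \ C) = volume.real (KK u t) :=
    measureReal_inter_add_sdiff hCc.measurableSet (fin _ (KK_sub u t))
  have s4 : W + volume.real (unitBall n \ C) = V :=
    measureReal_inter_add_sdiff hCc.measurableSet hBfin
  have s5 : r^n ≤ 1 - t/40 := by
    calc r^n ≤ r^2 := pow_le_pow_of_le_one hr0.le hr1 hn
      _ ≤ _ := by nlinarith [sq_nonneg r]
  have s6 : r^n * W ≤ (1 - t/40) * W := by gcongr
  change volume.real (KK u t) ≤ (1 - W / (40 * V) * t) * V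
  have s7 : (1 - W / (40 * V) * t) * V = V - t/40 * W := by field_simp
  rw [s7]
  linarith

end

section
open scoped RealInnerProductSpace
open Metric MeasureTheory

lemma exists_dense {n : ℕ} {u : Euc n} (hu : ‖u‖ = 1) {c t : ℝ} (hc : 0 < c) (ht0 : 0 < t)
    (hv : (volume (KK u t)).toReal ≤ (1 - c * t) * (volume (unitBall n)).toReal)
    (hp : ¬ packFrac (KK u t) < packFrac (unitBall n)) :
    ∃ b : Fin n → Euc n, gdet b ≠ 0 ∧ (∀ v ∈ Lb b, v ≠ 0 → Good u t v) ∧ |gdet b| ≤ dB n * (1 - c/2 * t) := by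
  have hV : 0 < (volume (unitBall n)).toReal :=
    ENNReal.toReal_pos (measure_closedBall_pos _ _ one_pos).ne' measure_closedBall_lt_top.ne
  set V := (volume (unitBall n)).toReal with hVd
  set W := (volume (KK u t)).toReal with hWd
  have hd : 0 < critDet (unitBall n) := dB_pos n
  have hD0 : 0 ≤ critDet (KK u t) := by
    rw [critDet_eq]
    apply Real.sInf_nonneg
    rintro d ⟨b, _, _, rfl⟩
    positivity
  simp only [packFrac] at hp
  rw [← hVd, ← hWd] at hp
  have hD : 0 < critDet (KK u t) := by
    rcases hD0.lt_or_eq with h | h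
    · exact h
    · exfalso; apply hp
      rw [← h]; simp only [mul_zero, div_zero]; positivity
  push Not at hp
  rw [div_le_div_iff₀ (by positivity) (by positivity)] at hp
  have h2 : (0:ℝ) < 2^n := by positivity
  have hp' : V * critDet (KK u t) ≤ W * critDet (unitBall n) := by
    have : 2^n * (V * critDet (KK u t)) ≤ 2^n * (W * critDet (unitBall n)) := by linarith
    exact le_of_mul_le_mul_left this h2
  have h3 : W * critDet (unitBall n) ≤ (1 - c * t) * V * critDet (unitBall n) := by gcongr
  have h4 : critDet (KK u t) ≤ (1 - c * t) * critDet (unitBall n) := by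
    have : V * critDet (KK u t) ≤ V * ((1 - c * t) * critDet (unitBall n)) := by linarith
    exact le_of_mul_le_mul_left this hV
  have h5 : critDet (KK u t) < critDet (unitBall n) * (1 - c/2 * t) := by
    have : 0 < c * t * critDet (unitBall n) := by positivity
    linarith
  rw [critDet_eq] at h5 hD
  have hne : {d | ∃ b : Fin n → Euc n, gdet b ≠ 0 ∧ IsAdmissible (Lb b) (KK u t) ∧ d = |gdet b|}.Nonempty := by
    by_contra hcon
    rw [Set.not_nonempty_iff_eq_empty] at hcon
    rw [hcon] at hD
    simp at hD
  obtain ⟨d, ⟨b, hb, hA, rfl⟩, hlt⟩ := exists_lt_of_csInf_lt hne h5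
  exact ⟨b, hb, KK_good hu ht0 hA, hlt.le⟩

lemma no_seq {n : ℕ} (hn2 : 2 ≤ n) (hT : TraceB n)
    (hcr : ∀ a : Fin n → Euc n, Adm a → |gdet a| = dB n → ∃ f, Frame a f)
    {u : Euc n} (hu : ‖u‖ = 1) {c : ℝ} (hc : 0 < c) (t : ℕ → ℝ) (ht0 : ∀ k, 0 < t k) (ht : ∀ k, t k ≤ 1/2)
    (htt : Filter.Tendsto t Filter.atTop (nhds 0)) (b : ℕ → Fin n → Euc n) (hb : ∀ k, gdet (b k) ≠ 0)
    (hg : ∀ k, ∀ v ∈ Lb (b k), v ≠ 0 → Good u (t k) v) (hd : ∀ k, |gdet (b k)| ≤ dB n * (1 - c * t k)) : False := by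
  have hdp := dB_pos n
  have hd' : ∀ k, |gdet (b k)| ≤ dB n := fun k => (hd k).trans (by
    have : 0 < dB n * (c * t k) := mul_pos hdp (mul_pos hc (ht0 k))
    linarith)
  obtain ⟨b', φ, a, hφ, hL, hlim, ha, hA⟩ := mahler_seq b (fun k => 1 - t k) (dB n) hb
    (fun k => by linarith [ht k]) (by simpa using htt.const_sub 1) (fun k v hv hv0 => by
      have h1 : 1 - t k ≤ ‖v‖^2 := by
        rcases hg k v hv hv0 with h | h
        · linarith [ht0 k]
        · exact h.2
      by_contra hcon
      push Not at hcon
      nlinarith [norm_nonneg v, ht0 k]) hd'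
  have hgd : ∀ k, |gdet (b' k)| = |gdet (b k)| := fun k => (abs_gdet_eq (hL k).symm (hb k)).symm
  have hcrit : |gdet a| = dB n := by
    apply le_antisymm _ (dB_le ha hA)
    have : Filter.Tendsto (fun k => |gdet (b' (φ k))|) Filter.atTop (nhds |gdet a|) :=
      ((continuous_gdet.tendsto a).comp hlim).abs
    exact le_of_tendsto' this (fun k => by rw [hgd]; exact hd' _)
  obtain ⟨f, hf, hfr⟩ := hcr a hA hcrit
  have hli := (gdet_ne_zero_iff a).1 ha
  set B := bas hli with hB
  let L : ℕ → (Euc n →ₗ[ℝ] Euc n) := fun k => B.constr ℝ (b' (φ k))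
  have hLa : ∀ k, (fun i => L k (a i)) = b' (φ k) := by
    intro k; funext i
    have : a i = B i := by rw [hB, bas_coe]
    rw [this]
    exact B.constr_basis ℝ _ i
  have hLL : ∀ k, ∀ v ∈ Lb a, L k v ∈ Lb (b (φ k)) := by
    intro k v hv
    rw [← hL, ← hLa, Lb_map]
    exact ⟨v, hv, rfl⟩
  have hdet : ∀ k, gdet (b' (φ k)) = LinearMap.det (L k) * gdet a := fun k => by
    rw [← gdet_map, hLa]
  have hdet0 : ∀ k, LinearMap.det (L k) ≠ 0 := fun k h => by
    have h1 := hdet k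
    rw [h, zero_mul] at h1
    have h2 := hgd (φ k)
    rw [h1, abs_zero] at h2
    exact hb _ (abs_eq_zero.1 h2.symm)
  have hinj : ∀ k v, L k v = 0 → v = 0 := fun k v hv => by
    have h1 := (LinearMap.equivOfDetNeZero (L k) (hdet0 k)).injective
    apply h1
    rw [map_zero]
    exact hv
  have hconv : ∀ i, Filter.Tendsto (fun k => L k (f i)) Filter.atTop (nhds (f i)) := by
    intro i
    have e : ∀ k, L k (f i) = ∑ j, B.repr (f i) j • b' (φ k) j := fun k => by
      show B.constr ℝ (b' (φ k)) (f i) = _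
      exact B.constr_apply_fintype ℝ _ _
    simp only [e]
    have e2 : f i = ∑ j, B.repr (f i) j • a j := by
      conv_lhs => rw [← B.sum_repr (f i)]
      rw [hB, bas_coe]
    conv => rhs; rw [e2]
    apply tendsto_finsetSum
    intro j _
    exact ((tendsto_pi_nhds.1 hlim) j).const_smul _
  obtain ⟨η, hη, hno⟩ := no_close hT ⟨0, by omega⟩ ⟨1, by omega⟩ (by simp) hc
  have hev1 : ∀ᶠ k in Filter.atTop, t (φ k) ≤ η :=
    (htt.comp hφ.tendsto_atTop).eventually (Iic_mem_nhds hη)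
  have hev2 : ∀ᶠ k in Filter.atTop, ∀ i j, |⟪L k (f i), L k (f j)⟫ - if i = j then (1:ℝ) else 0| ≤ η := by
    rw [Filter.eventually_all]; intro i
    rw [Filter.eventually_all]; intro j
    have h1 := (((hconv i).inner (𝕜 := ℝ) (hconv j)).sub_const (if i = j then (1:ℝ) else 0)).abs
    rw [orthonormal_iff_ite.1 hf, sub_self, abs_zero] at h1
    exact h1.eventually (Iic_mem_nhds hη)
  obtain ⟨k, hk1, hk2⟩ := (hev1.and hev2).exists
  refine hno (t (φ k)) (ht0 _) hk1 u hu (fun i => L k (f i)) hk2 ?_ ?_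
  · intro i j hij ε hε
    have hY : YY (fun i => L k (f i)) i j ε = L k (YY f i j ε) := by simp [YY]
    have hmem : YY f i j ε ∈ Lb a := by
      rcases hε with rfl | rfl
      · simpa [YY] using (hfr i j hij).1
      · simpa [YY, sub_eq_add_neg] using (hfr i j hij).2
    have hne : YY f i j ε ≠ 0 := by
      intro h0
      have h1 := YY_inner f i j i j ε ε
      rw [h0, inner_zero_left] at h1
      simp only [orthonormal_iff_ite.1 hf, hij, hij.symm, if_true, if_false] at h1
      rcases hε with rfl | rfl <;> norm_num at h1
    rw [hY]
    exact hg _ _ (hLL k _ hmem) (fun h => hne (hinj k _ h))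
  · rw [gdet_map, mul_pow, on_gdet hf, mul_one]
    have h1 := hd (φ k)
    rw [← hgd, hdet, abs_mul, hcrit, mul_comm] at h1
    have h2 : |LinearMap.det (L k)| ≤ 1 - c * t (φ k) := le_of_mul_le_mul_left h1 hdp
    have h3 := abs_nonneg (LinearMap.det (L k))
    have h4 := mul_pos hc (ht0 (φ k))
    rw [← sq_abs]
    nlinarith

lemma part2 {n : ℕ} (hn2 : 2 ≤ n) (hT : TraceB n)
    (hcr : ∀ a : Fin n → Euc n, Adm a → |gdet a| = dB n → ∃ f, Frame a f) (ε : ℝ) (hε : 0 < ε) :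
    ∃ K : Set (Euc n), IsSymCB K ∧ hausdorffDist K (unitBall n) < ε ∧ packFrac K < packFrac (unitBall n) := by
  by_contra hcon
  push Not at hcon
  set u : Euc n := EuclideanSpace.single ⟨0, by omega⟩ 1 with hud
  have hu : ‖u‖ = 1 := by simp [hud]
  obtain ⟨c, hc, hv⟩ := KK_vol hn2 hu
  set s : ℝ := min (1/2) (ε/2) with hs
  have hs0 : 0 < s := by positivity
  have hs1 : s ≤ 1/2 := min_le_left _ _
  have hs2 : s ≤ ε/2 := min_le_right _ _
  let t : ℕ → ℝ := fun k => s * (1 / ((k:ℝ) + 1))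
  have ht0 : ∀ k, 0 < t k := fun k => by positivity
  have hts : ∀ k, t k ≤ s := fun k => by
    have : 1 / ((k:ℝ) + 1) ≤ 1 := by
      rw [div_le_one (by positivity)]
      linarith [Nat.cast_nonneg (α := ℝ) k]
    calc s * (1 / ((k:ℝ) + 1)) ≤ s * 1 := by gcongr
      _ = s := mul_one s
  have htt : Filter.Tendsto t Filter.atTop (nhds 0) := by
    have := (tendsto_one_div_add_atTop_nhds_zero_nat (𝕜 := ℝ)).const_mul s
    rw [mul_zero] at this
    exact this
  have key : ∀ k, ∃ b : Fin n → Euc n, gdet b ≠ 0 ∧ (∀ v ∈ Lb b, v ≠ 0 → Good u (t k) v) ∧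
      |gdet b| ≤ dB n * (1 - c/2 * t k) := fun k => by
    have h1 : t k ≤ 1/2 := (hts k).trans hs1
    apply exists_dense hu hc (ht0 k) (hv _ (ht0 k) h1)
    apply not_lt.2
    apply hcon _ (KK_sym hu (ht0 k) h1)
    have := KK_haus hu (ht0 k) h1
    linarith [hts k]
  choose b hb hg hd using key
  exact no_seq hn2 hT hcr hu (half_pos hc) t ht0 (fun k => (hts k).trans hs1) htt b hb hg hd

end

/-- Corollary 3.8: for `n ∈ {4, 5}` the unit ball `Bⁿ` is irreducible
but not a local pessimum for lattice packing. -/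
theorem ball_irreducible_not_pessimum_4_5 (n : ℕ) (hn : n = 4 ∨ n = 5) :
    (∀ K : Set (Euc n), IsSymCB K → K ⊆ unitBall n → K ≠ unitBall n →
      critDet K < critDet (unitBall n)) ∧
    (∀ ε > (0 : ℝ), ∃ K : Set (Euc n), IsSymCB K ∧
      Metric.hausdorffDist K (unitBall n) < ε ∧
      packFrac K < packFrac (unitBall n)) := by
  rcases hn with rfl | rfl
  · exact ⟨part1_4, fun ε hε => part2 (by norm_num) traceB4 (fun a h h2 => (crit4 h h2).2) ε hε⟩
  · exact ⟨part1_5, fun ε hε => part2 (by norm_num) traceB5 (fun a h h2 => (crit5 h h2).2) ε hε⟩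

end
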